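/- (Goldston–Pintz–Yildirim, Theorem 3.4) One has Δ_1 := liminf_{n→∞} (p_{n+1} − p_n)/log p_n = 0. -/

import Mathlib

set_option linter.all false
open Real Filter
/-- `nthPrime n` is the `n`-th prime number `p_n` (so `p_1 = 2`, `p_2 = 3`, ...). -/
noncomputable def nthPrime (n : ℕ) : ℕ := Nat.nth Nat.Prime (n - 1)

section
open Finset
theorem abel_mono {E : Type*} [NormedAddCommGroup E] [NormedSpace ℝ E] (f : ℕ → E) (w : ℕ → ℝ)
    (K : ℝ) (a : ℕ) (hK : ∀ n, ‖∑ i ∈ Ico a n, f i‖ ≤ K) (hw : ∀ i ≥ a, w (i +1) ≤ w i)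
    (h0 : ∀ i ≥ a, 0 ≤ w i) (n : ℕ) : ‖∑ i ∈ Ico a n, w i • f i‖ ≤ K * w a := by
  have hK0 :0 ≤ K := (norm_nonneg _).trans (hK 0)
  rcases lt_or_ge n a with h | h
  · simp [Ico_eq_empty_of_le h.le, mul_nonneg hK0 (h0 a le_rfl)]
  have tel : ∑ i ∈ Ico a n, (w i - w (i +1)) = w a - w n := by
    induction n, h using Nat.le_induction with
    | base => simp
    | succ n hn ih => rw [sum_Ico_succ_top hn, ih]; ring
  have key : ∑ i ∈ Ico a n, w i • f i
      = w n • ∑ i ∈ Ico a n, f i + ∑ i ∈ Ico a n, (w i - w (i +1)) • ∑ j ∈ Ico a (i +1), f j := by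
    clear tel
    induction n, h using Nat.le_induction with
    | base => simp
    | succ n hn ih =>
      rw [sum_Ico_succ_top hn, ih, sum_Ico_succ_top hn, sum_Ico_succ_top hn (fun i => (w i - w (i+1)) • ∑ j ∈ Ico a (i +1), f j), sum_Ico_succ_top hn]
      simp only [smul_add, sub_smul]; abel
  rw [key]
  calc _ ≤ ‖w n • ∑ i ∈ Ico a n, f i‖ + ∑ i ∈ Ico a n, ‖(w i - w (i +1)) • ∑ j ∈ Ico a (i +1), f j‖ :=
        (norm_add_le _ _).trans (add_le_add_right (norm_sum_le _ _) _)
    _ ≤ w n * K + ∑ i ∈ Ico a n, (w i - w (i +1)) * K := by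
        gcongr with i hi
        · rw [norm_smul, Real.norm_of_nonneg (h0 n h)]
          exact mul_le_mul_of_nonneg_left (hK n) (h0 n h)
        · have := sub_nonneg.2 (hw i (mem_Ico.1 hi).1)
          rw [norm_smul, Real.norm_of_nonneg this]
          exact mul_le_mul_of_nonneg_left (hK _) this
    _ = K * w a := by rw [← sum_mul, tel]; ring

theorem per_sum {E : Type*} [NormedAddCommGroup E] {q : ℕ} [NeZero q] (f : ZMod q → E)
    (h0 : ∑ x, f x =0) (B : ℝ) (hb : ∀ x, ‖f x‖ ≤ B) (a b : ℕ) :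
    ‖∑ i ∈ Ico a b, f (i : ZMod q)‖ ≤ q * B := by
  have hq :0 < q := NeZero.pos q
  have hB :0 ≤ B := (norm_nonneg _).trans (hb 0)
  have per : ∀ a : ℕ, ∑ i ∈ Ico a (a + q), f (i : ZMod q) =0 := by
    intro a
    rw [← h0]
    refine sum_bij (fun i _ => (i : ZMod q)) (by simp) ?_ ?_ (by simp)
    · intro i hi j hj h
      rw [ZMod.natCast_eq_natCast_iff] at h
      simp only [mem_Ico] at hi hj
      rcases le_total i j with hij | hij
      · have := (Nat.modEq_iff_dvd' hij).1 h
        have := Nat.eq_zero_of_dvd_of_lt this (by omega); omega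
      · have := (Nat.modEq_iff_dvd' hij).1 h.symm
        have := Nat.eq_zero_of_dvd_of_lt this (by omega); omega
    · intro x _
      refine ⟨a + (x - a).val, by simp [ZMod.val_lt], by simp⟩
  induction hn : b - a using Nat.strong_induction_on generalizing a with
  | _ n ih =>
    rcases lt_or_ge (b - a) q with h | h
    · calc _ ≤ ∑ i ∈ Ico a b, ‖f (i : ZMod q)‖ := norm_sum_le _ _
        _ ≤ ∑ i ∈ Ico a b, B := sum_le_sum fun i _ => hb _
        _ = (b - a : ℕ) * B := by simp
        _ ≤ q * B := by gcongr
    · rw [← sum_Ico_consecutive _ (Nat.le_add_right a q) (by omega : a + q ≤ b), per, zero_add]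
      exact ih (b - (a + q)) (by omega) _ rfl

noncomputable def trn (f : ℕ → ℂ) (M : ℕ) (k : ℕ) : ℂ := if M ≤ k then f k else 0

noncomputable def tlS (f : ℕ → ℂ) (M : ℕ) (t : ℝ) : ℂ := ∑ k ∈ Icc 1 ⌊t⌋₊, trn f M k

theorem LSer_rep (f : ℕ → ℂ) (hf : ∀ n, ‖f n‖ ≤1) (M : ℕ) {s : ℂ} (hs :1 < s.re) :
    LSeries f s = ∑ n ∈ Ico 1 M, f n * (n : ℂ) ^ (-s)
      + s * ∫ t in Set.Ioi (1 : ℝ), tlS f M t * (t : ℂ) ^ (-(s +1)) := by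
  have hb : ∀ k, ‖trn f M k‖ ≤1 := by
    intro k; unfold trn; split_ifs; exacts [hf k, by simp]
  have hs1 : LSeriesSummable f s :=
    LSeriesSummable_of_bounded_of_one_lt_re (m :=1) (fun n _ => hf n) hs
  have hs2 : LSeriesSummable (trn f M) s :=
    LSeriesSummable_of_bounded_of_one_lt_re (m :=1) (fun n _ => hb n) hs
  have h1 := LSeries_eq_mul_integral (trn f M) (r :=1) zero_le_one hs hs2 (by
    refine Asymptotics.IsBigO.of_bound 1 (Filter.Eventually.of_forall fun n => ?_)
    calc _ ≤ ∑ k ∈ Icc 1 n, ‖trn f M k‖ := norm_sum_le _ _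
      _ ≤ ∑ k ∈ Icc 1 n, (1 : ℝ) := sum_le_sum fun k _ => hb k
      _ ≤ _ := by simp)
  unfold tlS
  rw [← h1, ← sub_eq_iff_eq_add, ← LSeries_sub hs1 hs2, LSeries]
  rw [tsum_eq_sum (s := Ico 1 M)]
  · refine sum_congr rfl fun n hn => ?_
    have h := mem_Ico.1 hn
    rw [LSeries.term_of_ne_zero (by omega)]
    simp [trn, not_le.2 h.2, Complex.cpow_neg, div_eq_mul_inv]
  · intro n hn
    rcases Nat.eq_zero_or_pos n with rfl | h
    · simp
    · have : M ≤ n := by by_contra hh; exact hn (mem_Ico.2 ⟨h, not_le.1 hh⟩)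
      rw [LSeries.term_of_ne_zero (by omega)]
      simp [trn, this]

theorem tlS_zero (f : ℕ → ℂ) (M : ℕ) {t : ℝ} (ht : t < M) : tlS f M t =0 := by
  refine sum_eq_zero fun k hk => if_neg ?_
  have := (mem_Icc.1 hk)
  rw [not_le]
  have h0 :0 ≤ t := by
    by_contra h
    rw [Nat.floor_of_nonpos (not_le.1 h).le] at this; omega
  have : (k : ℝ) ≤ t := (Nat.cast_le.2 this.2).trans (Nat.floor_le h0)
  exact_mod_cast this.trans_lt ht

theorem tlS_eq (f : ℕ → ℂ) {M : ℕ} (hM :1 ≤ M) (t : ℝ) : tlS f M t = ∑ k ∈ Ico M (⌊t⌋₊ +1), f k := by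
  unfold tlS trn
  rw [← sum_filter]
  refine sum_congr ?_ fun _ _ => rfl
  ext k; simp only [mem_filter, mem_Icc, mem_Ico]; omega

theorem tlS_meas (f : ℕ → ℂ) (M : ℕ) : Measurable (tlS f M) := by
  have : tlS f M = (fun n : ℕ => ∑ k ∈ Icc 1 n, trn f M k) ∘ (fun t : ℝ => ⌊t⌋₊) := rfl
  rw [this]
  exact (measurable_from_nat).comp Nat.measurable_floor
theorem tail_bound (f : ℕ → ℂ) {M : ℕ} (hM :1 ≤ M) (K : ℝ) (hK : ∀ t, ‖tlS f M t‖ ≤ K) {s : ℂ} (hs :0 < s.re) :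
    ‖s * ∫ t in Set.Ioi (1 : ℝ), tlS f M t * (t : ℂ) ^ (-(s +1))‖ ≤ ‖s‖ * (K * (M : ℝ) ^ (-s.re) / s.re) := by
  have hM' : (0 : ℝ) < M := by exact_mod_cast hM
  rw [norm_mul]
  gcongr
  have e : ∫ t in Set.Ioi (1 : ℝ), tlS f M t * (t : ℂ) ^ (-(s +1)) =
      ∫ t in Set.Ici (M : ℝ), tlS f M t * (t : ℂ) ^ (-(s +1)) := by
    rw [← MeasureTheory.integral_Ici_eq_integral_Ioi]
    refine MeasureTheory.setIntegral_eq_of_subset_of_forall_sdiff_eq_zero measurableSet_Ici (Set.Ici_subset_Ici.2 (by exact_mod_cast hM)) ?_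
    intro t ht
    rw [tlS_zero f M (by simpa using ht.2), zero_mul]
  rw [e, MeasureTheory.integral_Ici_eq_integral_Ioi]
  have hi := integrableOn_Ioi_rpow_of_lt (a := -s.re -1) (by linarith) hM'
  calc _ ≤ ∫ t in Set.Ioi (M : ℝ), K * t ^ (-s.re -1) := by
        refine MeasureTheory.norm_integral_le_of_norm_le (hi.const_mul K) ?_
        refine (MeasureTheory.ae_restrict_mem measurableSet_Ioi).mono fun t ht => ?_
        have ht0 :0 < t := hM'.trans ht
        rw [norm_mul, Complex.norm_cpow_eq_rpow_re_of_pos ht0]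
        have : (-(s +1)).re = -s.re -1 := by simp; ring
        rw [this]
        gcongr
        exact hK t
    _ = _ := by
        rw [MeasureTheory.integral_const_mul, integral_Ioi_rpow_of_lt (by linarith) hM']
        ring_nf

theorem tail_diff (f : ℕ → ℂ) {M : ℕ} (hM :1 ≤ M) (K : ℝ) (hK : ∀ t, ‖tlS f M t‖ ≤ K) {s : ℂ} (hs :0 < s.re) :
    DifferentiableAt ℂ (fun s : ℂ => ∫ t in Set.Ioi (1 : ℝ), tlS f M t * (t : ℂ) ^ (-(s +1))) s := by
  have e : (fun s : ℂ => ∫ t in Set.Ioi (1 : ℝ), tlS f M t * (t : ℂ) ^ (-(s +1))) =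
      (fun s : ℂ => mellin (tlS f M) (-s)) := by
    ext s
    unfold mellin
    rw [← MeasureTheory.integral_Ici_eq_integral_Ioi]
    rw [MeasureTheory.setIntegral_eq_of_subset_of_forall_sdiff_eq_zero (s := Set.Ici 1) (t := Set.Ioi 0) measurableSet_Ioi (fun t (ht : (1:ℝ) ≤ t) => show (0:ℝ) < t by linarith) (f := fun t : ℝ => (t : ℂ) ^ (-s -1) • tlS f M t)]
    · refine MeasureTheory.setIntegral_congr_fun measurableSet_Ici fun t _ => ?_
      simp only [smul_eq_mul]; rw [mul_comm]; congr 2; ring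
    · intro t ht
      rw [tlS_zero f M, smul_zero]
      have := ht.2
      simp only [Set.mem_Ici, not_le] at this
      exact this.trans_le (by exact_mod_cast hM)
  rw [e]
  have hd : DifferentiableAt ℂ (mellin (tlS f M)) (-s) := by
    refine mellin_differentiableAt_of_isBigO_rpow (a :=0) (b := -s.re -1) ?_ ?_ (by simpa) ?_ (by simp)
    · refine MeasureTheory.LocallyIntegrable.locallyIntegrableOn ?_ _
      refine MeasureTheory.LocallyIntegrable.mono (MeasureTheory.locallyIntegrable_const K) (tlS_meas f M).aestronglyMeasurable (Filter.Eventually.of_forall fun t => (hK t).trans (le_abs_self K))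
    · refine Asymptotics.IsBigO.of_bound K (Filter.Eventually.of_forall fun t => ?_)
      simpa using hK t
    · refine Asymptotics.IsBigO.of_bound 0 ?_
      filter_upwards [Ioo_mem_nhdsGT (show (0:ℝ) <1 by norm_num)] with t ht
      rw [tlS_zero f M (ht.2.trans_le (by exact_mod_cast hM))]; simp
  exact hd.comp s differentiableAt_id.neg

end
section
open Finset DirichletCharacter
theorem chi_norm_le {D : ℕ} (χ : DirichletCharacter ℂ D) (n : ZMod D) : ‖χ n‖ ≤1 := χ.norm_le_one n

theorem chi_tl {D : ℕ} [NeZero D] (χ : DirichletCharacter ℂ D) (hχ : χ ≠1) {M : ℕ} (hM :1 ≤ M) (t : ℝ) :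
    ‖tlS (fun n => χ n) M t‖ ≤ D := by
  rw [tlS_eq _ hM]
  simpa using per_sum (fun x => χ x) (by simpa using MulChar.sum_eq_zero_of_ne_one hχ) 1 (chi_norm_le χ) M (⌊t⌋₊ +1)

theorem Lrep {D : ℕ} [NeZero D] (χ : DirichletCharacter ℂ D) (hχ : χ ≠1) {M : ℕ} (hM :1 ≤ M) {s : ℂ} (hs :0 < s.re) :
    LFunction χ s = ∑ n ∈ Ico 1 M, χ n * (n : ℂ) ^ (-s)
      + s * ∫ t in Set.Ioi (1 : ℝ), tlS (fun n => χ n) M t * (t : ℂ) ^ (-(s +1)) := by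
  have ho : IsOpen {s : ℂ | 0 < s.re} := isOpen_lt continuous_const Complex.continuous_re
  have h1 : AnalyticOnNhd ℂ (LFunction χ) {s : ℂ | 0 < s.re} :=
    ((differentiable_LFunction hχ).differentiableOn).analyticOnNhd ho
  have h2 : AnalyticOnNhd ℂ (fun s : ℂ => ∑ n ∈ Ico 1 M, χ n * (n : ℂ) ^ (-s)
      + s * ∫ t in Set.Ioi (1 : ℝ), tlS (fun n => χ n) M t * (t : ℂ) ^ (-(s +1))) {s : ℂ | 0 < s.re} := by
    refine DifferentiableOn.analyticOnNhd (fun s hs => DifferentiableAt.differentiableWithinAt ?_) ho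
    refine DifferentiableAt.add ?_ (differentiableAt_id.mul (tail_diff _ hM D (chi_tl χ hχ hM) hs))
    refine DifferentiableAt.fun_sum fun n hn => ?_
    have : (n : ℂ) ≠0 := by have := (mem_Ico.1 hn).1; exact_mod_cast (by omega : n ≠0)
    exact (DifferentiableAt.const_cpow differentiableAt_id.neg (Or.inl this)).const_mul _
  refine h1.eqOn_of_preconnected_of_eventuallyEq h2 (convex_halfSpace_re_gt 0).isPreconnected (z₀ :=2) (by simp) ?_ hs
  have : {s : ℂ | 1 < s.re} ∈ nhds (2 : ℂ) := (isOpen_lt continuous_const Complex.continuous_re).mem_nhds (by simp)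
  filter_upwards [this] with s hs
  rw [LFunction_eq_LSeries χ hs]
  exact LSer_rep (fun n => χ n) (fun n => chi_norm_le χ _) M hs

theorem head_bd (f : ℕ → ℂ) (hf : ∀ n, ‖f n‖ ≤1) {Y : ℝ} (hY :8 ≤ Y) {s : ℂ} (hs :1 -1 / log Y ≤ s.re) :
    ‖∑ n ∈ Ico 1 ⌈Y⌉₊, f n * (n : ℂ) ^ (-s)‖ ≤ Real.exp 1 * (1 + log Y) := by
  have hl :0 < log Y := Real.log_pos (by linarith)
  calc _ ≤ ∑ n ∈ Ico 1 ⌈Y⌉₊, Real.exp 1 * ((n : ℝ)⁻¹) := by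
        refine (norm_sum_le _ _).trans (sum_le_sum fun n hn => ?_)
        have h := mem_Ico.1 hn
        have hn0 : (0 : ℝ) < n := by exact_mod_cast h.1
        have hn1 : (1 : ℝ) ≤ n := by exact_mod_cast h.1
        have hnY : (n : ℝ) < Y := Nat.lt_ceil.1 h.2
        rw [norm_mul]
        have e1 : ‖(n : ℂ) ^ (-s)‖ = (n : ℝ) ^ (-s.re) := by
          rw [← Complex.ofReal_natCast, Complex.norm_cpow_eq_rpow_re_of_pos hn0]; simp
        rw [e1]
        refine (mul_le_of_le_one_left (by positivity) (hf n)).trans ?_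
        calc (n : ℝ) ^ (-s.re) ≤ (n : ℝ) ^ (1 / log Y + (-1)) := Real.rpow_le_rpow_of_exponent_le hn1 (by linarith)
          _ = (n : ℝ) ^ (1 / log Y) * (n : ℝ)⁻¹ := by rw [Real.rpow_add hn0, Real.rpow_neg_one]
          _ ≤ _ := by
            gcongr
            rw [Real.rpow_def_of_pos hn0]
            gcongr
            rw [mul_one_div, div_le_one hl]
            exact Real.log_le_log hn0 hnY.le
    _ = Real.exp 1 * ∑ n ∈ Ico 1 ⌈Y⌉₊, (n : ℝ)⁻¹ := by rw [mul_sum]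
    _ ≤ _ := by
        gcongr
        have h1 : ∑ n ∈ Ico 1 ⌈Y⌉₊, (n : ℝ)⁻¹ = (harmonic (⌈Y⌉₊ -1) : ℝ) := by
          rw [harmonic_eq_sum_Icc]
          push_cast
          refine sum_congr ?_ fun _ _ => rfl
          ext n; simp only [mem_Icc, mem_Ico]
          have :0 < ⌈Y⌉₊ := Nat.ceil_pos.2 (by linarith)
          omega
        rw [h1]
        refine (harmonic_le_one_add_log _).trans ?_
        refine add_le_add_right ?_ 1
        rcases Nat.eq_zero_or_pos (⌈Y⌉₊ -1) with h0 | h0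
        · rw [h0]; simpa using hl.le
        · refine Real.log_le_log (by exact_mod_cast h0) ?_
          rw [← Nat.le_floor_iff (by linarith)]
          have := Nat.ceil_le_floor_add_one Y
          omega

theorem logY_ge {Y : ℝ} (hY :8 ≤ Y) :2 ≤ log Y := by
  rw [Real.le_log_iff_exp_le (by linarith)]
  have := Real.exp_one_lt_d9
  have h2 : Real.exp 2 = Real.exp 1 * Real.exp 1 := by rw [← Real.exp_add]; norm_num
  nlinarith [Real.exp_pos 1]

theorem tl_num {Y : ℝ} (hY :8 ≤ Y) {K : ℝ} (hK :0 ≤ K) {s : ℂ} (hs :1 -1 / log Y ≤ s.re) (hD : K * (|s.im| +8) ≤3 * Y) :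
    ‖s‖ * (K * (⌈Y⌉₊ : ℝ) ^ (-s.re) / s.re) ≤6 * Real.exp 1 := by
  have hl := logY_ge hY
  have h1 :1 / log Y ≤1 /2 := by gcongr
  have hσ :1 /2 ≤ s.re := by linarith
  have hY0 :0 < Y := by linarith
  have hM : Y ≤ (⌈Y⌉₊ : ℝ) := Nat.le_ceil Y
  have h2 : (⌈Y⌉₊ : ℝ) ^ (-s.re) ≤ Real.exp 1 / Y := by
    calc (⌈Y⌉₊ : ℝ) ^ (-s.re) ≤ Y ^ (-s.re) := Real.rpow_le_rpow_of_nonpos hY0 hM (by linarith)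
      _ ≤ Y ^ (1 / log Y + (-1)) := Real.rpow_le_rpow_of_exponent_le (by linarith) (by linarith)
      _ = _ := by
        rw [Real.rpow_add hY0, Real.rpow_neg_one, Real.rpow_def_of_pos hY0, mul_one_div_cancel (by linarith)]; rfl
  have h3 : ‖s‖ ≤ s.re * (1 +2 * |s.im|) := by
    refine (Complex.norm_le_abs_re_add_abs_im s).trans ?_
    rw [abs_of_nonneg (by linarith)]
    nlinarith [abs_nonneg s.im]
  calc _ ≤ (s.re * (1 +2 * |s.im|)) * (K * (Real.exp 1 / Y) / s.re) := by gcongr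
    _ = (K * (1 +2 * |s.im|)) * Real.exp 1 / Y := by
        have : s.re ≠0 := by linarith
        field_simp
    _ ≤ (6 * Y) * Real.exp 1 / Y := by
        gcongr ?_ * _ / _; nlinarith [abs_nonneg s.im]
    _ = _ := by field_simp

theorem tl_num' {Y : ℝ} {K : ℝ} {s : ℂ} (hD : K * (|s.im| +8) ≤ Y) (hK :1 ≤ K) :8 ≤ Y := by
  nlinarith [abs_nonneg s.im]

theorem L_bd {D : ℕ} [NeZero D] (χ : DirichletCharacter ℂ D) (hχ : χ ≠1) {Y : ℝ} {s : ℂ}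
    (hD : D * (|s.im| +8) ≤ Y) (hs :1 -1 / log Y ≤ s.re) : ‖LFunction χ s‖ ≤13 * log Y := by
  have hD1 : (1 : ℝ) ≤ D := by exact_mod_cast NeZero.one_le
  have hY := tl_num' hD hD1
  have hl := logY_ge hY
  have h1 :1 / log Y ≤1 /2 := by gcongr
  have hM :1 ≤ ⌈Y⌉₊ := Nat.ceil_pos.2 (by linarith)
  rw [Lrep χ hχ hM (by linarith :0 < s.re)]
  refine (norm_add_le _ _).trans ?_
  have a := head_bd (fun n => χ n) (fun n => chi_norm_le χ _) hY hs
  have b := (tail_bound _ hM D (chi_tl χ hχ hM) (by linarith :0 < s.re)).trans (tl_num hY (by positivity) hs (by linarith))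
  have := Real.exp_one_lt_d9
  nlinarith

theorem L'_bd {D : ℕ} [NeZero D] (χ : DirichletCharacter ℂ D) (hχ : χ ≠1) {Y : ℝ} {s : ℂ}
    (hD : D * (|s.im| +9) ≤ Y) (hs :1 -1 / (2 * log Y) ≤ s.re) : ‖deriv (LFunction χ) s‖ ≤26 * log Y ^2 := by
  have hD1 : (1 : ℝ) ≤ D := by exact_mod_cast NeZero.one_le
  have hY :8 ≤ Y := by nlinarith [abs_nonneg s.im]
  have hl := logY_ge hY
  have h1 :1 / (2 * log Y) ≤1 := by rw [div_le_one (by linarith)]; linarith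
  have h2 :1 / (2 * log Y) +1 / (2 * log Y) =1 / log Y := by field_simp; norm_num
  have := Complex.norm_deriv_le_of_forall_mem_sphere_norm_le (f := LFunction χ) (c := s) (R :=1 / (2 * log Y)) (C :=13 * log Y) (by positivity)
    (differentiable_LFunction hχ).diffContOnCl (fun z hz => by
      have hz' : ‖z - s‖ =1 / (2 * log Y) := by simpa [dist_eq_norm] using hz
      have a := Complex.abs_re_le_norm (z - s)
      have b := Complex.abs_im_le_norm (z - s)
      rw [hz', Complex.sub_re, abs_le] at a
      rw [hz', Complex.sub_im] at b
      have c : |z.im| ≤ |s.im| +1 := by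
        have := abs_sub_abs_le_abs_sub z.im s.im; linarith
      refine L_bd χ hχ (le_trans ?_ hD) (by linarith [a.1])
      refine mul_le_mul_of_nonneg_left (by linarith) (by linarith))
  refine this.trans (le_of_eq ?_)
  field_simp; norm_num

theorem tail2 (f : ℕ → ℂ) {M : ℕ} (hM :1 ≤ M) (K : ℝ) (ρ : ℂ) (hρ : ‖ρ‖ ≤1) (hK : ∀ t, (M : ℝ) ≤ t → ‖tlS f M t - ρ * (t - M)‖ ≤ K) {s : ℂ} (hs :1 < s.re) :
    ‖s * ∫ t in Set.Ioi (1 : ℝ), tlS f M t * (t : ℂ) ^ (-(s +1))‖ ≤ ‖s‖ * (K * (M : ℝ) ^ (-s.re) / s.re) +1 / ‖s -1‖ := by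
  have hM' : (0 : ℝ) < M := by exact_mod_cast hM
  have hs0 : s ≠0 := by rintro rfl; simp at hs; linarith
  have hs1 : s -1 ≠0 := by intro h; rw [sub_eq_zero] at h; rw [h] at hs; simp at hs
  have e : ∫ t in Set.Ioi (1 : ℝ), tlS f M t * (t : ℂ) ^ (-(s +1)) =
      ∫ t in Set.Ici (M : ℝ), tlS f M t * (t : ℂ) ^ (-(s +1)) := by
    rw [← MeasureTheory.integral_Ici_eq_integral_Ioi]
    refine MeasureTheory.setIntegral_eq_of_subset_of_forall_sdiff_eq_zero measurableSet_Ici (Set.Ici_subset_Ici.2 (by exact_mod_cast hM)) ?_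
    intro t ht
    rw [tlS_zero f M (by simpa using ht.2), zero_mul]
  have hi := integrableOn_Ioi_rpow_of_lt (a := -s.re -1) (by linarith) hM'
  have hbd : ∀ᵐ t ∂(MeasureTheory.volume.restrict (Set.Ioi (M : ℝ))), ‖(tlS f M t - ρ * (t - M)) * (t : ℂ) ^ (-(s +1))‖ ≤ K * t ^ (-s.re -1) := by
    refine (MeasureTheory.ae_restrict_mem measurableSet_Ioi).mono fun t ht => ?_
    have ht0 :0 < t := hM'.trans ht
    rw [norm_mul, Complex.norm_cpow_eq_rpow_re_of_pos ht0]
    have : (-(s +1)).re = -s.re -1 := by simp; ring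
    rw [this]
    gcongr
    exact hK t (le_of_lt ht)
  have i1 : MeasureTheory.IntegrableOn (fun t : ℝ => (tlS f M t - ρ * (t - M)) * (t : ℂ) ^ (-(s +1))) (Set.Ioi (M : ℝ)) := by
    refine MeasureTheory.Integrable.mono' (hi.const_mul K) ?_ hbd
    refine Measurable.aestronglyMeasurable ?_
    have := tlS_meas f M
    fun_prop
  have ic1 := integrableOn_Ioi_cpow_of_lt (a := -s) (by simpa using hs) hM'
  have ic2 := integrableOn_Ioi_cpow_of_lt (a := -(s +1)) (by simp; linarith) hM'
  have e2 : ∫ t in Set.Ioi (M : ℝ), tlS f M t * (t : ℂ) ^ (-(s +1)) =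
      (∫ t in Set.Ioi (M : ℝ), (tlS f M t - ρ * (t - M)) * (t : ℂ) ^ (-(s +1))) + ρ * ((M : ℂ) ^ (1 - s) / (s * (s -1))) := by
    have e3 : ρ * ((M : ℂ) ^ (1 - s) / (s * (s -1))) = ∫ t in Set.Ioi (M : ℝ), ρ * ((t : ℂ) ^ (-s) - M * (t : ℂ) ^ (-(s +1))) := by
      rw [MeasureTheory.integral_const_mul, MeasureTheory.integral_sub ic1 (ic2.const_mul _), MeasureTheory.integral_const_mul,
        integral_Ioi_cpow_of_lt (by simpa using hs) hM', integral_Ioi_cpow_of_lt (by simp; linarith) hM']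
      have hMc : (M : ℂ) ≠0 := by exact_mod_cast hM'.ne'
      have a1 : ((M : ℝ) : ℂ) ^ (-s +1) = (M : ℂ) ^ (1 - s) := by rw [add_comm, ← sub_eq_add_neg]; simp
      have a2 : (M : ℂ) * ((M : ℝ) : ℂ) ^ (-(s +1) +1) = (M : ℂ) ^ (1 - s) := by
        have : -(s +1) +1 = -s := by ring
        rw [this, sub_eq_add_neg, Complex.cpow_add _ _ hMc]; simp
      rw [a1, mul_div_assoc' (M : ℂ), mul_neg, a2]
      have : -s +1 ≠0 := by intro h; apply hs1; linear_combination -h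
      have h3 : -(s +1) +1 = -s := by ring
      rw [h3]
      have h4 : -s +1 = -(s -1) := by ring
      rw [h4]
      field_simp
      ring
    rw [e3, ← MeasureTheory.integral_add i1]
    · refine MeasureTheory.setIntegral_congr_fun measurableSet_Ioi fun t ht => ?_
      have ht0 : (t : ℂ) ≠0 := by exact_mod_cast (hM'.trans ht).ne'
      have : (t : ℂ) ^ (-s) = t * (t : ℂ) ^ (-(s +1)) := by
        have : -s =1 + (-(s +1)) := by ring
        rw [this, Complex.cpow_add _ _ ht0, Complex.cpow_one]
      simp only [this]; ring
    · exact (ic1.sub (ic2.const_mul _)).const_mul _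
  rw [e, MeasureTheory.integral_Ici_eq_integral_Ioi, e2, mul_add]
  refine (norm_add_le _ _).trans (add_le_add ?_ ?_)
  · rw [norm_mul]
    gcongr
    calc _ ≤ ∫ t in Set.Ioi (M : ℝ), K * t ^ (-s.re -1) := MeasureTheory.norm_integral_le_of_norm_le (hi.const_mul K) hbd
      _ = _ := by
        rw [MeasureTheory.integral_const_mul, integral_Ioi_rpow_of_lt (by linarith) hM']
        ring_nf
  · have : s * (ρ * ((M : ℂ) ^ (1 - s) / (s * (s -1)))) = ρ * (M : ℂ) ^ (1 - s) / (s -1) := by field_simp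
    rw [this, norm_div, norm_mul]
    gcongr
    have : ‖(M : ℂ) ^ (1 - s)‖ ≤1 := by
      rw [← Complex.ofReal_natCast, Complex.norm_cpow_eq_rpow_re_of_pos hM']
      exact Real.rpow_le_one_of_one_le_of_nonpos (by exact_mod_cast hM) (by simp; linarith)
    exact mul_le_one₀ hρ (norm_nonneg _) this

theorem L0_bd {D : ℕ} [NeZero D] {Y : ℝ} {s : ℂ} (hs :1 < s.re)
    (hD : D * (|s.im| +8) ≤ Y) : ‖LFunction (1 : DirichletCharacter ℂ D) s‖ ≤13 * log Y +1 / ‖s -1‖ := by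
  set χ := (1 : DirichletCharacter ℂ D) with hχ
  have hD1 : (1 : ℝ) ≤ D := by exact_mod_cast NeZero.one_le
  have hY := tl_num' hD hD1
  have hl := logY_ge hY
  have h1 :0 ≤1 / log Y := by positivity
  have hM :1 ≤ ⌈Y⌉₊ := Nat.ceil_pos.2 (by linarith)
  have hM0 : (0 : ℝ) < ⌈Y⌉₊ := by exact_mod_cast hM
  rw [LFunction_eq_LSeries χ hs]
  set ρ : ℂ := (∑ x : ZMod D, χ x) / D with hρ
  have hρ1 : ‖ρ‖ ≤1 := by
    rw [hρ, norm_div, Complex.norm_natCast, div_le_one (by linarith)]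
    refine (norm_sum_le _ _).trans ((sum_le_sum fun x _ => chi_norm_le χ x).trans ?_)
    simp [ZMod.card]
  rw [LSer_rep (fun n => χ n) (fun n => chi_norm_le χ _) ⌈Y⌉₊ hs]
  have a := head_bd (fun n => χ n) (fun n => chi_norm_le χ _) hY (by linarith :1 -1 / log Y ≤ s.re)
  have b := tail2 (fun n => χ n) hM (3 * D) ρ hρ1 (by
    intro t ht
    rw [tlS_eq _ hM]
    have h := per_sum (fun x => χ x - ρ) (by
      rw [sum_sub_distrib, hρ]; simp only [sum_const, card_univ, ZMod.card, nsmul_eq_mul]; rw [mul_div_cancel₀ _ (by exact_mod_cast (by linarith : (D:ℝ) ≠0)), sub_self]) 2 (fun x => (norm_sub_le _ _).trans (by linarith [chi_norm_le χ x])) ⌈Y⌉₊ (⌊t⌋₊ +1)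
    rw [sum_sub_distrib] at h
    have hfl : ⌈Y⌉₊ ≤ ⌊t⌋₊ := Nat.le_floor ht
    have : ∑ i ∈ Ico ⌈Y⌉₊ (⌊t⌋₊ +1), ρ = ρ * (⌊t⌋₊ +1 - ⌈Y⌉₊) := by
      rw [sum_const, Nat.card_Ico, nsmul_eq_mul, mul_comm, Nat.cast_sub (by omega)]; push_cast; ring
    rw [this] at h
    have e3 : ∑ k ∈ Ico ⌈Y⌉₊ (⌊t⌋₊ +1), χ k - ρ * (t - ⌈Y⌉₊) = (∑ k ∈ Ico ⌈Y⌉₊ (⌊t⌋₊ +1), χ k - ρ * (⌊t⌋₊ +1 - ⌈Y⌉₊)) + ρ * (((⌊t⌋₊ +1 - t : ℝ)) : ℂ) := by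
      push_cast; ring
    rw [e3]
    refine (norm_add_le _ _).trans ?_
    have h4 : ‖ρ * (((⌊t⌋₊ +1 - t : ℝ)) : ℂ)‖ ≤1 := by
      rw [norm_mul]
      refine mul_le_one₀ hρ1 (norm_nonneg _) ?_
      rw [Complex.norm_real, Real.norm_eq_abs, abs_le]
      have := Nat.floor_le (show 0 ≤ t by linarith)
      have := Nat.lt_floor_add_one t
      constructor <;> linarith
    linarith) hs
  have c := tl_num hY (K :=3 * D) (by positivity) (by linarith :1 -1 / log Y ≤ s.re) (by linarith)
  refine (norm_add_le _ _).trans ?_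
  have := Real.exp_one_lt_d9
  nlinarith

theorem L_lip {D : ℕ} [NeZero D] (χ : DirichletCharacter ℂ D) (hχ : χ ≠1) {Y t : ℝ}
    (hD : D * (|t| +9) ≤ Y) {z w : ℂ} (hz :1 -1 / (2 * log Y) ≤ z.re) (hw :1 -1 / (2 * log Y) ≤ w.re)
    (hz' : |z.im| ≤ |t|) (hw' : |w.im| ≤ |t|) : ‖LFunction χ z - LFunction χ w‖ ≤26 * log Y ^2 * ‖z - w‖ := by
  have hc : Convex ℝ ({z : ℂ | 1 -1 / (2 * log Y) ≤ z.re} ∩ ({z : ℂ | -|t| ≤ z.im} ∩ {z : ℂ | z.im ≤ |t|})) :=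
    (convex_halfSpace_re_ge _).inter ((convex_halfSpace_im_ge _).inter (convex_halfSpace_im_le _))
  refine hc.norm_image_sub_le_of_norm_deriv_le (𝕜 := ℂ) (fun x _ => differentiable_LFunction hχ x) (fun x hx => ?_)
    ⟨hw, (abs_le.1 hw')⟩ ⟨hz, (abs_le.1 hz')⟩
  refine L'_bd χ hχ (le_trans ?_ hD) hx.1
  have : |x.im| ≤ |t| := abs_le.2 hx.2
  gcongr

theorem Lmain {D : ℕ} [NeZero D] (χ : DirichletCharacter ℂ D) (hχ : χ ≠1) {Y η x : ℝ} {s : ℂ}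
    (hD : D * (2 * |s.im| +9) ≤ Y) (hη0 :0 < η) (hη1 : η ≤1) (hη : χ ^2 =1 → η ≤ ‖LFunction χ 1‖)
    (hx0 :0 < x) (hx : x * (10 ^11 * log Y ^10) ≤ η)
    (hs : |s.re -1| ≤ x) : LFunction χ s ≠0 ∧ ‖deriv (LFunction χ) s / LFunction χ s‖ ≤1 / x := by
  have hD1 : (1 : ℝ) ≤ D := by exact_mod_cast NeZero.one_le
  have hY :8 ≤ Y := by nlinarith [abs_nonneg s.im]
  have hl := logY_ge hY
  set l := log Y with hldef
  have hD' : D * (|s.im| +9) ≤ Y := le_trans (by gcongr; linarith [abs_nonneg s.im]) hD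
  have hl8 :2 ^8 ≤ l ^8 := by gcongr
  have hl9 :2 ^9 ≤ l ^9 := by gcongr
  have h2 : x * (10 ^11 * l ^2) ≤ η := by
    refine le_trans ?_ hx
    have : l ^10 = l ^2 * l ^8 := by ring
    rw [this]; gcongr; nlinarith [sq_nonneg l]
  have h1 : x * (2 * l) ≤1 := by
    refine le_trans ?_ (h2.trans hη1)
    refine mul_le_mul_of_nonneg_left ?_ hx0.le; nlinarith
  have h1' : x * (13 * l) ≤1 := by
    refine le_trans ?_ (h2.trans hη1)
    refine mul_le_mul_of_nonneg_left ?_ hx0.le; nlinarith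
  have hx2 : x ≤1 / (2 * l) := by rw [le_div_iff₀ (by positivity)]; exact h1
  have hsa := abs_le.1 hs
  have hse : s = s.re + s.im * Complex.I := (Complex.re_add_im s).symm
  have hsre :1 -1 / (2 * l) ≤ s.re := by linarith
  have key :52 * l ^2 * x ≤ ‖LFunction χ s‖ := by
    by_cases hc : χ ^2 =1 ∧ |s.im| ≤ η / (104 * l ^2)
    · have h3 := hη hc.1
      have h4 := L_lip χ hχ hD' (z :=1) (w := s) (by simp; positivity) hsre (by simp) le_rfl
      have h5 : ‖1 - s‖ ≤ x + η / (104 * l ^2) := by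
        refine (Complex.norm_le_abs_re_add_abs_im _).trans (add_le_add ?_ ?_)
        · simp; rwa [abs_sub_comm]
        · simpa using hc.2
      have h6 :26 * l ^2 * ‖1 - s‖ ≤ η /2 := by
        calc _ ≤26 * l ^2 * (x + η / (104 * l ^2)) := by gcongr
          _ =26 * (x * l ^2) + η /4 := by field_simp; ring
          _ ≤ _ := by linarith
      have := norm_sub_norm_le (LFunction χ 1) (LFunction χ s)
      rw [← hldef] at h4
      linarith
    · have hP : ‖LFunction (χ ^2) (1 + x +2 * Complex.I * s.im)‖ ≤65 * l ^2 / η := by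
        have him : (1 + x +2 * Complex.I * s.im).im =2 * s.im := by simp
        have hre : (1 + x +2 * Complex.I * s.im).re =1 + x := by simp
        have hDD : D * (|(1 + x +2 * Complex.I * s.im).im| +8) ≤ Y := by
          rw [him, abs_mul, abs_two]; refine le_trans ?_ hD; gcongr; norm_num
        have b0 :13 * l ≤13 * l ^2 / η := by
          rw [le_div_iff₀ hη0]; nlinarith
        by_cases h : χ ^2 =1
        · rw [h]
          refine (L0_bd (by rw [hre]; linarith) hDD).trans ?_
          have h3 : η / (52 * l ^2) ≤ ‖(1 + x +2 * Complex.I * s.im) -1‖ := by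
            refine le_trans ?_ (Complex.abs_im_le_norm _)
            rw [Complex.sub_im, him]
            have : η / (104 * l ^2) < |s.im| := by by_contra h'; exact hc ⟨h, not_lt.1 h'⟩
            simp [abs_mul]
            have h7 : η / (52 * l ^2) =2 * (η / (104 * l ^2)) := by field_simp; norm_num
            linarith
          have :1 / ‖(1 + x +2 * Complex.I * s.im) -1‖ ≤52 * l ^2 / η := by
            calc _ ≤1 / (η / (52 * l ^2)) := by gcongr
              _ = _ := by field_simp
          have h8 :65 * l ^2 / η =13 * l ^2 / η +52 * l ^2 / η := by ring
          linarith
        · refine (L_bd (χ ^2) h hDD ?_).trans ?_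
          · rw [hre]; have :0 ≤1 / log Y := by positivity
            linarith
          · refine b0.trans ?_; gcongr; norm_num
      have hT : ‖LFunctionTrivChar D (1 + x)‖ ≤2 / x := by
        have := L0_bd (D := D) (Y := Y) (s :=1 + x) (by simp; linarith) (by
          simp; refine le_trans ?_ hD; gcongr; linarith [abs_nonneg s.im])
        refine this.trans ?_
        rw [← hldef]
        have e : ‖(1 + x : ℂ) -1‖ = x := by simp [abs_of_pos hx0]
        rw [e]
        have :13 * l ≤1 / x := by rw [le_div_iff₀ hx0]; linarith
        have e2 :2 / x =1 / x +1 / x := by ring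
        linarith
      have h341 := norm_LFunction_product_ge_one χ hx0 s.im
      set w : ℂ :=1 + x + Complex.I * s.im with hw
      have hw4 : x ^3 * η / (520 * l ^2) ≤ ‖LFunction χ w‖ ^4 := by
        rw [norm_mul, norm_mul, norm_pow, norm_pow] at h341
        have :1 ≤ (2 / x) ^3 * ‖LFunction χ w‖ ^4 * (65 * l ^2 / η) := by
          refine le_trans (ge_iff_le.1 h341) ?_
          gcongr
        calc x ^3 * η / (520 * l ^2) = x ^3 * η / (520 * l ^2) *1 := by ring
          _ ≤ x ^3 * η / (520 * l ^2) * ((2 / x) ^3 * ‖LFunction χ w‖ ^4 * (65 * l ^2 / η)) := by gcongr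
          _ = _ := by field_simp; ring
      have h3 :104 * l ^2 * x ≤ ‖LFunction χ w‖ := by
        refine le_of_pow_le_pow_left₀ (n :=4) (by norm_num) (norm_nonneg _) (le_trans ?_ hw4)
        rw [le_div_iff₀ (by positivity)]
        have : (104 * l ^2 * x) ^4 * (520 * l ^2) = x ^3 * (x * (104 ^4 *520 * l ^10)) := by ring
        rw [this]
        gcongr
        refine le_trans ?_ hx
        gcongr; norm_num
      have h4 := L_lip χ hχ hD' (z := w) (w := s) (by simp [hw]; have :0 ≤ l⁻¹ *2⁻¹ := by positivity
                                                      linarith) hsre (by simp [hw]) le_rfl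
      have h5 : ‖w - s‖ ≤2 * x := by
        have : w - s = ((1 + x - s.re : ℝ) : ℂ) := by
          conv_lhs => rw [hse]
          rw [hw]; push_cast; ring
        rw [this, Complex.norm_real, Real.norm_eq_abs, abs_le]
        constructor <;> linarith
      have := norm_sub_norm_le (LFunction χ w) (LFunction χ s)
      have h6 :26 * l ^2 * ‖w - s‖ ≤26 * l ^2 * (2 * x) := by gcongr
      rw [← hldef] at h4
      linarith
  have hpos :0 < ‖LFunction χ s‖ := lt_of_lt_of_le (by positivity) key
  refine ⟨norm_pos_iff.1 hpos, ?_⟩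
  rw [norm_div, div_le_div_iff₀ hpos hx0]
  have := L'_bd χ hχ hD' hsre
  rw [← hldef] at this
  nlinarith

end
section
open Finset DirichletCharacter MeasureTheory
noncomputable def vl (c y : ℝ) : ℂ := c + y * Complex.I

theorem vl_re (c y : ℝ) : (vl c y).re = c := by simp [vl]
theorem vl_im (c y : ℝ) : (vl c y).im = y := by simp [vl]
theorem vl_cont (c : ℝ) : Continuous (vl c) := by unfold vl; fun_prop
theorem vl_ne {c : ℝ} (hc :0 < c) (y : ℝ) : vl c y ≠0 := fun h => by
  have := vl_re c y; rw [h] at this; simp at this; linarith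

theorem vl_inv_bd {c : ℝ} (hc :1 /2 ≤ c) (y : ℝ) : ‖(vl c y ^2)⁻¹‖ ≤4 * (1 + y ^2)⁻¹ := by
  rw [norm_inv, norm_pow, ← Complex.normSq_eq_norm_sq, Complex.normSq_apply, vl_re, vl_im, inv_le_iff_one_le_mul₀ (by nlinarith)]
  rw [← div_eq_mul_inv, div_mul_eq_mul_div, le_div_iff₀ (by positivity)]
  nlinarith

theorem vl_int {c : ℝ} (hc :1 /2 ≤ c) : Integrable (fun y => (vl c y ^2)⁻¹) := by
  refine Integrable.mono' (integrable_inv_one_add_sq.const_mul 4) ?_ (Filter.Eventually.of_forall (vl_inv_bd hc))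
  exact ((vl_cont c).pow 2 |>.inv₀ (fun y => pow_ne_zero 2 (vl_ne (by linarith) y))).aestronglyMeasurable

theorem perron1 {c x : ℝ} (hc :1 /2 ≤ c) (hx :0 < x) :
    (1 / (2 * Real.pi) : ℂ) * ∫ y : ℝ, (x : ℂ) ^ (-(vl c y)) * (vl c y ^2)⁻¹ = ((- log (min x 1) : ℝ) : ℂ) := by
  set f0 : ℝ → ℂ := Set.indicator (Set.Ioc 0 1) (fun _ => 1) with hf0
  have hli : LocallyIntegrableOn f0 (Set.Ioi 0) := by
    refine LocallyIntegrable.locallyIntegrableOn ?_ _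
    exact (locallyIntegrable_const (1:ℂ)).indicator measurableSet_Ioc
  have hd : ∀ s : ℂ, 0 < s.re → MellinConvergent (fun t => log t • f0 t) s ∧
      HasDerivAt (mellin f0) (mellin (fun t => log t • f0 t) s) s := by
    intro s hs
    refine mellin_hasDerivAt_of_isBigO_rpow (a := s.re +1) (b :=0) hli ?_ (by linarith) ?_ hs
    · refine Asymptotics.IsBigO.of_bound 0 ?_
      filter_upwards [Filter.eventually_gt_atTop 1] with t ht
      simp [hf0, ht]
    · refine Asymptotics.IsBigO.of_bound 1 (Filter.Eventually.of_forall fun t => ?_)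
      simp only [hf0, Set.indicator]; split_ifs <;> simp
  have hm : ∀ s : ℂ, 0 < s.re → mellin (fun t => log t • f0 t) s = -(s ^2)⁻¹ := by
    intro s hs
    have h1 := (hd s hs).2
    have hs0 : s ≠0 := by rintro rfl; simp at hs
    have h2 : HasDerivAt (mellin f0) (-(s ^2)⁻¹) s := by
      refine (hasDerivAt_inv hs0).congr_of_eventuallyEq ?_
      filter_upwards [(isOpen_lt continuous_const Complex.continuous_re).mem_nhds (show (0:ℝ) < s.re from hs)] with z hz
      rw [(hasMellin_one_Ioc hz).2, one_div]
    exact h1.unique h2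
  have hc0 :0 < c := by linarith
  have hcont : ContinuousAt (fun t => log t • f0 t) x := by
    have : ContinuousAt (fun t : ℝ => ((log (min t 1) : ℝ) : ℂ)) x := by
      refine Complex.continuous_ofReal.continuousAt.comp (ContinuousAt.log (by fun_prop) (by positivity))
    refine this.congr ?_
    filter_upwards [lt_mem_nhds hx] with t ht
    by_cases h : t ≤1
    · simp [hf0, h, ht]
    · simp [hf0, h, (not_le.1 h).le]
  have key := mellinInv_mellin_eq c (fun t => log t • f0 t) hx (hd c (by simpa)).1 (by
    refine (vl_int hc).neg.congr (Filter.Eventually.of_forall fun y => ?_)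
    have := hm (vl c y) (by rw [vl_re]; exact hc0)
    simpa [vl] using this.symm) hcont
  have e : log x • f0 x = ((log (min x 1) : ℝ) : ℂ) := by
    by_cases h : x ≤1
    · simp [hf0, h, hx]
    · simp [hf0, h, (not_le.1 h).le]
  simp only [e] at key
  push_cast
  rw [← key, mellinInv, Complex.real_smul]
  have : ∀ y : ℝ, (x : ℂ) ^ (-((c:ℂ) + y * Complex.I)) • mellin (fun t => log t • f0 t) (c + y * Complex.I) = -((x : ℂ) ^ (-(vl c y)) * (vl c y ^2)⁻¹) := by
    intro y
    have := hm (vl c y) (by rw [vl_re]; exact hc0)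
    rw [← vl, this, smul_eq_mul, mul_neg]
  simp_rw [this]
  rw [integral_neg]; push_cast; ring

theorem perron_sum (a : ℕ → ℂ) {c : ℝ} (hc :1 /2 ≤ c) (ha : LSeriesSummable a c) {N : ℕ} (hN :1 ≤ N) :
    ∑ n ∈ Icc 1 N, a n * (log (N / n) : ℝ) = (1 / (2 * Real.pi) : ℂ) * ∫ y : ℝ, (N : ℂ) ^ (vl c y) * LSeries a (vl c y) * (vl c y ^2)⁻¹ := by
  have hN0 : (0 : ℝ) < N := by exact_mod_cast hN
  have hNc : (N : ℂ) ≠0 := by exact_mod_cast hN0.ne'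
  set F : ℕ → ℝ → ℂ := fun n y => (N : ℂ) ^ (vl c y) * LSeries.term a (vl c y) n * (vl c y ^2)⁻¹ with hF
  have hFn : ∀ n y, ‖F n y‖ = (N : ℝ) ^ c * ‖LSeries.term a c n‖ * ‖(vl c y ^2)⁻¹‖ := by
    intro n y
    simp only [hF, norm_mul, LSeries.norm_term_eq, vl_re, Complex.ofReal_re]
    rw [← Complex.ofReal_natCast, Complex.norm_cpow_eq_rpow_re_of_pos hN0, vl_re]
  have hFi : ∀ n, Integrable (F n) := by
    intro n
    have hcont : Continuous (F n) := by
      have h1 : Continuous fun y => (vl c y ^2)⁻¹ := (vl_cont c).pow 2 |>.inv₀ (fun y => pow_ne_zero 2 (vl_ne (by linarith) y))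
      have h2 : Continuous fun y => (N : ℂ) ^ (vl c y) := (vl_cont c).const_cpow (Or.inl hNc)
      refine (h2.mul ?_).mul h1
      rcases Nat.eq_zero_or_pos n with rfl | hn
      · simp; fun_prop
      · have hnc : (n : ℂ) ≠0 := by exact_mod_cast hn.ne'
        simp_rw [LSeries.term_of_ne_zero hn.ne']
        exact continuous_const.div ((vl_cont c).const_cpow (Or.inl hnc)) (fun y => by simp [Complex.cpow_eq_zero_iff, hnc])
    refine Integrable.mono' ((vl_int hc).norm.const_mul ((N : ℝ) ^ c * ‖LSeries.term a c n‖)) hcont.aestronglyMeasurable (Filter.Eventually.of_forall fun y => ?_)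
    rw [hFn]
  have hsum := hasSum_integral_of_summable_integral_norm hFi (by
    simp_rw [hFn, integral_const_mul]
    exact (ha.norm.mul_left _).mul_right _)
  have e1 : ∀ y, ∑' n, F n y = (N : ℂ) ^ (vl c y) * LSeries a (vl c y) * (vl c y ^2)⁻¹ := by
    intro y; simp only [hF, LSeries, tsum_mul_right, tsum_mul_left]
  simp_rw [e1] at hsum
  have e2 : ∀ n : ℕ, 1 ≤ n → (1 / (2 * Real.pi) : ℂ) * ∫ y, F n y = a n * ((- log (min (n / N) 1) : ℝ) : ℂ) := by
    intro n hn
    have hn0 : (0 : ℝ) < n := by exact_mod_cast hn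
    rw [← perron1 hc (div_pos hn0 hN0)]
    have : ∀ y, F n y = a n * ((((n / N : ℝ) : ℂ)) ^ (-(vl c y)) * (vl c y ^2)⁻¹) := by
      intro y
      simp only [hF]
      rw [LSeries.term_of_ne_zero (by omega), Complex.cpow_def_of_ne_zero (x := ((n / N : ℝ) : ℂ)) (Complex.ofReal_ne_zero.2 (div_pos hn0 hN0).ne'), ← Complex.ofReal_log (by positivity),
        Real.log_div hn0.ne' hN0.ne', Complex.cpow_def_of_ne_zero hNc, Complex.cpow_def_of_ne_zero (by exact_mod_cast hn0.ne'), div_eq_mul_inv, ← Complex.exp_neg]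
      have : Complex.exp (((log n - log N : ℝ) : ℂ) * -vl c y) = Complex.exp (Complex.log N * vl c y) * Complex.exp (-(Complex.log n * vl c y)) := by
        rw [← Complex.exp_add]; congr 1; push_cast; ring
      rw [this]; ring
    simp_rw [this]
    rw [integral_const_mul]; ring
  rw [← hsum.tsum_eq, ← tsum_mul_left, tsum_eq_sum (s := Icc 1 N)]
  · refine sum_congr rfl fun n hn => ?_
    have h := mem_Icc.1 hn
    have hn0 : (0 : ℝ) < n := by exact_mod_cast h.1
    rw [e2 n h.1, min_eq_left (by rw [div_le_one hN0]; exact_mod_cast h.2), ← Real.log_inv, inv_div]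
  · intro n hn
    rcases Nat.eq_zero_or_pos n with rfl | h
    · simp [hF]
    · rw [e2 n h, min_eq_right]
      · simp
      · rw [le_div_iff₀ hN0, one_mul]
        by_contra hh
        exact hn (mem_Icc.2 ⟨h, by exact_mod_cast (not_le.1 hh).le⟩)

noncomputable def Psi {D : ℕ} (χ : DirichletCharacter ℂ D) (N : ℕ) : ℂ :=
  ∑ n ∈ Icc 1 N, (χ n * (ArithmeticFunction.vonMangoldt n : ℝ)) * (log (N / n) : ℝ)

theorem zsum_bd {a : ℝ} (ha :0 < a) (ha1 : a ≤1) : Summable (fun n : ℕ => (n : ℝ) ^ (-(1 + a))) ∧ ∑' n : ℕ, (n : ℝ) ^ (-(1 + a)) ≤40 / a := by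
  have hs : Summable (fun n : ℕ => (n : ℝ) ^ (-(1 + a))) := Real.summable_nat_rpow.2 (by linarith)
  refine ⟨hs, ?_⟩
  have h := L0_bd (D :=1) (Y :=8) (s :=1 + a) (by simp; linarith) (by simp)
  have hre :1 < (1 + a : ℂ).re := by simp; linarith
  rw [LFunction_eq_LSeries _ hre] at h
  have e : LSeries (fun n => (1 : DirichletCharacter ℂ 1) n) (1 + a) = ((∑' n : ℕ, (n : ℝ) ^ (-(1 + a)) : ℝ) : ℂ) := by
    rw [LSeries, Complex.ofReal_tsum]
    refine tsum_congr fun n => ?_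
    rcases Nat.eq_zero_or_pos n with rfl | hn
    · simp; rw [Real.zero_rpow (by linarith), Complex.ofReal_zero]
    · rw [LSeries.term_of_ne_zero hn.ne']
      have : (1 : DirichletCharacter ℂ 1) n =1 := by
        rw [Subsingleton.elim ((n : ZMod 1)) 1]; simp
      rw [this, Complex.ofReal_cpow (by positivity)]
      push_cast
      rw [Complex.cpow_neg, one_div]
  rw [e, Complex.norm_real, Real.norm_eq_abs, abs_of_nonneg (tsum_nonneg fun n => by positivity)] at h
  have e2 : ‖(1 + a : ℂ) -1‖ = a := by simp [abs_of_pos ha]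
  rw [e2] at h
  have hlog : log 8 ≤3 := by
    rw [Real.log_le_iff_le_exp (by norm_num)]
    have := Real.add_one_le_exp (1 : ℝ)
    have e3 : Real.exp 3 = Real.exp 1 ^3 := by rw [← Real.exp_nat_mul]; norm_num
    rw [e3]; calc (8:ℝ) =2 ^3 := by norm_num
      _ ≤ _ := by gcongr; linarith
  have :39 ≤39 / a := by rw [le_div_iff₀ ha]; linarith
  have e4 :40 / a =39 / a +1 / a := by ring
  linarith

theorem lamL_bd {D : ℕ} (χ : DirichletCharacter ℂ D) {l : ℝ} (hl :1 ≤ l) (y : ℝ) :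
    ‖LSeries (fun n => χ n * (ArithmeticFunction.vonMangoldt n : ℝ)) (vl (1 +1 / l) y)‖ ≤160 * l ^2 := by
  have ha :0 <1 / (2 * l) := by positivity
  have ha1 :1 / (2 * l) ≤1 := by rw [div_le_one (by positivity)]; linarith
  obtain ⟨hs, hb⟩ := zsum_bd ha ha1
  have hle : ∀ n, ‖LSeries.term (fun n => χ n * (ArithmeticFunction.vonMangoldt n : ℝ)) (vl (1 +1 / l) y) n‖ ≤2 * l * (n : ℝ) ^ (-(1 +1 / (2 * l))) := by
    intro n
    rw [LSeries.norm_term_eq, vl_re]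
    split_ifs with h
    · positivity
    · have hn0 : (0 : ℝ) < n := by exact_mod_cast Nat.pos_of_ne_zero h
      have h1 : ‖χ n * (ArithmeticFunction.vonMangoldt n : ℝ)‖ ≤ log n := by
        rw [norm_mul, Complex.norm_real, Real.norm_eq_abs, abs_of_nonneg ArithmeticFunction.vonMangoldt_nonneg]
        exact (mul_le_of_le_one_left ArithmeticFunction.vonMangoldt_nonneg (chi_norm_le χ _)).trans ArithmeticFunction.vonMangoldt_le_log
      have h2 := Real.log_le_rpow_div hn0.le ha
      rw [div_le_iff₀ (by positivity)]
      refine h1.trans (h2.trans (le_of_eq ?_))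
      rw [mul_assoc, ← Real.rpow_add hn0]
      have : -(1 +1 / (2 * l)) + (1 +1 / l) =1 / (2 * l) := by field_simp; ring
      rw [this]; field_simp
  refine (tsum_of_norm_bounded (hs.mul_left (2 * l)).hasSum hle).trans ?_
  rw [tsum_mul_left]
  calc _ ≤2 * l * (40 / (1 / (2 * l))) := by gcongr
    _ = _ := by field_simp; norm_num

theorem atan_bd {T : ℝ} (hT :1 ≤ T) : Real.pi /2 - Real.arctan T ≤1 / T := by
  rw [← Real.arctan_inv_of_pos (by linarith), one_div]
  have h :0 ≤ T⁻¹ := by positivity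
  have := Real.le_tan (Real.arctan_nonneg.2 h) (Real.arctan_lt_pi_div_two _)
  rwa [Real.tan_arctan] at this

theorem psi_bd {D : ℕ} [NeZero D] (χ : DirichletCharacter ℂ D) (hχ : χ ≠1) {Y η x T : ℝ} {N : ℕ} (hN :3 ≤ N) (hT :1 ≤ T)
    (hD : D * (2 * T +9) ≤ Y) (hη0 :0 < η) (hη1 : η ≤1) (hη : χ ^2 =1 → η ≤ ‖LFunction χ 1‖)
    (hx0 :0 < x) (hx : x * (10 ^11 * log Y ^10) ≤ η) (hx1 : x ≤1 /2) (hNx :1 / log N ≤ x) :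
    ‖Psi χ N‖ ≤600 * N * log N ^2 / T +2 * (N : ℝ) ^ (1 - x) * T / x := by
  have hN0 : (0 : ℝ) < N := by positivity
  have hNc : (N : ℂ) ≠0 := by exact_mod_cast hN0.ne'
  have hl :1 ≤ log N := by
    rw [Real.le_log_iff_exp_le hN0]
    have := Real.exp_one_lt_d9
    have : (3 : ℝ) ≤ N := by exact_mod_cast hN
    linarith
  set l := log N with hldef
  set c :=1 +1 / l with hcdef
  have hc1 :1 < c := by
      rw [hcdef]; have :0 <1 / l := by positivity
      linarith
  have hNcpow : (N : ℝ) ^ c = Real.exp 1 * N := by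
    rw [hcdef, Real.rpow_add hN0, Real.rpow_one, Real.rpow_def_of_pos hN0, mul_one_div_cancel (by positivity)]; ring
  set G : ℂ → ℂ := fun s => (N : ℂ) ^ s * (-(deriv (LFunction χ) s / LFunction χ s)) * (s ^2)⁻¹ with hG
  have hGn : ∀ s : ℂ, ‖G s‖ = (N : ℝ) ^ s.re * ‖deriv (LFunction χ) s / LFunction χ s‖ * ‖(s ^2)⁻¹‖ := by
    intro s
    simp only [hG, norm_mul, norm_neg]
    rw [← Complex.ofReal_natCast, Complex.norm_cpow_eq_rpow_re_of_pos hN0]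
  have hLser : ∀ s : ℂ, 1 < s.re → LSeries (fun n => χ n * (ArithmeticFunction.vonMangoldt n : ℝ)) s = -(deriv (LFunction χ) s / LFunction χ s) := by
    intro s hs
    rw [deriv_LFunction_eq_deriv_LSeries χ hs, LFunction_eq_LSeries χ hs, ← neg_div, ← LSeries_twist_vonMangoldt_eq χ hs]
    rfl
  have hperron : Psi χ N = (1 / (2 * Real.pi) : ℂ) * ∫ y : ℝ, G (vl c y) := by
    unfold Psi
    rw [perron_sum (fun n => χ n * (ArithmeticFunction.vonMangoldt n : ℝ)) (c := c) (by linarith) (LSeriesSummable_twist_vonMangoldt χ (by simpa using hc1)) (by omega)]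
    congr 1
    refine integral_congr_ae (Filter.Eventually.of_forall fun y => ?_)
    simp only [hG]
    rw [hLser _ (by rw [vl_re]; exact hc1)]
  have hGv : ∀ y, ‖G (vl c y)‖ ≤ (Real.exp 1 * N * (160 * l ^2) *4) * (1 + y ^2)⁻¹ := by
    intro y
    rw [hGn, vl_re, hNcpow, ← norm_neg (deriv _ _ / _), ← hLser _ (by rw [vl_re]; exact hc1), mul_assoc (_ * _) 4]
    gcongr
    · exact lamL_bd χ hl y
    · exact vl_inv_bd (by linarith) y
  have hrect : ∀ s : ℂ, 1 - x ≤ s.re → s.re ≤ c → |s.im| ≤ T → LFunction χ s ≠0 ∧ ‖deriv (LFunction χ) s / LFunction χ s‖ ≤1 / x := by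
    intro s h1 h2 h3
    refine Lmain χ hχ (le_trans ?_ hD) hη0 hη1 hη hx0 hx (abs_le.2 ⟨by linarith, by linarith⟩)
    gcongr
  have hdiff : DifferentiableOn ℂ G (Set.uIcc (1 - x) c ×ℂ Set.uIcc (-T) T) := by
    intro s hs
    rw [Complex.mem_reProdIm, Set.uIcc_of_le (by linarith), Set.uIcc_of_le (by linarith)] at hs
    have h0 := (hrect s hs.1.1 hs.1.2 (abs_le.2 hs.2)).1
    have hs0 : s ≠0 := by rintro rfl; have := hs.1.1; simp at this; linarith
    have d1 := differentiable_LFunction hχ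
    have d2 : DifferentiableAt ℂ (deriv (LFunction χ)) s :=
      (d1.contDiff (n :=2)).differentiable_deriv_two.differentiableAt
    refine DifferentiableAt.differentiableWithinAt ?_
    refine ((differentiableAt_id.const_cpow (Or.inl hNc)).mul (d2.div d1.differentiableAt h0).neg).mul ?_
    exact (differentiableAt_id.pow 2).inv (pow_ne_zero 2 hs0)
  have hcauchy := Complex.integral_boundary_rect_eq_zero_of_differentiableOn G ((1 - x : ℝ) + (-T : ℝ) * Complex.I) ((c : ℝ) + (T : ℝ) * Complex.I) (by simpa using hdiff)
  simp only [Complex.add_re, Complex.ofReal_re, Complex.mul_re, Complex.I_re, mul_zero, Complex.ofReal_im, Complex.I_im, mul_one, sub_self, add_zero,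
    Complex.add_im, Complex.mul_im, zero_add] at hcauchy
  have hedge : ∀ T' : ℝ, |T'| = T → ‖∫ u in (1 - x)..c, G (u + T' * Complex.I)‖ ≤6 * N / T := by
    intro T' hT'
    have h1 : ∀ u ∈ Set.uIoc (1 - x) c, ‖G (u + T' * Complex.I)‖ ≤ Real.exp 1 * N * (1 / x) * (T ^2)⁻¹ := by
      intro u hu
      rw [Set.uIoc_of_le (by linarith)] at hu
      have hre : (u + T' * Complex.I).re = u := by simp
      have him : (u + T' * Complex.I).im = T' := by simp
      rw [hGn, hre]
      have a := (hrect (u + T' * Complex.I) (by rw [hre]; exact hu.1.le) (by rw [hre]; exact hu.2) (by rw [him, hT'])).2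
      have b : (N : ℝ) ^ u ≤ Real.exp 1 * N := by
        rw [← hNcpow]; exact Real.rpow_le_rpow_of_exponent_le (by exact_mod_cast (by omega :1 ≤ N)) hu.2
      have d : ‖((u + T' * Complex.I) ^2)⁻¹‖ ≤ (T ^2)⁻¹ := by
        rw [norm_inv, norm_pow]
        gcongr
        have := Complex.abs_im_le_norm (u + T' * Complex.I)
        rwa [him, hT'] at this
      gcongr
    refine (intervalIntegral.norm_integral_le_of_norm_le_const h1).trans ?_
    have h2 : |c - (1 - x)| ≤2 * x := by rw [abs_of_nonneg (by linarith)]; linarith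
    calc _ ≤ Real.exp 1 * N * (1 / x) * (T ^2)⁻¹ * (2 * x) := by gcongr
      _ =2 * Real.exp 1 * N / T * (1 / T) := by field_simp
      _ ≤6 * N / T *1 := by
          have := Real.exp_one_lt_d9
          have :1 / T ≤1 := by rw [div_le_one (by linarith)]; exact hT
          gcongr; linarith
      _ = _ := by ring
  have hleft : ‖∫ y in (-T)..T, G ((1 - x : ℝ) + y * Complex.I)‖ ≤8 * (N : ℝ) ^ (1 - x) * T / x := by
    have h1 : ∀ y ∈ Set.uIoc (-T) T, ‖G ((1 - x : ℝ) + y * Complex.I)‖ ≤ (N : ℝ) ^ (1 - x) * (1 / x) *4 := by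
      intro y hy
      rw [Set.uIoc_of_le (by linarith)] at hy
      rw [← vl, hGn, vl_re]
      have a := (hrect (vl (1 - x) y) (by rw [vl_re]) (by rw [vl_re]; linarith) (by rw [vl_im]; exact abs_le.2 ⟨hy.1.le, hy.2⟩)).2
      have b := vl_inv_bd (c :=1 - x) (by linarith) y
      have d : (1 + y ^2)⁻¹ ≤1 := inv_le_one_of_one_le₀ (by nlinarith)
      gcongr
      linarith
    refine (intervalIntegral.norm_integral_le_of_norm_le_const h1).trans (le_of_eq ?_)
    rw [abs_of_nonneg (by linarith)]; ring
  have hmid : ‖∫ y in (-T)..T, G (vl c y)‖ ≤6 * N / T +6 * N / T +8 * (N : ℝ) ^ (1 - x) * T / x := by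
    have e : Complex.I * ∫ y in (-T)..T, G (vl c y) = (∫ u in (1 - x)..c, G (u + (T : ℝ) * Complex.I)) - (∫ u in (1 - x)..c, G (u + (-T : ℝ) * Complex.I))
        + Complex.I * ∫ y in (-T)..T, G ((1 - x : ℝ) + y * Complex.I) := by
      simp only [smul_eq_mul] at hcauchy
      unfold vl
      linear_combination hcauchy
    have : ‖∫ y in (-T)..T, G (vl c y)‖ = ‖Complex.I * ∫ y in (-T)..T, G (vl c y)‖ := by simp
    rw [this, e]
    refine (norm_add_le _ _).trans (add_le_add ((norm_sub_le _ _).trans (add_le_add (hedge T (abs_of_nonneg (by linarith))) (hedge (-T) (by rw [abs_neg, abs_of_nonneg (by linarith)])))) ?_)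
    rw [norm_mul, Complex.norm_I, one_mul]
    exact hleft
  have hGi : Integrable (fun y => G (vl c y)) := by
    refine Integrable.mono' (integrable_inv_one_add_sq.const_mul _) ?_ (Filter.Eventually.of_forall hGv)
    have d1 := differentiable_LFunction hχ
    have d2 : Continuous (deriv (LFunction χ)) := (d1.contDiff (n :=2)).differentiable_deriv_two.continuous
    refine Continuous.aestronglyMeasurable (Continuous.mul (Continuous.mul ?_ ?_) ?_)
    · exact (vl_cont c).const_cpow (Or.inl hNc)
    · refine ((d2.comp (vl_cont c)).div (d1.continuous.comp (vl_cont c)) fun y => ?_).neg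
      simp only [Function.comp]
      rw [LFunction_eq_LSeries χ (by rw [vl_re]; exact hc1)]
      exact LSeries_ne_zero_of_one_lt_re χ (by rw [vl_re]; exact hc1)
    · exact (vl_cont c).pow 2 |>.inv₀ (fun y => pow_ne_zero 2 (vl_ne (by linarith) y))
  have hsplit : ∫ y, G (vl c y) = (∫ y in Set.Iic (-T), G (vl c y)) + (∫ y in (-T)..T, G (vl c y)) + ∫ y in Set.Ioi T, G (vl c y) := by
    rw [← intervalIntegral.integral_Iic_add_Ioi hGi.integrableOn hGi.integrableOn (b := T),
      ← intervalIntegral.integral_Iic_sub_Iic hGi.integrableOn hGi.integrableOn]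
    ring
  set K := Real.exp 1 * N * (160 * l ^2) *4 with hK
  have hK0 :0 ≤ K := by positivity
  have ht1 : ‖∫ y in Set.Iic (-T), G (vl c y)‖ ≤ K * (1 / T) := by
    refine (norm_integral_le_of_norm_le ((integrable_inv_one_add_sq.const_mul K).integrableOn) (Filter.Eventually.of_forall hGv)).trans ?_
    rw [integral_const_mul, integral_Iic_inv_one_add_sq, Real.arctan_neg]
    have := atan_bd hT
    gcongr; linarith
  have ht2 : ‖∫ y in Set.Ioi T, G (vl c y)‖ ≤ K * (1 / T) := by
    refine (norm_integral_le_of_norm_le ((integrable_inv_one_add_sq.const_mul K).integrableOn) (Filter.Eventually.of_forall hGv)).trans ?_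
    rw [integral_const_mul, integral_Ioi_inv_one_add_sq]
    have := atan_bd hT
    gcongr
  have htot : ‖∫ y, G (vl c y)‖ ≤3600 * N * l ^2 / T +8 * (N : ℝ) ^ (1 - x) * T / x := by
    rw [hsplit]
    refine (norm_add₃_le).trans ?_
    have h1 : K * (1 / T) ≤1760 * (N * l ^2 / T) := by
      rw [hK]
      have := Real.exp_one_lt_d9
      calc _ =640 * Real.exp 1 * (N * l ^2 / T) := by ring
        _ ≤ _ := by gcongr; linarith
    have h2 :6 * N / T ≤6 * (N * l ^2 / T) := by
      rw [mul_div_assoc]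
      gcongr
      exact le_mul_of_one_le_right hN0.le (one_le_pow₀ hl)
    have h3 :3600 * N * l ^2 / T =3600 * (N * l ^2 / T) := by ring
    have h0 :0 ≤ N * l ^2 / T := by positivity
    linarith
  rw [hperron, norm_mul]
  have hpi : ‖(1 / (2 * Real.pi) : ℂ)‖ ≤1 /6 := by
    have e : (1 / (2 * Real.pi) : ℂ) = ((1 / (2 * Real.pi) : ℝ) : ℂ) := by push_cast; rfl
    rw [e, Complex.norm_real, Real.norm_eq_abs, abs_of_nonneg (by positivity)]
    have := Real.pi_gt_three
    gcongr; linarith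
  have h0 :0 ≤ (N : ℝ) ^ (1 - x) * T / x := by positivity
  calc _ ≤1 /6 * (3600 * N * l ^2 / T +8 * (N : ℝ) ^ (1 - x) * T / x) := by gcongr
    _ ≤ _ := by ring_nf at h0 ⊢; linarith

end
section
open Finset DirichletCharacter
theorem cl_apply {d m : ℕ} (h : d ∣ m) (χ : DirichletCharacter ℂ d) (n : ℕ) :
    changeLevel h χ n = if n.Coprime m then χ n else 0 := by
  split_ifs with hc
  · have := changeLevel_eq_cast_of_dvd χ h (ZMod.unitOfCoprime n hc)
    rw [ZMod.coe_unitOfCoprime, ZMod.cast_natCast h] at this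
    exact this
  · exact MulChar.map_nonunit _ (by rwa [ZMod.isUnit_iff_coprime])

theorem chi_zero {d n : ℕ} (χ : DirichletCharacter ℂ d) (h : ¬ n.Coprime d) : χ n =0 :=
  MulChar.map_nonunit _ (by rwa [ZMod.isUnit_iff_coprime])

noncomputable def prodc {a b : ℕ} (χ : DirichletCharacter ℂ a) (ψ : DirichletCharacter ℂ b) : DirichletCharacter ℂ (a * b) :=
  changeLevel (dvd_mul_right a b) χ * changeLevel (dvd_mul_left b a) ψ

theorem prodc_apply {a b : ℕ} (χ : DirichletCharacter ℂ a) (ψ : DirichletCharacter ℂ b) (n : ℕ) :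
    prodc χ ψ n = χ n * ψ n := by
  rw [prodc, MulChar.mul_apply, cl_apply, cl_apply]
  by_cases h : n.Coprime (a * b)
  · rw [if_pos h, if_pos h]
  · rw [Nat.coprime_mul_iff_right] at h
    simp only [Nat.coprime_mul_iff_right, h, if_false, zero_mul]
    by_cases ha : n.Coprime a
    · rw [chi_zero ψ (fun hb => h ⟨ha, hb⟩), mul_zero]
    · rw [chi_zero χ ha, zero_mul]

theorem real_vals {d : ℕ} (χ : DirichletCharacter ℂ d) (h : χ ^2 =1) (n : ℕ) : χ n =0 ∨ χ n =1 ∨ χ n = -1 := by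
  by_cases hc : n.Coprime d
  · right
    have h1 : (χ ^2) n =1 := by rw [h]; exact MulChar.one_apply ((ZMod.isUnit_iff_coprime n d).2 hc)
    rw [MulChar.pow_apply' _ (by norm_num)] at h1
    have h2 : (χ n -1) * (χ n +1) =0 := by linear_combination h1
    rcases mul_eq_zero.1 h2 with h | h
    · left; linear_combination h
    · right; linear_combination h
  · left; exact chi_zero χ hc

theorem euler4 {X : ℂ} {x : ℝ} (hX : X = x) (h0 :0 ≤ x) (h1 : x <1) {a b : ℂ} (ha : a =0 ∨ a =1 ∨ a = -1) (hb : b =0 ∨ b =1 ∨ b = -1) :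
    1 ≤ ‖(1 - X)⁻¹ * (1 - a * X)⁻¹ * (1 - b * X)⁻¹ * (1 - a * b * X)⁻¹‖ := by
  rw [← mul_inv, ← mul_inv, ← mul_inv, norm_inv]
  subst hX
  have key : ∃ α β : ℝ, a = α ∧ b = β ∧ 0 < (1 - x) * (1 - α * x) * (1 - β * x) * (1 - α * β * x) ∧ (1 - x) * (1 - α * x) * (1 - β * x) * (1 - α * β * x) ≤1 := by
    have p1 :0 <1 - x := by linarith
    have p2 :0 <1 + x := by linarith
    have q1 : (1 - x) * (1 + x) ≤1 := by nlinarith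
    have q0 :0 < (1 - x) * (1 + x) := by positivity
    rcases ha with rfl | rfl | rfl <;> rcases hb with rfl | rfl | rfl
    · exact ⟨0, 0, by simp, by simp, by simpa using h1, by simpa using h0⟩
    · exact ⟨0, 1, by simp, by simp, by nlinarith [mul_pos p1 p1], by nlinarith⟩
    · exact ⟨0, -1, by simp, by simp, by simpa using q0, by simpa using q1⟩
    · exact ⟨1, 0, by simp, by simp, by nlinarith [mul_pos p1 p1], by nlinarith⟩
    · exact ⟨1, 1, by simp, by simp, by simp only [one_mul]; positivity, by
        have : (1 - x) ^4 ≤1 := pow_le_one₀ p1.le (by linarith)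
        simp; nlinarith⟩
    · refine ⟨1, -1, by simp, by simp, ?_, ?_⟩
      · have :0 < ((1 - x) * (1 + x)) * ((1 - x) * (1 + x)) := by positivity
        nlinarith
      · have : ((1 - x) * (1 + x)) * ((1 - x) * (1 + x)) ≤1 := mul_le_one₀ q1 q0.le q1
        nlinarith
    · exact ⟨-1, 0, by simp, by simp, by simpa using q0, by simpa using q1⟩
    · refine ⟨-1, 1, by simp, by simp, ?_, ?_⟩
      · have :0 < ((1 - x) * (1 + x)) * ((1 - x) * (1 + x)) := by positivity
        nlinarith
      · have : ((1 - x) * (1 + x)) * ((1 - x) * (1 + x)) ≤1 := mul_le_one₀ q1 q0.le q1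
        nlinarith
    · refine ⟨-1, -1, by simp, by simp, ?_, ?_⟩
      · have :0 < ((1 - x) * (1 + x)) * ((1 - x) * (1 + x)) := by positivity
        nlinarith
      · have : ((1 - x) * (1 + x)) * ((1 - x) * (1 + x)) ≤1 := mul_le_one₀ q1 q0.le q1
        nlinarith
  obtain ⟨α, β, rfl, rfl, k1, k2⟩ := key
  have e : (1 - (x:ℂ)) * (1 - α * x) * (1 - β * x) * (1 - α * β * x) = (((1 - x) * (1 - α * x) * (1 - β * x) * (1 - α * β * x) : ℝ) : ℂ) := by push_cast; ring
  rw [e, Complex.norm_real, Real.norm_eq_abs, abs_of_pos k1]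
  exact (one_le_inv₀ k1).2 k2

theorem L4_ge {a b : ℕ} [NeZero a] [NeZero b] (χ : DirichletCharacter ℂ a) (ψ : DirichletCharacter ℂ b) (hχ : χ ^2 =1) (hψ : ψ ^2 =1)
    {δ : ℝ} (hδ :0 < δ) :
    1 ≤ ‖LFunction (1 : DirichletCharacter ℂ 1) (1 + δ) * LFunction χ (1 + δ) * LFunction ψ (1 + δ) * LFunction (prodc χ ψ) (1 + δ)‖ := by
  have hs :1 < (1 + δ : ℂ).re := by simp; linarith
  haveI : NeZero (a * b) := ⟨mul_ne_zero (NeZero.ne a) (NeZero.ne b)⟩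
  have h := (((LSeries_eulerProduct_hasProd (1 : DirichletCharacter ℂ 1) hs).mul (LSeries_eulerProduct_hasProd χ hs)).mul
    (LSeries_eulerProduct_hasProd ψ hs)).mul (LSeries_eulerProduct_hasProd (prodc χ ψ) hs)
  rw [LFunction_eq_LSeries _ hs, LFunction_eq_LSeries _ hs, LFunction_eq_LSeries _ hs, LFunction_eq_LSeries _ hs]
  refine ge_of_tendsto (Filter.Tendsto.norm h) (Filter.Eventually.of_forall fun S => ?_)
  rw [norm_prod]
  calc (1:ℝ) = ∏ p ∈ S, (1:ℝ) := by simp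
    _ ≤ _ := by
      refine Finset.prod_le_prod (fun _ _ => zero_le_one) fun p _ => ?_
      have hp1 : (1 : ℝ) < (p : ℕ) := by exact_mod_cast p.2.one_lt
      have e : (((p : ℕ) : ℂ) ^ (-(1 + δ : ℂ))) = (((p : ℕ) : ℝ) ^ (-(1 + δ)) : ℝ) := by
        rw [Complex.ofReal_cpow (by positivity)]; push_cast; rfl
      have := euler4 e (by positivity) (Real.rpow_lt_one_of_one_lt_of_neg hp1 (by linarith)) (real_vals χ hχ p) (real_vals ψ hψ p)
      have e1 : (1 : DirichletCharacter ℂ 1) ((p : ℕ) : ZMod 1) =1 := by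
        rw [Subsingleton.elim (((p : ℕ) : ZMod 1)) 1, map_one]
      rw [prodc_apply, e1, one_mul]
      exact this

theorem repul {a b Q : ℕ} [NeZero a] [NeZero b] (χ : DirichletCharacter ℂ a) (ψ : DirichletCharacter ℂ b) (hχ : χ ^2 =1) (hψ : ψ ^2 =1)
    (hχ1 : χ ≠1) (hψ1 : ψ ≠1) (h : prodc χ ψ ≠1) (ha : a ≤ Q) (hb : b ≤ Q) :
    1 / (10 ^6 * log (9 * (Q:ℝ) ^2) ^3) ≤ max ‖LFunction χ 1‖ ‖LFunction ψ 1‖ := by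
  have ha1 :1 ≤ a := NeZero.one_le
  have hb1 :1 ≤ b := NeZero.one_le
  have hQ1 : (1 : ℝ) ≤ Q := by exact_mod_cast ha1.trans ha
  have haQ : (a : ℝ) ≤ Q := by exact_mod_cast ha
  have hbQ : (b : ℝ) ≤ Q := by exact_mod_cast hb
  haveI : NeZero (a * b) := ⟨mul_ne_zero (NeZero.ne a) (NeZero.ne b)⟩
  set Y :=9 * (Q : ℝ) ^2 with hY
  have hl :2 ≤ log Y := logY_ge (by nlinarith)
  set l := log Y with hldef
  by_contra hcon
  rw [not_le, max_lt_iff] at hcon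
  set A :=1 / (10 ^6 * l ^3) with hA
  set δ := A / (26 * l ^2) with hδ
  have hA0 :0 < A := by positivity
  have hδ0 :0 < δ := by positivity
  have h4 := L4_ge χ ψ hχ hψ hδ0
  have hl3 : (2:ℝ) ^3 ≤ l ^3 := by gcongr
  have hδ1 : δ ≤1 := by
    have : A ≤1 := by rw [hA, div_le_one (by positivity)]; linarith
    rw [hδ, div_le_one (by positivity)]; nlinarith
  have key : ∀ {c : ℕ} [NeZero c] (φ : DirichletCharacter ℂ c), φ ≠1 → (c : ℝ) ≤ Q → ‖LFunction φ 1‖ < A → ‖LFunction φ (1 + δ)‖ ≤2 * A := by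
    intro c _ φ h1 h2 h3
    have hp :0 ≤1 / (2 * log Y) := by positivity
    have := L_lip φ h1 (Y := Y) (t :=0) (by simp; nlinarith) (z :=1 + δ) (w :=1) (by simp only [Complex.add_re, Complex.one_re, Complex.ofReal_re]; linarith) (by simp only [Complex.one_re]; linarith) (by simp) (by simp)
    have e : ‖(1 + δ : ℂ) -1‖ = δ := by simp [abs_of_pos hδ0]
    rw [e, ← hldef] at this
    have e2 :26 * l ^2 * δ = A := by rw [hδ]; field_simp
    have := norm_sub_norm_le (LFunction φ (1 + δ)) (LFunction φ 1)
    linarith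
  have k1 := key χ hχ1 haQ hcon.1
  have k2 := key ψ hψ1 hbQ hcon.2
  have k3 : ‖LFunction (prodc χ ψ) (1 + δ)‖ ≤13 * l := by
    refine L_bd _ h (Y := Y) ?_ ?_
    · simp; nlinarith
    · have hp :0 ≤1 / (log Y) := by positivity
      simp only [Complex.add_re, Complex.one_re, Complex.ofReal_re]; linarith
  have k0 : ‖LFunction (1 : DirichletCharacter ℂ 1) (1 + δ)‖ ≤40 / δ := by
    have := L0_bd (D :=1) (Y :=8) (s :=1 + δ) (by simp; linarith) (by simp)
    refine this.trans ?_
    have e : ‖(1 + δ : ℂ) -1‖ = δ := by simp [abs_of_pos hδ0]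
    have hlog : log 8 ≤3 := by
      rw [Real.log_le_iff_le_exp (by norm_num)]
      have := Real.add_one_le_exp (1 : ℝ)
      have e3 : Real.exp 3 = Real.exp 1 ^3 := by rw [← Real.exp_nat_mul]; norm_num
      rw [e3]; calc (8:ℝ) =2 ^3 := by norm_num
        _ ≤ _ := by gcongr; linarith
    have :39 ≤39 / δ := by rw [le_div_iff₀ hδ0]; linarith
    have e4 :40 / δ =39 / δ +1 / δ := by ring
    rw [e]
    linarith
  rw [norm_mul, norm_mul, norm_mul] at h4
  have : (1 : ℝ) ≤40 / δ * (2 * A) * (2 * A) * (13 * l) := h4.trans (by gcongr)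
  have e :40 / δ * (2 * A) * (2 * A) * (13 * l) =54080 /10 ^6 := by
    rw [hδ, hA]; field_simp; norm_num
  rw [e] at this
  norm_num at this

theorem same_char {a b : ℕ} [NeZero a] [NeZero b] (χ : DirichletCharacter ℂ a) (ψ : DirichletCharacter ℂ b) (hψ : ψ ^2 =1)
    (hp : χ.IsPrimitive) (hq : ψ.IsPrimitive) (h : prodc χ ψ =1) : ‖LFunction χ 1‖ = ‖LFunction ψ 1‖ := by
  have hab : NeZero (a * b) := ⟨mul_ne_zero (NeZero.ne a) (NeZero.ne b)⟩
  have e : changeLevel (dvd_mul_right a b) χ = changeLevel (dvd_mul_left b a) ψ := by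
    have h2 : changeLevel (dvd_mul_left b a) ψ * changeLevel (dvd_mul_left b a) ψ =1 := by
      rw [← map_mul, ← sq, hψ, map_one]
    have h3 : changeLevel (dvd_mul_right a b) χ * changeLevel (dvd_mul_left b a) ψ =1 := h
    exact mul_right_cancel (h3.trans h2.symm)
  have hc : a = b := by
    have h1 := congrArg conductor e
    rw [conductor_changeLevel, conductor_changeLevel] at h1
    rw [← hp, ← hq] ; exact h1
  subst hc
  rw [changeLevel_injective _ e]

noncomputable def eta (Q : ℕ) : ℝ :=1 / (2 *10 ^6 * log (9 * (Q:ℝ) ^2) ^3)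

def GoodQ (Q : ℕ) : Prop := ∀ (D : ℕ) [NeZero D] (χ : DirichletCharacter ℂ D), D ≤ Q → χ ≠1 → χ ^2 =1 → χ.IsPrimitive →
  eta Q ≤ ‖LFunction χ 1‖

theorem good_scale (Q0 : ℕ) : ∃ Q ≥ Q0, GoodQ Q := by
  suffices H : ∀ Q0 : ℕ, 100 ≤ Q0 → ∃ Q ≥ Q0, GoodQ Q by
    obtain ⟨Q, h, hQ⟩ := H (max Q0 100) (le_max_right _ _)
    exact ⟨Q, (le_max_left _ _).trans h, hQ⟩
  intro Q0 hQ0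
  by_cases hg : GoodQ Q0
  · exact ⟨Q0, le_rfl, hg⟩
  simp only [GoodQ, not_forall, not_le] at hg
  obtain ⟨D0, hD0, χ0, hD0Q, h1, h2, h3, h4⟩ := hg
  set ε := ‖LFunction χ0 1‖ with hε
  have hε0 :0 < ε := norm_pos_iff.2 (LFunction_apply_one_ne_zero h1)
  have hex : ∃ Q, Q0 ≤ Q ∧ eta Q ≤ ε := by
    have ht : Filter.Tendsto (fun Q : ℕ => eta Q) Filter.atTop (nhds 0) := by
      unfold eta
      refine Filter.Tendsto.div_atTop tendsto_const_nhds ?_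
      refine Filter.Tendsto.const_mul_atTop (by norm_num) ?_
      refine (Filter.tendsto_pow_atTop (by norm_num)).comp ?_
      refine Real.tendsto_log_atTop.comp ?_
      refine Filter.Tendsto.const_mul_atTop (by norm_num) ?_
      exact (Filter.tendsto_pow_atTop (by norm_num)).comp tendsto_natCast_atTop_atTop
    obtain ⟨Q, hQ1, hQ2⟩ := ((Filter.eventually_ge_atTop Q0).and (ht.eventually (ge_mem_nhds hε0))).exists
    exact ⟨Q, hQ1, hQ2⟩
  classical
  obtain ⟨hQ1, hQ2⟩ := Nat.find_spec hex
  have hmin := fun {m} => Nat.find_min hex (m := m)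
  set Q := Nat.find hex with hQ
  have hQne : Q ≠ Q0 := by rintro h; rw [h] at hQ2; linarith
  have hprev : ε < eta (Q -1) := by
    have := hmin (m := Q -1) (by omega)
    rw [not_and, not_le] at this
    exact this (by omega)
  have hhalf : eta (Q -1) ≤2 * eta Q := by
    have hq : (100 : ℝ) ≤ ((Q -1 : ℕ) : ℝ) := by exact_mod_cast (by omega)
    have hqe : (Q : ℝ) = ((Q -1 : ℕ) : ℝ) +1 := by exact_mod_cast (by omega)
    unfold eta
    set q := ((Q -1 : ℕ) : ℝ) with hqd
    have hl :2 ≤ log (9 * q ^2) := logY_ge (by nlinarith)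
    have hl2 : log (9 * (Q:ℝ) ^2) ≤5 /4 * log (9 * q ^2) := by
      have e :9 * (Q:ℝ) ^2 = (9 * q ^2) * (1 +1 / q) ^2 := by rw [hqe]; field_simp
      rw [e, Real.log_mul (by positivity) (by positivity), Real.log_pow]
      have : log (1 +1 / q) ≤1 / q := by
        have := Real.log_le_sub_one_of_pos (show 0 <1 +1 / q by positivity); linarith
      have :1 / q ≤1 /100 := by gcongr
      push_cast; linarith
    have hl3 :2 ≤ log (9 * (Q:ℝ) ^2) := logY_ge (by nlinarith)
    have : log (9 * (Q:ℝ) ^2) ^3 ≤ (5 /4 * log (9 * q ^2)) ^3 := by gcongr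
    rw [← mul_div_assoc, div_le_div_iff₀ (by positivity) (by positivity)]
    rw [mul_pow] at this
    have :0 < log (9 * q ^2) ^3 := by positivity
    nlinarith
  refine ⟨Q, hQ1, fun D _ χ hDQ g1 g2 g3 => ?_⟩
  by_cases hpc : prodc χ χ0 =1
  · rw [same_char χ χ0 h2 g3 h3 hpc]; exact hQ2
  · have := repul χ χ0 g2 h2 g1 h1 hpc hDQ (hD0Q.trans hQ1)
    have e :1 / (10 ^6 * log (9 * (Q:ℝ) ^2) ^3) =2 * eta Q := by
      unfold eta
      have :1 ≤ Q := by omega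
      have h1 : (1:ℝ) ≤ Q := by exact_mod_cast this
      have hl3 :2 ≤ log (9 * (Q:ℝ) ^2) := logY_ge (by nlinarith)
      field_simp
    rw [e] at this
    have hpos :0 <2 * eta Q := hε0.trans (hprev.trans_le hhalf)
    rcases le_max_iff.1 this with h | h
    · linarith
    · linarith

theorem sw (A B : ℕ) : ∃ L0 : ℝ, ∀ N Q : ℕ, L0 ≤ log N → (Q : ℝ) ≤ log N ^ A → GoodQ Q →
    ∀ (D : ℕ) [NeZero D] (χ : DirichletCharacter ℂ D), D ≤ Q → χ ≠1 → χ.IsPrimitive →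
    ‖Psi χ N‖ ≤ N / log N ^ B := by
  set C : ℝ :=10 ^11 * ((A + B +4 : ℕ) : ℝ) ^10 * (2 *10 ^6 * ((2 * A +1 : ℕ) : ℝ) ^3) with hC
  have ev1 : ∀ᶠ L : ℝ in Filter.atTop, C * log L ^13 ≤ √L := by
    have h := (isLittleO_log_rpow_rpow_atTop (s :=1 /2) (13 : ℝ) (by norm_num)).bound (c :=1 / (C +1)) (by positivity)
    filter_upwards [h, Filter.eventually_ge_atTop 1] with L hL h1
    have hlog :0 ≤ log L := Real.log_nonneg h1
    rw [Real.norm_of_nonneg (by positivity), Real.norm_of_nonneg (by positivity), ← Real.sqrt_eq_rpow] at hL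
    have e : log L ^ (13 : ℝ) = log L ^13 := by exact_mod_cast Real.rpow_natCast _ 13
    rw [e, one_div_mul_eq_div, le_div_iff₀ (by positivity)] at hL
    have :0 ≤ log L ^13 := by positivity
    linarith
  have ev2 : ∀ᶠ L : ℝ in Filter.atTop, 4 * √L ^ (4 * B +7) ≤ Real.exp (√L) := by
    have h := (Real.isLittleO_pow_exp_atTop (n :=4 * B +7)).bound (c :=1 /4) (by positivity)
    have := Real.tendsto_sqrt_atTop.eventually h
    filter_upwards [this] with L hL
    rw [Real.norm_of_nonneg (by positivity), Real.norm_of_nonneg (by positivity)] at hL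
    linarith
  obtain ⟨L0, hL0⟩ := Filter.eventually_atTop.1 (ev1.and ev2)
  refine ⟨max L0 2000, fun N Q hN hQ hg D _ χ hD h1 h2 => ?_⟩
  set L := log N with hL
  obtain ⟨k1, k2⟩ := hL0 L ((le_max_left _ _).trans hN)
  have hL2 :2000 ≤ L := (le_max_right _ _).trans hN
  have hN3 :3 ≤ N := by
    by_contra h
    have h3 : (N:ℝ) ≤3 := by exact_mod_cast (by omega)
    rcases Nat.eq_zero_or_pos N with h0 | h0
    · rw [hL, h0] at hL2; norm_num at hL2
    · have := Real.log_le_sub_one_of_pos (show (0:ℝ) < N by exact_mod_cast h0)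
      linarith
  have hN0 : (0:ℝ) < N := by positivity
  have hs : √L * √L = L := Real.mul_self_sqrt (by linarith)
  have hs2 :40 ≤ √L := Real.le_sqrt_of_sq_le (by linarith)
  have hu :2 ≤ log L := logY_ge (by linarith)
  set u := log L with hu'
  have hD1 : (1:ℝ) ≤ D := by exact_mod_cast NeZero.one_le
  have hDQ : (D:ℝ) ≤ Q := by exact_mod_cast hD
  set η :=1 / (2 *10 ^6 * (((2 * A +1 : ℕ) : ℝ) * u) ^3) with hη
  have hη0 :0 < η := by positivity
  have hη1 : η ≤1 := by
    rw [hη, div_le_one (by positivity)]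
    have : (1:ℝ) ≤ ((2 * A +1 : ℕ) : ℝ) := by exact_mod_cast (by omega)
    have h5 : (1:ℝ) ≤ (((2 * A +1 : ℕ) : ℝ) * u) := by nlinarith
    have : (1:ℝ) ≤ (((2 * A +1 : ℕ) : ℝ) * u) ^3 := one_le_pow₀ h5
    linarith
  have hLA : (1:ℝ) ≤ L ^ A := one_le_pow₀ (by linarith)
  have heta : η ≤ eta Q := by
    rw [hη, eta]
    have hl3 :2 ≤ log (9 * (Q:ℝ) ^2) := logY_ge (by nlinarith)
    have : log (9 * (Q:ℝ) ^2) ≤ ((2 * A +1 : ℕ) : ℝ) * u := by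
      rw [hu', ← Real.log_pow]
      refine Real.log_le_log (by nlinarith) ?_
      rw [pow_succ L, mul_comm 2 A, pow_mul]
      have : (Q:ℝ) ^2 ≤ (L ^ A) ^2 := by gcongr
      nlinarith
    gcongr
  have hx :1 / √L * (10 ^11 * log (L ^ (A + B +4)) ^10) ≤ η := by
    rw [hη, Real.log_pow, one_div_mul_eq_div, div_le_div_iff₀ (by positivity) (by positivity)]
    refine le_trans (le_of_eq ?_) (k1.trans_eq (one_mul _).symm)
    rw [hC]; ring
  have hT : (1:ℝ) ≤ L ^ (B +3) := one_le_pow₀ (by linarith)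
  have hDY : (D:ℝ) * (2 * L ^ (B +3) +9) ≤ L ^ (A + B +4) := by
    calc (D:ℝ) * (2 * L ^ (B +3) +9) ≤ L ^ A * (L * L ^ (B +3)) := by
          gcongr
          · linarith
          · nlinarith
      _ = _ := by ring
  have main := psi_bd χ h1 hN3 hT hDY hη0 hη1 (fun h => heta.trans (hg D χ hD h1 h h2)) (x :=1 / √L) (by positivity) hx
    (by rw [div_le_div_iff₀ (by linarith) (by norm_num)]; linarith)
    (by rw [← hL, div_le_div_iff₀ (by linarith) (by linarith)]; nlinarith)
  refine main.trans ?_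
  rw [← hL]
  have e1 :600 * N * L ^2 / L ^ (B +3) ≤ (N / L ^ B) /2 := by
    have :600 * N * L ^2 / L ^ (B +3) = (N / L ^ B) * (600 / L) := by
      have : L ≠0 := by linarith
      field_simp; ring
    rw [this, div_eq_mul_one_div (N / L ^ B) (2:ℝ)]
    gcongr ?_ * ?_
    rw [div_le_div_iff₀ (by linarith) (by norm_num)]; linarith
  have e2 :2 * (N:ℝ) ^ (1 -1 / √L) * L ^ (B +3) / (1 / √L) ≤ (N / L ^ B) /2 := by
    have : (N:ℝ) ^ (1 -1 / √L) = N / Real.exp (√L) := by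
      rw [Real.rpow_sub hN0, Real.rpow_one]
      congr 1
      rw [Real.rpow_def_of_pos hN0, ← hL]
      congr 1
      rw [mul_one_div, div_eq_iff (by positivity), hs]
    rw [this]
    have e :2 * (N / Real.exp (√L)) * L ^ (B +3) / (1 / √L) = (N /2) * (4 * L ^ (B +3) * √L) / Real.exp (√L) := by
      field_simp; ring
    rw [e, div_div, div_le_div_iff₀ (Real.exp_pos _) (by positivity)]
    have e3 :4 * √L ^ (4 * B +7) =4 * L ^ (B +3) * √L * L ^ B := by
      have :4 * B +7 =2 * (B +3) +1 +2 * B := by ring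
      have hq : √L ^2 = L := by rw [sq, hs]
      rw [this, pow_add, pow_add, pow_mul, pow_mul, hq]; ring
    rw [e3] at k2
    calc N /2 * (4 * L ^ (B +3) * √L) * (L ^ B *2) = N * (4 * L ^ (B +3) * √L * L ^ B) := by ring
      _ ≤ _ := by gcongr
  linarith

end
section
open Finset ArithmeticFunction
section LS
variable {ι : Type} [Fintype ι] [DecidableEq ι]

theorem dual_ls (c : ι → ℕ → ℂ) (K : ℝ) (s : Finset ℕ) (h1 : ∀ i n, ‖c i n‖ ≤1)
    (hij : ∀ i j, i ≠ j → ‖∑ n ∈ s, c i n * (starRingEnd ℂ) (c j n)‖ ≤ K) (a : ι → ℂ) (hK :0 ≤ K) :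
    ∑ n ∈ s, ‖∑ i, a i * c i n‖ ^2 ≤ (#s + K * Fintype.card ι) * ∑ i, ‖a i‖ ^2 := by
  have e : ((∑ n ∈ s, ‖∑ i, a i * c i n‖ ^2 : ℝ) : ℂ) = ∑ i, ∑ j, a i * (starRingEnd ℂ) (a j) * ∑ n ∈ s, c i n * (starRingEnd ℂ) (c j n) := by
    push_cast
    simp_rw [← Complex.mul_conj', map_sum, map_mul, Finset.sum_mul_sum, Finset.mul_sum]
    rw [Finset.sum_comm]
    refine Finset.sum_congr rfl fun i _ => ?_
    rw [Finset.sum_comm]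
    refine Finset.sum_congr rfl fun j _ => ?_
    refine Finset.sum_congr rfl fun n _ => ?_
    ring
  have hb : ∀ i j, ‖∑ n ∈ s, c i n * (starRingEnd ℂ) (c j n)‖ ≤ (if i = j then (#s : ℝ) else 0) + K := by
    intro i j
    split_ifs with h
    · refine (norm_sum_le _ _).trans ?_
      refine (Finset.sum_le_sum (g := fun _ => (1:ℝ)) fun n _ => ?_).trans ?_
      · rw [norm_mul, RCLike.norm_conj]; exact mul_le_one₀ (h1 _ _) (norm_nonneg _) (h1 _ _)
      · simp [hK]
    · rw [zero_add]; exact hij i j h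
  have h2 : ∑ n ∈ s, ‖∑ i, a i * c i n‖ ^2 ≤ ∑ i, ∑ j, ‖a i‖ * ‖a j‖ * ((if i = j then (#s : ℝ) else 0) + K) := by
    have h0 :0 ≤ ∑ n ∈ s, ‖∑ i, a i * c i n‖ ^2 := Finset.sum_nonneg fun _ _ => by positivity
    rw [← Real.norm_of_nonneg h0, ← Complex.norm_real, e]
    refine (norm_sum_le _ _).trans (Finset.sum_le_sum fun i _ => (norm_sum_le _ _).trans (Finset.sum_le_sum fun j _ => ?_))
    rw [norm_mul, norm_mul, RCLike.norm_conj]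
    gcongr
    exact hb i j
  refine h2.trans ?_
  have e3 : ∑ i, ∑ j, ‖a i‖ * ‖a j‖ * ((if i = j then (#s : ℝ) else 0) + K) = #s * ∑ i, ‖a i‖ ^2 + K * (∑ i, ‖a i‖) ^2 := by
    simp_rw [mul_add, Finset.sum_add_distrib, mul_ite, mul_zero, Finset.sum_ite_eq, Finset.mem_univ, if_true]
    congr 1
    · rw [Finset.mul_sum]; exact Finset.sum_congr rfl fun i _ => by ring
    · rw [sq, Finset.sum_mul_sum, Finset.mul_sum]
      refine Finset.sum_congr rfl fun i _ => ?_
      rw [Finset.mul_sum]; exact Finset.sum_congr rfl fun j _ => by ring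
  rw [e3, add_mul, mul_assoc K]
  gcongr
  have := sq_sum_le_card_mul_sum_sq (s := (Finset.univ : Finset ι)) (f := fun i => ‖a i‖)
  simpa using this

theorem lsieve (c : ι → ℕ → ℂ) (K : ℝ) (s : Finset ℕ) (h1 : ∀ i n, ‖c i n‖ ≤1)
    (hij : ∀ i j, i ≠ j → ‖∑ n ∈ s, c i n * (starRingEnd ℂ) (c j n)‖ ≤ K) (hK :0 ≤ K) (b : ℕ → ℂ) :
    ∑ i, ‖∑ n ∈ s, b n * c i n‖ ^2 ≤ (#s + K * Fintype.card ι) * ∑ n ∈ s, ‖b n‖ ^2 := by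
  set B : ι → ℂ := fun i => ∑ n ∈ s, b n * c i n with hB
  set X := ∑ i, ‖B i‖ ^2 with hX
  have hX0 :0 ≤ X := Finset.sum_nonneg fun _ _ => by positivity
  have e : (X : ℂ) = ∑ n ∈ s, b n * ∑ i, (starRingEnd ℂ) (B i) * c i n := by
    rw [hX]; push_cast
    simp_rw [← Complex.mul_conj', Finset.mul_sum]
    rw [Finset.sum_comm]
    refine Finset.sum_congr rfl fun i _ => ?_
    conv_lhs => rw [hB]
    simp only []
    rw [Finset.sum_mul]
    exact Finset.sum_congr rfl fun n _ => by ring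
  have h2 : X ≤ ∑ n ∈ s, ‖b n‖ * ‖∑ i, (starRingEnd ℂ) (B i) * c i n‖ := by
    rw [← Real.norm_of_nonneg hX0, ← Complex.norm_real, e]
    refine (norm_sum_le _ _).trans (Finset.sum_le_sum fun n _ => ?_)
    rw [norm_mul]
  have h3 := Finset.sum_mul_sq_le_sq_mul_sq s (fun n => ‖b n‖) (fun n => ‖∑ i, (starRingEnd ℂ) (B i) * c i n‖)
  have h4 := dual_ls c K s h1 hij (fun i => (starRingEnd ℂ) (B i)) hK
  simp_rw [RCLike.norm_conj] at h4
  rw [← hX] at h4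
  have hb0 :0 ≤ ∑ n ∈ s, ‖b n‖ ^2 := Finset.sum_nonneg fun _ _ => by positivity
  have h5 : X * X ≤ X * ((#s + K * Fintype.card ι) * ∑ n ∈ s, ‖b n‖ ^2) := by
    calc X * X = X ^2 := by ring
      _ ≤ (∑ n ∈ s, ‖b n‖ * ‖∑ i, (starRingEnd ℂ) (B i) * c i n‖) ^2 := by gcongr
      _ ≤ _ := h3
      _ ≤ (∑ n ∈ s, ‖b n‖ ^2) * ((#s + K * Fintype.card ι) * X) := by gcongr
      _ = _ := by ring
  rcases hX0.eq_or_lt with h | h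
  · rw [← h]; positivity
  · exact le_of_mul_le_mul_left h5 h

end LS

theorem conv_sum (g h : ArithmeticFunction ℝ) (N : ℕ) (F : ℕ → ℂ) (hF : ∀ n, N < n → F n =0) :
    ∑ n ∈ Icc 1 N, (((g * h) n : ℝ) : ℂ) * F n = ∑ m ∈ Icc 1 N, ∑ l ∈ Icc 1 N, (g m : ℂ) * (h l : ℂ) * F (m * l) := by
  rw [← Finset.sum_product']
  have e : ∀ n ∈ Icc 1 N, (((g * h) n : ℝ) : ℂ) * F n = ∑ x ∈ (Icc 1 N ×ˢ Icc 1 N) with x.1 * x.2 = n, (g x.1 : ℂ) * (h x.2 : ℂ) * F (x.1 * x.2) := by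
    intro n hn
    have hn' := mem_Icc.1 hn
    rw [ArithmeticFunction.mul_apply]
    push_cast
    rw [Finset.sum_mul]
    have : n.divisorsAntidiagonal = (Icc 1 N ×ˢ Icc 1 N).filter (fun x ↦ x.1 * x.2 = n) := by
      ext ⟨a, b⟩
      simp only [Nat.mem_divisorsAntidiagonal, mem_filter, mem_product, mem_Icc]
      constructor
      · rintro ⟨rfl, h0⟩
        have ha :1 ≤ a := Nat.pos_of_ne_zero fun h => h0 (by simp [h])
        have hb :1 ≤ b := Nat.pos_of_ne_zero fun h => h0 (by simp [h])
        exact ⟨⟨⟨ha, by nlinarith⟩, ⟨hb, by nlinarith⟩⟩, rfl⟩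
      · rintro ⟨_, rfl⟩
        exact ⟨rfl, by omega⟩
    rw [this]
    refine Finset.sum_congr rfl fun x hx => ?_
    rw [(mem_filter.1 hx).2]
  rw [Finset.sum_congr rfl e]
  have hsub : ∑ n ∈ Icc 1 N, ∑ x ∈ (Icc 1 N ×ˢ Icc 1 N) with x.1 * x.2 = n, (g x.1 : ℂ) * (h x.2 : ℂ) * F (x.1 * x.2)
     = ∑ x ∈ (Icc 1 N ×ˢ Icc 1 N) with x.1 * x.2 ∈ Icc 1 N, (g x.1 : ℂ) * (h x.2 : ℂ) * F (x.1 * x.2) := by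
    simp_rw [Finset.sum_filter]
    rw [Finset.sum_comm]
    refine Finset.sum_congr rfl fun x _ => ?_
    rw [Finset.sum_ite_eq]
  rw [hsub, Finset.sum_filter]
  refine Finset.sum_congr rfl fun x hx => ?_
  split_ifs with h
  · rfl
  · rw [hF, mul_zero]
    by_contra h'
    have := mem_product.1 hx
    simp only [mem_Icc] at this h
    exact h ⟨Nat.mul_pos this.1.1 this.2.1, by omega⟩

/-- truncated weight -/
noncomputable def wt (N n : ℕ) : ℝ := max 0 (Real.log (N / n))

theorem wt_nonneg (N n : ℕ) :0 ≤ wt N n := le_max_left _ _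

theorem wt_zero {N n : ℕ} (h : N < n) : wt N n =0 := by
  have : (0:ℝ) < n := by exact_mod_cast (by omega)
  exact max_eq_left (Real.log_nonpos (by positivity) ((div_le_one this).2 (by exact_mod_cast h.le)))

theorem wt_eq {N n : ℕ} (h1 :1 ≤ n) (h : n ≤ N) : wt N n = Real.log (N / n) := by
  have : (0:ℝ) < n := by exact_mod_cast (by omega)
  exact max_eq_right (Real.log_nonneg ((one_le_div this).2 (by exact_mod_cast h)))

theorem wt_anti {N a b : ℕ} (ha :1 ≤ a) (h : a ≤ b) : wt N b ≤ wt N a := by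
  rcases lt_or_ge N b with hb | hb
  · rw [wt_zero hb]; exact wt_nonneg _ _
  rw [wt_eq (ha.trans h) hb, wt_eq ha (h.trans hb)]
  have h1 : (0:ℝ) < a := by exact_mod_cast (by omega)
  have h2 : (0:ℝ) < N := by exact_mod_cast (by omega)
  have h3 : (a:ℝ) ≤ b := by exact_mod_cast h
  have : (0:ℝ) < b := by linarith
  exact Real.log_le_log (by positivity) (by gcongr)

theorem wt_le (N n : ℕ) : wt N n ≤ Real.log N := by
  have h0 :0 ≤ Real.log N := Real.log_natCast_nonneg N
  rcases Nat.eq_zero_or_pos n with rfl | h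
  · simpa [wt] using h0
  refine (wt_anti le_rfl h).trans ?_
  simp [wt, h0]

theorem wt_log {N k d : ℕ} (hk :1 ≤ k) (hd :1 ≤ d) : Real.log k * wt N (d * k) = Real.log N * wt N (d * k) - wt N k * wt N (d * k) := by
  rcases lt_or_ge N (d * k) with h | h
  · rw [wt_zero h]; ring
  · have hkN : k ≤ N := by nlinarith
    have h1 : (0:ℝ) < k := by exact_mod_cast (by omega)
    have h2 : (0:ℝ) < N := by exact_mod_cast (by omega)
    rw [wt_eq hk hkN, Real.log_div h2.ne' h1.ne']; ring

theorem ti_one {c : ℕ → ℂ} {K : ℝ} (hs : ∀ a b, ‖∑ n ∈ Ico a b, c n‖ ≤ K) (N d : ℕ) (hd :1 ≤ d) : ‖∑ k ∈ Icc 1 N, c k * (wt N (d * k) : ℂ)‖ ≤ K * Real.log N := by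
  have hK :0 ≤ K := (norm_nonneg _).trans (hs 0 0)
  have := abel_mono c (fun k => wt N (d * k)) K 1 (hs 1) (fun i hi => wt_anti (Nat.mul_pos hd hi) (by gcongr; omega)) (fun _ _ => wt_nonneg _ _) (N +1)
  refine le_trans (le_of_eq ?_) (this.trans (mul_le_mul_of_nonneg_left (wt_le _ _) hK))
  congr 1
  exact Finset.sum_congr (by ext; simp) fun k _ => by rw [Complex.real_smul]; ring

theorem ti_two {c : ℕ → ℂ} {K : ℝ} (hs : ∀ a b, ‖∑ n ∈ Ico a b, c n‖ ≤ K) (N d : ℕ) (hd :1 ≤ d) : ‖∑ k ∈ Icc 1 N, c k * ((Real.log k * wt N (d * k) : ℝ) : ℂ)‖ ≤2 * K * Real.log N ^2 := by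
  have hK :0 ≤ K := (norm_nonneg _).trans (hs 0 0)
  have h0 :0 ≤ Real.log N := Real.log_natCast_nonneg N
  have e : ∑ k ∈ Icc 1 N, c k * ((Real.log k * wt N (d * k) : ℝ) : ℂ) = (Real.log N : ℂ) * ∑ k ∈ Icc 1 N, c k * (wt N (d * k) : ℂ)
     - ∑ k ∈ Ico 1 (N +1), (wt N k * wt N (d * k)) • c k := by
    rw [Finset.mul_sum, show Ico 1 (N +1) = Icc 1 N by ext; simp, ← Finset.sum_sub_distrib]
    refine Finset.sum_congr rfl fun k hk => ?_
    rw [wt_log (mem_Icc.1 hk).1 hd, Complex.real_smul]; push_cast; ring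
  rw [e]
  refine (norm_sub_le _ _).trans ?_
  have h1 := ti_one hs N d hd
  have h2 := abel_mono c (fun k => wt N k * wt N (d * k)) K 1 (hs 1) (fun i hi => mul_le_mul (wt_anti hi (by omega)) (wt_anti (Nat.mul_pos hd hi) (by gcongr; omega)) (wt_nonneg _ _) (wt_nonneg _ _)) (fun _ _ => mul_nonneg (wt_nonneg _ _) (wt_nonneg _ _)) (N +1)
  rw [norm_mul, Complex.norm_real, Real.norm_of_nonneg h0]
  have h3 : wt N 1 * wt N (d *1) ≤ Real.log N * Real.log N := mul_le_mul (wt_le _ _) (wt_le _ _) (wt_nonneg _ _) h0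
  calc _ ≤ Real.log N * (K * Real.log N) + K * (Real.log N * Real.log N) := add_le_add (mul_le_mul_of_nonneg_left h1 h0) (h2.trans (mul_le_mul_of_nonneg_left h3 hK))
    _ = _ := by ring

/-- off-diagonal inner sum -/
theorem tii_off {c : ℕ → ℂ} {K : ℝ} (hs : ∀ a b, ‖∑ n ∈ Ico a b, c n‖ ≤ K) (N U l l' : ℕ) (hl :1 ≤ l) (hl' :1 ≤ l') : ‖∑ m ∈ Ico (U +1) (N +1), c m * ((m * (wt N (m * l) * wt N (m * l')) : ℝ) : ℂ)‖ ≤2 * K * (N / l) * Real.log N ^2 := by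
  have hK :0 ≤ K := (norm_nonneg _).trans (hs 0 0)
  have h0 :0 ≤ Real.log N := Real.log_natCast_nonneg N
  set M : ℝ := N / l with hM
  have hM0 :0 ≤ M := by positivity
  have hl0 : (0:ℝ) < l := by exact_mod_cast hl
  set v : ℕ → ℝ := fun m => wt N (m * l) * wt N (m * l') with hv
  have v0 : ∀ m, 0 ≤ v m := fun m => mul_nonneg (wt_nonneg _ _) (wt_nonneg _ _)
  have v1 : ∀ m, v m ≤ Real.log N ^2 := fun m => by
    rw [sq]; exact mul_le_mul (wt_le _ _) (wt_le _ _) (wt_nonneg _ _) h0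
  have vm : ∀ m ≥ U +1, v (m +1) ≤ v m := fun m hm => by
    refine mul_le_mul (wt_anti (Nat.mul_pos (by omega) hl) (by gcongr; omega)) (wt_anti (Nat.mul_pos (by omega) hl') (by gcongr; omega)) (wt_nonneg _ _) (wt_nonneg _ _)
  have e : ∑ m ∈ Ico (U +1) (N +1), c m * ((m * v m : ℝ) : ℂ) = (M : ℂ) * ∑ m ∈ Ico (U +1) (N +1), v m • c m
     - ∑ m ∈ Ico (U +1) (N +1), (max 0 (M - m) * v m) • c m := by
    rw [Finset.mul_sum, ← Finset.sum_sub_distrib]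
    refine Finset.sum_congr rfl fun m hm => ?_
    have : (m : ℝ) * v m = M * v m - max 0 (M - m) * v m := by
      rcases le_or_gt (m : ℝ) M with h | h
      · rw [max_eq_right (by linarith)]; ring
      · have : v m =0 := by
          simp only [hv]
          rw [wt_zero, zero_mul]
          rw [hM, div_lt_iff₀ hl0] at h
          exact_mod_cast h
        rw [this]; ring
    rw [this, Complex.real_smul, Complex.real_smul]; push_cast; ring
  rw [e]
  refine (norm_sub_le _ _).trans ?_
  have h1 := abel_mono c v K (U +1) (hs _) vm (fun _ _ => v0 _) (N +1)
  have h2 := abel_mono c (fun m => max 0 (M - m) * v m) K (U +1) (hs _) (fun i hi => mul_le_mul (by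
    refine max_le_max le_rfl ?_; push_cast; linarith) (vm i hi) (v0 _) (le_max_left _ _)) (fun _ _ => mul_nonneg (le_max_left _ _) (v0 _)) (N +1)
  rw [norm_mul, Complex.norm_real, Real.norm_of_nonneg hM0]
  have h3 : max 0 (M - (U +1 : ℕ)) * v (U +1) ≤ M * Real.log N ^2 := by
    refine mul_le_mul (max_le hM0 ?_) (v1 _) (v0 _) hM0
    have : (0:ℝ) ≤ (U +1 : ℕ) := by positivity
    linarith
  calc _ ≤ M * (K * Real.log N ^2) + K * (M * Real.log N ^2) := add_le_add (mul_le_mul_of_nonneg_left (h1.trans (mul_le_mul_of_nonneg_left (v1 _) hK)) hM0) (h2.trans (mul_le_mul_of_nonneg_left h3 hK))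
    _ = _ := by ring

theorem harm_bd (a N : ℕ) : ∑ m ∈ Ico (a +1) (N +1), (1 : ℝ) / m ≤1 + Real.log N := by
  have h := harmonic_le_one_add_log N
  rw [harmonic_eq_sum_Icc] at h
  push_cast at h
  refine le_trans ?_ h
  simp_rw [one_div]
  exact Finset.sum_le_sum_of_subset_of_nonneg (fun x hx => by simp only [mem_Ico, mem_Icc] at *; omega) (fun _ _ _ => by positivity)

section
variable {ι : Type} [Fintype ι] [DecidableEq ι]

theorem tii_diag (c : ι → ℕ → ℂ) (K N U m : ℕ) (h1 : ∀ i n, ‖c i n‖ ≤1) (hm :1 ≤ m)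
    (hij : ∀ i j, i ≠ j → ∀ a b, ‖∑ n ∈ Ico a b, c i n * (starRingEnd ℂ) (c j n)‖ ≤ K) (hcard : Fintype.card ι ≤ K) (hU : K * K ≤ U)
    (a : ℕ → ℝ) (ha : ∀ l ≤ N, |a l| ≤ Real.log N) :
    m * ∑ i, ‖∑ l ∈ Ico (U +1) (N +1), ((a l * wt N (m * l) : ℝ) : ℂ) * c i l‖ ^2 ≤2 * N ^2 * Real.log N ^4 * (1 / m) := by
  have h0 :0 ≤ Real.log N := Real.log_natCast_nonneg N
  set Y := N / m with hY
  have hYN : Y ≤ N := Nat.div_le_self _ _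
  have e : ∀ i, ∑ l ∈ Ico (U +1) (N +1), ((a l * wt N (m * l) : ℝ) : ℂ) * c i l = ∑ l ∈ Ico (U +1) (Y +1), ((a l * wt N (m * l) : ℝ) : ℂ) * c i l := by
    intro i
    symm
    refine Finset.sum_subset (Ico_subset_Ico le_rfl (by omega)) fun l hl hl' => ?_
    simp only [mem_Ico, not_and, not_lt] at hl hl'
    have : N < m * l := by
      have := hl' hl.1
      rw [hY] at this
      rw [mul_comm]
      exact (Nat.div_lt_iff_lt_mul hm).1 (by omega)
    rw [wt_zero this]; simp
  simp_rw [e]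
  have hls := lsieve c K (Ico (U +1) (Y +1)) h1 (fun i j h => hij i j h _ _) (by positivity) (fun l => ((a l * wt N (m * l) : ℝ) : ℂ))
  have hb : ∑ n ∈ Ico (U +1) (Y +1), ‖((a n * wt N (m * n) : ℝ) : ℂ)‖ ^2 ≤ #(Ico (U +1) (Y +1)) * Real.log N ^4 := by
    rw [← nsmul_eq_mul]
    refine Finset.sum_le_card_nsmul _ _ _ fun n hn => ?_
    rw [Complex.norm_real, Real.norm_eq_abs, abs_mul, abs_of_nonneg (wt_nonneg _ _)]
    calc (|a n| * wt N (m * n)) ^2 ≤ (Real.log N * Real.log N) ^2 := by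
          have := ha n (by have := mem_Ico.1 hn; omega)
          have := wt_le N (m * n)
          have := wt_nonneg N (m * n)
          gcongr
      _ = _ := by ring
  have hc : (#(Ico (U +1) (Y +1)) : ℝ) * (#(Ico (U +1) (Y +1)) + K * Fintype.card ι) ≤2 * (N / m) ^2 := by
    have hYr : (Y : ℝ) ≤ N / m := Nat.cast_div_le
    rcases le_or_gt Y U with h | h
    · rw [Nat.card_Ico, Nat.sub_eq_zero_of_le (by omega)]; simp; positivity
    · have h2 : (#(Ico (U +1) (Y +1)) : ℝ) ≤ Y := by rw [Nat.card_Ico]; exact_mod_cast (by omega)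
      have h3 : (K : ℝ) * Fintype.card ι ≤ Y := by
        have : K * Fintype.card ι ≤ Y := (Nat.mul_le_mul_left K hcard).trans (hU.trans h.le)
        exact_mod_cast this
      calc _ ≤ (Y : ℝ) * (Y + Y) := by gcongr
        _ =2 * (Y : ℝ) ^2 := by ring
        _ ≤ _ := by gcongr
  have hm0 : (0:ℝ) < m := by exact_mod_cast hm
  calc _ ≤ (m : ℝ) * ((#(Ico (U +1) (Y +1)) + K * Fintype.card ι) * (#(Ico (U +1) (Y +1)) * Real.log N ^4)) := by
        refine mul_le_mul_of_nonneg_left (hls.trans ?_) hm0.le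
        gcongr
    _ = (m : ℝ) * Real.log N ^4 * (#(Ico (U +1) (Y +1)) * (#(Ico (U +1) (Y +1)) + K * Fintype.card ι)) := by ring
    _ ≤ (m : ℝ) * Real.log N ^4 * (2 * (N / m) ^2) := by gcongr
    _ = _ := by field_simp

theorem tii_offd (c c' : ℕ → ℂ) (K N U : ℕ) (h1 : ∀ n, ‖c n‖ ≤1) (h1' : ∀ n, ‖c' n‖ ≤1)
    (hs : ∀ a b, ‖∑ n ∈ Ico a b, c n * c' n‖ ≤ K) (hU :1 ≤ U) 
    (a : ℕ → ℝ) (ha : ∀ l ≤ N, |a l| ≤ Real.log N) :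
    ‖∑ m ∈ Ico (U +1) (N +1), (m : ℂ) * (c m * c' m) * ((∑ l ∈ Ico (U +1) (N +1), ((a l * wt N (m * l) : ℝ) : ℂ) * c l) *
      ∑ l ∈ Ico (U +1) (N +1), ((a l * wt N (m * l) : ℝ) : ℂ) * c' l)‖ ≤2 * K * N ^2 / U * Real.log N ^4 * (1 + Real.log N) := by
  have h0 :0 ≤ Real.log N := Real.log_natCast_nonneg N
  set I := Ico (U +1) (N +1) with hI
  have e : ∑ m ∈ I, (m : ℂ) * (c m * c' m) * ((∑ l ∈ I, ((a l * wt N (m * l) : ℝ) : ℂ) * c l) * ∑ l ∈ I, ((a l * wt N (m * l) : ℝ) : ℂ) * c' l)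
    = ∑ l ∈ I, ∑ l' ∈ I, (a l * c l * (a l' * c' l')) * ∑ m ∈ I, c m * c' m * ((m * (wt N (m * l) * wt N (m * l')) : ℝ) : ℂ) := by
    simp_rw [Finset.sum_mul_sum, Finset.mul_sum]
    rw [Finset.sum_comm]
    refine Finset.sum_congr rfl fun l _ => ?_
    rw [Finset.sum_comm]
    refine Finset.sum_congr rfl fun l' _ => ?_
    refine Finset.sum_congr rfl fun m _ => ?_
    push_cast; ring
  rw [e]
  have hb : ∀ l ∈ I, ∀ l' ∈ I, ‖(a l * c l * (a l' * c' l')) * ∑ m ∈ I, c m * c' m * ((m * (wt N (m * l) * wt N (m * l')) : ℝ) : ℂ)‖ ≤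
      (if l' ∈ Ico (U +1) (N / U +1) then 2 * K * N * Real.log N ^4 * (1 / l) else 0) := by
    intro l hl l' hl'
    rw [hI, mem_Ico] at hl hl'
    split_ifs with h
    · rw [norm_mul]
      have := tii_off hs N U l l' (by omega) (by omega)
      have ha1 := ha l (by omega)
      have ha2 := ha l' (by omega)
      have hh : ‖(a l * c l * (a l' * c' l'))‖ ≤ Real.log N ^2 := by
        simp only [norm_mul, Complex.norm_real, Real.norm_eq_abs]
        calc |a l| * ‖c l‖ * (|a l'| * ‖c' l'‖) ≤ Real.log N *1 * (Real.log N *1) := by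
              have := h1 l
              have := h1' l'
              gcongr
          _ = _ := by ring
      calc _ ≤ Real.log N ^2 * (2 * K * (N / l) * Real.log N ^2) := mul_le_mul hh this (norm_nonneg _) (by positivity)
        _ = _ := by ring
    · have : ∑ m ∈ I, c m * c' m * ((m * (wt N (m * l) * wt N (m * l')) : ℝ) : ℂ) =0 := by
        refine Finset.sum_eq_zero fun m hm => ?_
        rw [hI, mem_Ico] at hm
        have : N < m * l' := by
          rw [mem_Ico] at h
          have h2 : N / U < l' := by omega
          rw [Nat.div_lt_iff_lt_mul hU] at h2
          nlinarith
        rw [wt_zero this]; simp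
      rw [this]; simp
  refine (norm_sum_le _ _).trans ((Finset.sum_le_sum fun l hl => (norm_sum_le _ _).trans (Finset.sum_le_sum fun l' hl' => hb l hl l' hl')).trans ?_)
  have hX : ∀ l ∈ I, ∑ l' ∈ I, (if l' ∈ Ico (U +1) (N / U +1) then 2 * K * N * Real.log N ^4 * (1 / (l:ℝ)) else 0) ≤2 * K * N * Real.log N ^4 * (N / U) * (1 / (l:ℝ)) := by
    intro l _
    rw [← Finset.sum_filter, Finset.sum_const, nsmul_eq_mul]
    have : (#({x ∈ I | x ∈ Ico (U +1) (N / U +1)}) : ℝ) ≤ N / U := by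
      have h2 : #({x ∈ I | x ∈ Ico (U +1) (N / U +1)}) ≤ N / U := by
        refine (Finset.card_le_card (t := Ico (U +1) (N / U +1)) fun x hx => (mem_filter.1 hx).2).trans ?_
        rw [Nat.card_Ico]; generalize N / U = d; omega
      calc _ ≤ ((N / U : ℕ) : ℝ) := by exact_mod_cast h2
        _ ≤ _ := Nat.cast_div_le
    calc _ ≤ (N / U : ℝ) * (2 * K * N * Real.log N ^4 * (1 / (l:ℝ))) := by gcongr
      _ = _ := by ring
  refine (Finset.sum_le_sum hX).trans ?_
  rw [← Finset.mul_sum]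
  calc _ ≤2 * K * N * Real.log N ^4 * (N / U) * (1 + Real.log N) := by gcongr; exact harm_bd U N
    _ = _ := by ring

theorem tii (c : ι → ℕ → ℂ) (K N : ℕ) (hK :1 ≤ K) (h1 : ∀ i n, ‖c i n‖ ≤1)
    (hij : ∀ i j, i ≠ j → ∀ a b, ‖∑ n ∈ Ico a b, c i n * (starRingEnd ℂ) (c j n)‖ ≤ K) (hcard : Fintype.card ι ≤ K) 
    (a b : ℕ → ℝ) (ha : ∀ l ≤ N, |a l| ≤ Real.log N) (hb : ∀ m, |b m| ≤1) (ε : ι → ℂ) (hε : ∀ i, ‖ε i‖ ≤1) :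
    ‖∑ i, ε i * ∑ m ∈ Ico (K ^3 +1) (N +1), ∑ l ∈ Ico (K ^3 +1) (N +1), (b m : ℂ) * (a l : ℂ) * (c i m * c i l * (wt N (m * l) : ℂ))‖ ≤
      2 * N * Real.log N ^2 * (1 + Real.log N) := by
  have h0 :0 ≤ Real.log N := Real.log_natCast_nonneg N
  set U := K ^3 with hU
  have hU1 :1 ≤ U := Nat.one_le_pow _ _ hK
  set I := Ico (U +1) (N +1) with hI
  set B : ℕ → ι → ℂ := fun m i => ∑ l ∈ I, ((a l * wt N (m * l) : ℝ) : ℂ) * c i l with hB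
  set F : ℕ → ℂ := fun m => ∑ i, ε i * c i m * B m i with hF
  have e1 : ∑ i, ε i * ∑ m ∈ I, ∑ l ∈ I, (b m : ℂ) * (a l : ℂ) * (c i m * c i l * (wt N (m * l) : ℂ)) = ∑ m ∈ I, (b m : ℂ) * F m := by
    simp only [hF, hB, Finset.mul_sum]
    rw [Finset.sum_comm]
    refine Finset.sum_congr rfl fun m _ => Finset.sum_congr rfl fun i _ => Finset.sum_congr rfl fun l _ => ?_
    push_cast; ring
  rw [e1]
  have hS : ‖∑ m ∈ I, (b m : ℂ) * F m‖ ≤ ∑ m ∈ I, √(1 / m) * (√m * ‖F m‖) := by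
    refine (norm_sum_le _ _).trans (Finset.sum_le_sum fun m hm => ?_)
    have hm0 : (0:ℝ) < m := by exact_mod_cast (by rw [hI, mem_Ico] at hm; omega)
    rw [norm_mul, Complex.norm_real, Real.norm_eq_abs, ← mul_assoc, ← Real.sqrt_mul (by positivity), one_div_mul_cancel hm0.ne', Real.sqrt_one]
    exact mul_le_mul_of_nonneg_right (hb m) (norm_nonneg _)
  have hCS := Finset.sum_mul_sq_le_sq_mul_sq I (fun m => √(1 / (m:ℝ))) (fun m => √(m:ℝ) * ‖F m‖)
  have e2 : ∑ m ∈ I, √(1 / (m:ℝ)) ^2 ≤1 + Real.log N := by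
    refine le_trans (le_of_eq ?_) (harm_bd U N)
    exact Finset.sum_congr rfl fun m _ => Real.sq_sqrt (by positivity)
  have e3 : ∑ m ∈ I, (√(m:ℝ) * ‖F m‖) ^2 = ∑ m ∈ I, (m:ℝ) * ‖F m‖ ^2 :=
    Finset.sum_congr rfl fun m _ => by rw [mul_pow, Real.sq_sqrt (by positivity)]
  set G : ι → ι → ℂ := fun i j => ∑ m ∈ I, (m : ℂ) * (c i m * (starRingEnd ℂ) (c j m)) * (B m i * (starRingEnd ℂ) (B m j)) with hG
  have e4 : ((∑ m ∈ I, (m:ℝ) * ‖F m‖ ^2 : ℝ) : ℂ) = ∑ i, ∑ j, ε i * (starRingEnd ℂ) (ε j) * G i j := by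
    push_cast
    simp only [hG, hF]
    simp_rw [← Complex.mul_conj', map_sum, map_mul, Finset.sum_mul_sum, Finset.mul_sum]
    rw [Finset.sum_comm]
    refine Finset.sum_congr rfl fun i _ => ?_
    rw [Finset.sum_comm]
    refine Finset.sum_congr rfl fun j _ => Finset.sum_congr rfl fun m _ => ?_
    ring
  have hoff : ∀ i j, i ≠ j → ‖G i j‖ ≤2 * K * N ^2 / U * Real.log N ^4 * (1 + Real.log N) := by
    intro i j h
    have := tii_offd (c i) (fun n => (starRingEnd ℂ) (c j n)) K N U (h1 i) (fun n => by rw [RCLike.norm_conj]; exact h1 j n) (hij i j h) hU1 a ha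
    refine le_trans (le_of_eq ?_) this
    simp only [hG, hB, map_sum, map_mul, Complex.conj_ofReal]
    rfl
  have hdiag : ∑ i, ‖G i i‖ ≤2 * N ^2 * Real.log N ^4 * (1 + Real.log N) := by
    have : ∀ i, ‖G i i‖ ≤ ∑ m ∈ I, (m : ℝ) * ‖B m i‖ ^2 := by
      intro i
      refine (norm_sum_le _ _).trans (Finset.sum_le_sum fun m _ => ?_)
      simp only [norm_mul, RCLike.norm_conj, Complex.norm_natCast]
      have := mul_le_one₀ (h1 i m) (norm_nonneg _) (h1 i m)
      calc (m:ℝ) * (‖c i m‖ * ‖c i m‖) * (‖B m i‖ * ‖B m i‖) ≤ (m:ℝ) *1 * (‖B m i‖ * ‖B m i‖) := by gcongr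
        _ = _ := by ring
    refine (Finset.sum_le_sum fun i _ => this i).trans ?_
    rw [Finset.sum_comm]
    calc _ ≤ ∑ m ∈ I, 2 * N ^2 * Real.log N ^4 * (1 / (m:ℝ)) := by
          refine Finset.sum_le_sum fun m hm => ?_
          rw [← Finset.mul_sum]
          exact tii_diag c K N U m h1 (by rw [hI, mem_Ico] at hm; omega) hij hcard (by rw [hU]; nlinarith) a ha
      _ =2 * N ^2 * Real.log N ^4 * ∑ m ∈ I, (1 / (m:ℝ)) := by rw [Finset.mul_sum]
      _ ≤ _ := by gcongr; exact harm_bd U N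
  set Z :=2 * (N:ℝ) ^2 * Real.log N ^4 * (1 + Real.log N) with hZ
  have hZ0 :0 ≤ Z := by positivity
  have hK0 : (0:ℝ) < K := by exact_mod_cast hK
  have hcK : (Fintype.card ι : ℝ) ≤ K := by exact_mod_cast hcard
  have hmain : ∑ m ∈ I, (m:ℝ) * ‖F m‖ ^2 ≤2 * Z := by
    have hp :0 ≤ ∑ m ∈ I, (m:ℝ) * ‖F m‖ ^2 := Finset.sum_nonneg fun _ _ => by positivity
    rw [← Real.norm_of_nonneg hp, ← Complex.norm_real, e4]
    have hx : ∀ i, ‖∑ j, ε i * (starRingEnd ℂ) (ε j) * G i j‖ ≤ ‖G i i‖ + Z / K := by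
      intro i
      calc _ ≤ ∑ j, ((if i = j then ‖G i i‖ else 0) + Z / K ^2) := by
            refine (norm_sum_le _ _).trans (Finset.sum_le_sum fun j _ => ?_)
            rw [norm_mul, norm_mul, RCLike.norm_conj]
            have : ‖ε i‖ * ‖ε j‖ * ‖G i j‖ ≤1 * ‖G i j‖ := by
              gcongr; exact mul_le_one₀ (hε i) (norm_nonneg _) (hε j)
            refine this.trans ?_
            rw [one_mul]
            split_ifs with h
            · subst h; have :0 ≤ Z / (K:ℝ) ^2 := by positivity
              linarith
            · rw [zero_add]
              refine (hoff i j h).trans (le_of_eq ?_)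
              rw [hZ, hU]; push_cast; field_simp
        _ = ‖G i i‖ + Fintype.card ι * (Z / K ^2) := by
            rw [Finset.sum_add_distrib, Finset.sum_ite_eq]; simp
        _ ≤ ‖G i i‖ + K * (Z / K ^2) := by gcongr
        _ = _ := by field_simp
    calc _ ≤ ∑ i, (‖G i i‖ + Z / K) := (norm_sum_le _ _).trans (Finset.sum_le_sum fun i _ => hx i)
      _ = ∑ i, ‖G i i‖ + Fintype.card ι * (Z / K) := by rw [Finset.sum_add_distrib]; simp
      _ ≤ Z + K * (Z / K) := by gcongr
      _ =2 * Z := by field_simp; ring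
  have hfin : (∑ m ∈ I, √(1 / m) * (√m * ‖F m‖)) ^2 ≤ (2 * N * Real.log N ^2 * (1 + Real.log N)) ^2 := by
    refine hCS.trans ?_
    rw [e3]
    calc _ ≤ (1 + Real.log N) * (2 * Z) := by gcongr
      _ = _ := by rw [hZ]; ring
  exact hS.trans (abs_le_of_sq_le_sq' hfin (by positivity)).2
end

noncomputable def MU : ArithmeticFunction ℝ := (moebius : ArithmeticFunction ℝ)
noncomputable def ZE : ArithmeticFunction ℝ := (zeta : ArithmeticFunction ℝ)

noncomputable def tr1 (f : ArithmeticFunction ℝ) (U : ℕ) : ArithmeticFunction ℝ := ⟨fun n => if n ≤ U then f n else 0, by simp⟩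
noncomputable def tr2 (f : ArithmeticFunction ℝ) (U : ℕ) : ArithmeticFunction ℝ := ⟨fun n => if n ≤ U then 0 else f n, by simp⟩
theorem tr1_apply (f : ArithmeticFunction ℝ) (U n : ℕ) : tr1 f U n = if n ≤ U then f n else 0 := rfl
theorem tr2_apply (f : ArithmeticFunction ℝ) (U n : ℕ) : tr2 f U n = if n ≤ U then 0 else f n := rfl
theorem tr_add (f : ArithmeticFunction ℝ) (U : ℕ) : tr1 f U + tr2 f U = f := by
  ext n; rw [ArithmeticFunction.add_apply, tr1_apply, tr2_apply]; split_ifs <;> simp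

theorem vaughan_id (U : ℕ) : vonMangoldt = tr1 vonMangoldt U + tr1 MU U * ArithmeticFunction.log
    - tr1 MU U * tr1 vonMangoldt U * ZE + tr2 MU U * (tr2 vonMangoldt U * ZE) := by
  have h1 := tr_add vonMangoldt U
  have h2 := tr_add MU U
  set a := tr1 vonMangoldt U
  set b := tr2 vonMangoldt U
  set m := tr1 MU U
  set m' := tr2 MU U
  have h3 : MU * ZE =1 := coe_moebius_mul_coe_zeta
  have h4 : vonMangoldt * ZE = ArithmeticFunction.log := vonMangoldt_mul_zeta
  rw [← h4, ← h1]
  rw [← h2] at h3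
  linear_combination (-b) * h3

theorem cnt_bd (N U : ℕ) {x : ℝ} (hx :0 ≤ x) : ∑ n ∈ Icc 1 N, (if n ≤ U then x else 0) ≤ U * x := by
  rw [← Finset.sum_filter, Finset.sum_const, nsmul_eq_mul]
  gcongr
  refine (Finset.card_le_card (t := Icc 1 U) fun n hn => ?_).trans (by simp)
  simp only [mem_filter, mem_Icc] at *; omega

theorem tr2z (U l : ℕ) :0 ≤ (tr2 vonMangoldt U * ZE) l ∧ (tr2 vonMangoldt U * ZE) l ≤ Real.log l ∧ (l ≤ U → (tr2 vonMangoldt U * ZE) l =0) := by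
  rw [ZE, ArithmeticFunction.coe_mul_zeta_apply, ← vonMangoldt_sum]
  refine ⟨Finset.sum_nonneg fun d _ => ?_, Finset.sum_le_sum fun d _ => ?_, fun h => Finset.sum_eq_zero fun d hd => ?_⟩
  · rw [tr2_apply]; split_ifs; exacts [le_rfl, vonMangoldt_nonneg]
  · rw [tr2_apply]; split_ifs; exacts [vonMangoldt_nonneg, le_rfl]
  · rw [tr2_apply, if_pos ((Nat.divisor_le hd).trans h)]

section
variable {ι : Type} [Fintype ι] [DecidableEq ι]

theorem vaughan_ls (c : ι → ℕ → ℂ) (K N : ℕ) (hK :1 ≤ K) (hN : K ^8 ≤ N) (hN3 :3 ≤ N) (h1 : ∀ i n, ‖c i n‖ ≤1)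
    (hmul : ∀ i m n, c i (m * n) = c i m * c i n)
    (hs : ∀ i a b, ‖∑ n ∈ Ico a b, c i n‖ ≤ K)
    (hij : ∀ i j, i ≠ j → ∀ a b, ‖∑ n ∈ Ico a b, c i n * (starRingEnd ℂ) (c j n)‖ ≤ K) (hcard : Fintype.card ι ≤ K) :
    ∑ i, ‖∑ n ∈ Icc 1 N, (c i n * (vonMangoldt n : ℝ)) * (Real.log (N / n) : ℝ)‖ ≤8 * N * Real.log N ^3 := by
  have hL :1 ≤ Real.log N := by
    rw [Real.le_log_iff_exp_le (by positivity)]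
    have : (3:ℝ) ≤ N := by exact_mod_cast hN3
    linarith [Real.exp_one_lt_three]
  set L := Real.log N with hLd
  set U := K ^3 with hU
  have hK0 : (1:ℝ) ≤ K := by exact_mod_cast hK
  have hNK : (K:ℝ) ^8 ≤ N := by exact_mod_cast hN
  have hUN : U ≤ N := (Nat.pow_le_pow_right hK (by norm_num)).trans hN
  set F : ι → ℕ → ℂ := fun i n => c i n * (wt N n : ℂ) with hF
  have hF0 : ∀ i n, N < n → F i n =0 := fun i n h => by simp [hF, wt_zero h]
  have hLam : ∀ n ≤ N, |vonMangoldt n| ≤ L := fun n hn => by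
    rw [abs_of_nonneg vonMangoldt_nonneg]
    refine vonMangoldt_le_log.trans ?_
    rcases Nat.eq_zero_or_pos n with rfl | h
    · simp; linarith
    · exact Real.log_le_log (by exact_mod_cast h) (by exact_mod_cast hn)
  have hmu : ∀ n, |MU n| ≤1 := fun n => by
    have : |moebius n| ≤1 := abs_moebius_le_one
    simp only [MU, ArithmeticFunction.intCoe_apply]; exact_mod_cast this
  set T1 : ι → ℂ := fun i => ∑ n ∈ Icc 1 N, ((tr1 vonMangoldt U n : ℝ) : ℂ) * F i n
  set T2 : ι → ℂ := fun i => ∑ m ∈ Icc 1 N, ∑ l ∈ Icc 1 N, (tr1 MU U m : ℂ) * (ArithmeticFunction.log l : ℂ) * F i (m * l)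
  set T3 : ι → ℂ := fun i => ∑ m ∈ Icc 1 N, ∑ l ∈ Icc 1 N, ((tr1 MU U * tr1 vonMangoldt U) m : ℂ) * (ZE l : ℂ) * F i (m * l)
  set T4 : ι → ℂ := fun i => ∑ m ∈ Icc 1 N, ∑ l ∈ Icc 1 N, (tr2 MU U m : ℂ) * ((tr2 vonMangoldt U * ZE) l : ℂ) * F i (m * l)
  have hsplit : ∀ i, ∑ n ∈ Icc 1 N, (c i n * (vonMangoldt n : ℝ)) * (Real.log (N / n) : ℝ) = T1 i + T2 i - T3 i + T4 i := by
    intro i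
    have e0 : ∑ n ∈ Icc 1 N, (c i n * (vonMangoldt n : ℝ)) * (Real.log (N / n) : ℝ) = ∑ n ∈ Icc 1 N, ((vonMangoldt n : ℝ) : ℂ) * F i n := by
      refine Finset.sum_congr rfl fun n hn => ?_
      rw [mem_Icc] at hn
      simp only [hF]
      rw [wt_eq hn.1 hn.2]; ring
    rw [e0]
    simp only [T1, T2, T3, T4]
    rw [← conv_sum _ _ N _ (hF0 i), ← conv_sum _ _ N _ (hF0 i), ← conv_sum _ _ N _ (hF0 i), ← Finset.sum_add_distrib, ← Finset.sum_sub_distrib, ← Finset.sum_add_distrib]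
    refine Finset.sum_congr rfl fun n hn => ?_
    conv_lhs => rw [vaughan_id U]
    simp only [ArithmeticFunction.add_apply, sub_eq_add_neg, ArithmeticFunction.neg_apply]
    push_cast; ring
  have hL0 :0 ≤ L := by linarith
  have hw : ∀ n, ‖(wt N n : ℂ)‖ ≤ L := fun n => by
    rw [Complex.norm_real, Real.norm_of_nonneg (wt_nonneg _ _)]; exact wt_le _ _
  have b1 : ∀ i, ‖T1 i‖ ≤ U * (L * L) := by
    intro i
    refine (norm_sum_le _ _).trans (le_trans (Finset.sum_le_sum fun n hn => ?_) (cnt_bd N U (mul_nonneg hL0 hL0)))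
    rw [tr1_apply]
    split_ifs with h
    · rw [norm_mul, Complex.norm_real, Real.norm_eq_abs]
      refine mul_le_mul (hLam n (mem_Icc.1 hn).2) ?_ (norm_nonneg _) hL0
      simp only [hF, norm_mul]
      exact (mul_le_mul (h1 i n) (hw n) (norm_nonneg _) zero_le_one).trans_eq (one_mul _)
    · simp
  have b2 : ∀ i, ‖T2 i‖ ≤ U * (2 * K * L ^2) := by
    intro i
    refine (norm_sum_le _ _).trans (le_trans (Finset.sum_le_sum fun m hm => ?_) (cnt_bd N U (by positivity)))
    have e : ∑ l ∈ Icc 1 N, (tr1 MU U m : ℂ) * (ArithmeticFunction.log l : ℂ) * F i (m * l) = (tr1 MU U m : ℂ) * (c i m * ∑ l ∈ Icc 1 N, c i l * ((Real.log l * wt N (m * l) : ℝ) : ℂ)) := by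
      rw [Finset.mul_sum, Finset.mul_sum]
      refine Finset.sum_congr rfl fun l _ => ?_
      simp only [hF, hmul, log_apply]; push_cast; ring
    rw [e, tr1_apply]
    split_ifs with h
    · rw [norm_mul, norm_mul, Complex.norm_real, Real.norm_eq_abs]
      have := ti_two (hs i) N m (mem_Icc.1 hm).1
      calc _ ≤1 * (1 * (2 * K * L ^2)) := by
            gcongr
            · exact hmu m
            · exact h1 i m
        _ = _ := by ring
    · simp
  have b3 : ∀ i, ‖T3 i‖ ≤ U * (U * L) * (K * L) := by
    intro i
    set G : ℕ → ℂ := fun m => c i m * ∑ l ∈ Icc 1 N, c i l * (wt N (m * l) : ℂ) with hG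
    have hG0 : ∀ m, N < m → G m =0 := fun m hm => by
      simp only [hG]
      rw [Finset.sum_eq_zero, mul_zero]
      intro l hl
      have := (mem_Icc.1 hl).1
      rw [wt_zero (by nlinarith)]; simp
    have hG1 : ∀ m, 1 ≤ m → ‖G m‖ ≤ K * L := fun m hm => by
      simp only [hG, norm_mul]
      exact (mul_le_mul (h1 i m) (ti_one (hs i) N m hm) (norm_nonneg _) zero_le_one).trans_eq (one_mul _)
    have e : T3 i = ∑ m ∈ Icc 1 N, (((tr1 MU U * tr1 vonMangoldt U) m : ℝ) : ℂ) * G m := by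
      refine Finset.sum_congr rfl fun m _ => ?_
      simp only [hG]
      rw [Finset.mul_sum, Finset.mul_sum]
      refine Finset.sum_congr rfl fun l hl => ?_
      have hz : ZE l =1 := by
        have := (mem_Icc.1 hl).1
        rw [ZE, ArithmeticFunction.natCoe_apply, zeta_apply, if_neg (by omega)]; simp
      simp only [hF, hmul, hz]; push_cast; ring
    rw [e, conv_sum _ _ N G hG0]
    have : (U : ℝ) * (U * L) * (K * L) = U * (U * (L * (K * L))) := by ring
    rw [this]
    refine (norm_sum_le _ _).trans (le_trans (Finset.sum_le_sum fun m hm => ?_) (cnt_bd N U (by positivity)))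
    refine (norm_sum_le _ _).trans ?_
    simp_rw [norm_mul, Complex.norm_real, Real.norm_eq_abs, tr1_apply]
    split_ifs with h
    · refine (le_trans (Finset.sum_le_sum fun l hl => ?_) (cnt_bd N U (by positivity)))
      split_ifs with h'
      · have q1 := hLam l (mem_Icc.1 hl).2
        have q2 := hmu m
        have q3 := hG1 (m * l) (Nat.mul_pos (mem_Icc.1 hm).1 (mem_Icc.1 hl).1)
        calc _ ≤1 * L * (K * L) := by gcongr
          _ = _ := by ring
      · simp
    · simp
  have b4 : ∑ i, ‖T4 i‖ ≤2 * N * L ^2 * (1 + L) := by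
    set ε : ι → ℂ := fun i => (starRingEnd ℂ) (T4 i) / (‖T4 i‖ : ℂ) with hε
    have hε1 : ∀ i, ‖ε i‖ ≤1 := fun i => by
      simp only [hε, norm_div, RCLike.norm_conj, Complex.norm_real, norm_norm]; exact div_self_le_one _
    have hε2 : ∀ i, ε i * T4 i = (‖T4 i‖ : ℂ) := fun i => by
      simp only [hε]
      by_cases h : T4 i =0
      · simp [h]
      · have : (‖T4 i‖ : ℂ) ≠0 := by simpa using h
        rw [div_mul_eq_mul_div, div_eq_iff this, mul_comm, Complex.mul_conj']; ring
    have hT : ∀ i, T4 i = ∑ m ∈ Ico (K ^3 +1) (N +1), ∑ l ∈ Ico (K ^3 +1) (N +1), (tr2 MU U m : ℂ) * ((tr2 vonMangoldt U * ZE) l : ℂ) * (c i m * c i l * (wt N (m * l) : ℂ)) := by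
      intro i
      have hsub : Ico (K ^3 +1) (N +1) ⊆ Icc 1 N := fun x hx => by simp only [mem_Ico, mem_Icc] at *; omega
      have hnot : ∀ x ∈ Icc 1 N, x ∉ Ico (K ^3 +1) (N +1) → x ≤ U := fun x hx hx' => by
        rw [hU]; simp only [mem_Ico, mem_Icc] at *; omega
      simp only [T4]
      rw [← Finset.sum_subset hsub]
      · refine Finset.sum_congr rfl fun m _ => ?_
        rw [← Finset.sum_subset hsub]
        · refine Finset.sum_congr rfl fun l _ => ?_
          simp only [hF, hmul]
        · intro l hl hl'
          rw [(tr2z U l).2.2 (hnot l hl hl')]; simp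
      · intro m hm hm'
        refine Finset.sum_eq_zero fun l _ => ?_
        rw [tr2_apply, if_pos (hnot m hm hm')]; simp
    have := tii c K N hK h1 hij hcard (fun l => (tr2 vonMangoldt U * ZE) l) (fun m => tr2 MU U m) (fun l hl => by
      have := tr2z U l
      rw [abs_of_nonneg this.1]
      refine this.2.1.trans ?_
      rcases Nat.eq_zero_or_pos l with rfl | h
      · simpa using hL0
      · exact Real.log_le_log (by exact_mod_cast h) (by exact_mod_cast hl)) (fun m => by
      simp only [tr2_apply]; split_ifs
      · simp
      · exact hmu m) ε hε1
    simp_rw [← hT, hε2] at this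
    refine le_trans (le_of_eq ?_) this
    rw [← Complex.ofReal_sum, Complex.norm_real, Real.norm_of_nonneg (Finset.sum_nonneg fun _ _ => norm_nonneg _)]
  have hcK : (Fintype.card ι : ℝ) ≤ K := by exact_mod_cast hcard
  have hUr : (U:ℝ) = (K:ℝ) ^3 := by rw [hU]; push_cast; ring
  calc _ ≤ ∑ i, (U * (L * L) + U * (2 * K * L ^2) + U * (U * L) * (K * L) + ‖T4 i‖) := by
        refine Finset.sum_le_sum fun i _ => ?_
        rw [hsplit i]
        refine (norm_add_le _ _).trans (add_le_add_left ((norm_sub_le _ _).trans (add_le_add ((norm_add_le _ _).trans (add_le_add (b1 i) (b2 i))) (b3 i))) _)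
    _ = Fintype.card ι * (U * (L * L) + U * (2 * K * L ^2) + U * (U * L) * (K * L)) + ∑ i, ‖T4 i‖ := by
        rw [Finset.sum_add_distrib]; simp; ring
    _ ≤ K * (U * (L * L) + U * (2 * K * L ^2) + U * (U * L) * (K * L)) +2 * N * L ^2 * (1 + L) := by gcongr
    _ = (K ^4 +2 * K ^5 + K ^8) * L ^2 +2 * N * L ^2 * (1 + L) := by rw [hUr]; ring
    _ ≤ (N +2 * N + N) * L ^2 +2 * N * L ^2 * (1 + L) := by
        have g1 : (K:ℝ) ^4 ≤ N := (pow_le_pow_right₀ hK0 (by norm_num)).trans hNK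
        have g2 : (K:ℝ) ^5 ≤ N := (pow_le_pow_right₀ hK0 (by norm_num)).trans hNK
        gcongr
    _ ≤ _ := by
        have : (N:ℝ) * L ^2 ≤ N * L ^3 := by
          gcongr; norm_num
        nlinarith
end

end
section
open Finset DirichletCharacter
theorem lam_le {n N : ℕ} (h1 :1 ≤ n) (h : n ≤ N) : ArithmeticFunction.vonMangoldt n * log (N / n) ≤ log N ^2 ∧
    0 ≤ ArithmeticFunction.vonMangoldt n * log (N / n) := by
  have a := wt_eq h1 h
  rw [← a]
  have h2 := wt_le N n
  have h3 := wt_nonneg N n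
  have h4 : ArithmeticFunction.vonMangoldt n ≤ log N := ArithmeticFunction.vonMangoldt_le_log.trans
    (Real.log_le_log (by exact_mod_cast h1) (by exact_mod_cast h))
  have h5 :0 ≤ ArithmeticFunction.vonMangoldt n := ArithmeticFunction.vonMangoldt_nonneg
  exact ⟨by nlinarith, by positivity⟩

theorem logN_one {N : ℕ} (hN :3 ≤ N) :1 ≤ log N := by
  rw [Real.le_log_iff_exp_le (by positivity)]
  have : (3:ℝ) ≤ N := by exact_mod_cast hN
  linarith [Real.exp_one_lt_d9]

theorem natlog_le {N : ℕ} (hN :3 ≤ N) : ((Nat.log 2 N +1 : ℕ) : ℝ) ≤3 * log N := by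
  have h1 := logN_one hN
  have h2 : (Nat.log 2 N : ℝ) * log 2 ≤ log N := by
    rw [← Real.log_pow]
    refine Real.log_le_log (by positivity) ?_
    exact_mod_cast Nat.pow_log_le_self 2 (by omega : N ≠0)
  have := Real.log_two_gt_d9
  push_cast
  nlinarith

theorem pp_bd (T : Finset ℕ) {N : ℕ} (hN :3 ≤ N) :
    ∑ n ∈ (Icc 1 N).filter (fun n => ∃ p ∈ T, p.Prime ∧ p ∣ n), ArithmeticFunction.vonMangoldt n * log (N / n)
      ≤ T.card * (3 * log N ^3) := by
  classical
  set G := ((Icc 1 N).filter (fun n => ∃ p ∈ T, p.Prime ∧ p ∣ n)).filter (fun n => ArithmeticFunction.vonMangoldt n ≠0) with hG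
  have e : ∑ n ∈ (Icc 1 N).filter (fun n => ∃ p ∈ T, p.Prime ∧ p ∣ n), ArithmeticFunction.vonMangoldt n * log (N / n)
      = ∑ n ∈ G, ArithmeticFunction.vonMangoldt n * log (N / n) := by
    refine (sum_filter_of_ne fun n _ h h0 => ?_).symm
    rw [h0, zero_mul] at h; exact h rfl
  have hsub : G ⊆ (T ×ˢ range (Nat.log 2 N +1)).image (fun x => x.1 ^ x.2) := by
    intro n hn
    simp only [hG, mem_filter, mem_Icc, ArithmeticFunction.vonMangoldt_ne_zero_iff] at hn
    obtain ⟨⟨⟨h1, h2⟩, p, hp, hpp, hd⟩, hpow⟩ := hn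
    rw [isPrimePow_nat_iff] at hpow
    obtain ⟨q, j, hq, hj, rfl⟩ := hpow
    have : p = q := (Nat.prime_dvd_prime_iff_eq hpp hq).1 (hpp.dvd_of_dvd_pow hd)
    subst this
    simp only [mem_image, mem_product, mem_range, Prod.exists]
    refine ⟨p, j, ⟨hp, ?_⟩, rfl⟩
    exact Nat.lt_succ_of_le (Nat.le_log_of_pow_le (by norm_num) ((Nat.pow_le_pow_left hq.two_le j).trans h2))
  have hc : (G.card : ℝ) ≤ T.card * (3 * log N) := by
    have := (card_le_card hsub).trans card_image_le
    rw [card_product, card_range] at this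
    calc (G.card : ℝ) ≤ ((T.card * (Nat.log 2 N +1) : ℕ) : ℝ) := by exact_mod_cast this
      _ ≤ _ := by rw [Nat.cast_mul]; gcongr; exact natlog_le hN
  rw [e]
  calc _ ≤ ∑ n ∈ G, log N ^2 := sum_le_sum fun n hn => by
        simp only [hG, mem_filter, mem_Icc] at hn
        exact (lam_le hn.1.1.1 hn.1.1.2).1
    _ = G.card * log N ^2 := by simp
    _ ≤ T.card * (3 * log N) * log N ^2 := by gcongr
    _ = _ := by ring

noncomputable def Eqn (q N : ℕ) : ℝ := ∑ n ∈ (Icc 1 N).filter (fun n => ¬ n.Coprime q), ArithmeticFunction.vonMangoldt n * log (N / n)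

theorem Eqn_bd {q N : ℕ} (hN :3 ≤ N) (hq :1 ≤ q) (hqN : q ≤ N) : Eqn q N ≤9 * log N ^4 := by
  have h1 := logN_one hN
  have h : Eqn q N ≤ q.primeFactors.card * (3 * log N ^3) := by
    refine le_trans (le_of_eq ?_) (pp_bd q.primeFactors hN)
    unfold Eqn
    congr 1
    ext n
    simp only [mem_filter, and_congr_right_iff, Nat.Prime.not_coprime_iff_dvd]
    intro _
    constructor
    · rintro ⟨p, hp, h1, h2⟩
      exact ⟨p, by simp [hp, h2]; omega, hp, h1⟩
    · rintro ⟨p, hp, h1, h2⟩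
      exact ⟨p, h1, h2, Nat.dvd_of_mem_primeFactors hp⟩
  have hc : (q.primeFactors.card : ℝ) ≤3 * log N := by
    refine le_trans ?_ (natlog_le hN)
    have :2 ^ q.primeFactors.card ≤ N := by
      calc 2 ^ q.primeFactors.card ≤ ∏ p ∈ q.primeFactors, p := by
            rw [← prod_const]
            exact prod_le_prod' fun p hp => (Nat.prime_of_mem_primeFactors hp).two_le
        _ ≤ q := Nat.le_of_dvd hq (Nat.prod_primeFactors_dvd q)
        _ ≤ N := hqN
    exact_mod_cast (Nat.le_log_of_pow_le (by norm_num) this).trans (Nat.le_succ _)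
  calc _ ≤ _ := h
    _ ≤ (3 * log N) * (3 * log N ^3) := by gcongr
    _ = _ := by ring

noncomputable def MN (N : ℕ) : ℝ := ∑ n ∈ Icc 1 N, ArithmeticFunction.vonMangoldt n * log (N / n)

open Classical in
noncomputable def Sp (D N : ℕ) : ℝ := ∑ χ ∈ (univ : Finset (DirichletCharacter ℂ D)).filter (fun χ => χ.IsPrimitive), ‖Psi χ N‖

theorem Sp_nonneg (D N : ℕ) :0 ≤ Sp D N := sum_nonneg fun _ _ => norm_nonneg _

theorem cl_psi {D q : ℕ} [NeZero q] (h : D ∣ q) (χ : DirichletCharacter ℂ D) (N : ℕ) :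
    ‖Psi (changeLevel h χ) N - Psi χ N‖ ≤ Eqn q N := by
  unfold Psi Eqn
  rw [← sum_sub_distrib, sum_filter]
  refine (norm_sum_le _ _).trans (sum_le_sum fun n hn => ?_)
  rw [mem_Icc] at hn
  rw [cl_apply]
  split_ifs with h1
  · simp
  · rw [zero_mul, zero_mul, zero_sub, norm_neg, mul_assoc, norm_mul, ← Complex.ofReal_mul, Complex.norm_real,
      Real.norm_of_nonneg (lam_le hn.1 hn.2).2]
    exact mul_le_of_le_one_left (lam_le hn.1 hn.2).2 (χ.norm_le_one _)

theorem cond_sum {q D N : ℕ} [NeZero q] (h : D ∣ q) :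
    ∑ χ ∈ (univ : Finset (DirichletCharacter ℂ q)).filter (fun χ => χ.conductor = D), (‖Psi χ N‖ - Eqn q N) ≤ Sp D N := by
  classical
  have hs : (univ : Finset (DirichletCharacter ℂ q)).filter (fun χ => χ.conductor = D) =
      ((univ : Finset (DirichletCharacter ℂ D)).filter (fun χ => χ.IsPrimitive)).image (changeLevel h) := by
    ext χ
    simp only [mem_filter, mem_univ, true_and, mem_image]
    constructor
    · intro hc
      subst hc
      exact ⟨χ.primitiveCharacter, primitiveCharacter_isPrimitive χ, changeLevel_primitiveCharacter χ⟩
    · rintro ⟨ψ, hψ, rfl⟩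
      rw [conductor_changeLevel]; exact hψ
  rw [hs, sum_image fun a _ b _ hab => changeLevel_injective h hab]
  unfold Sp
  refine le_of_le_of_eq (sum_le_sum (g := fun χ => ‖Psi χ N‖) fun ψ _ => ?_) (by congr)
  have := cl_psi h ψ N
  have h2 := norm_sub_norm_le (Psi (changeLevel h ψ) N) (Psi ψ N)
  linarith

theorem ap_thm {q N : ℕ} (hN :3 ≤ N) (hq :1 ≤ q) (hqN : q ≤ N) {a : ℕ} (ha : a.Coprime q) :
    |∑ n ∈ (Icc 1 N).filter (fun n => n ≡ a [MOD q]), ArithmeticFunction.vonMangoldt n * log (N / n) - MN N / q.totient|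
      ≤ (∑ D ∈ q.divisors.erase 1, Sp D N) / q.totient +9 * log N ^4 := by
  classical
  have : NeZero q := ⟨by omega⟩
  have hφ : (0:ℝ) < q.totient := by exact_mod_cast Nat.totient_pos.2 hq
  have hE := Eqn_bd hN hq hqN
  set S := ∑ n ∈ (Icc 1 N).filter (fun n => n ≡ a [MOD q]), ArithmeticFunction.vonMangoldt n * log (N / n) with hS
  have ha' : IsUnit (a : ZMod q) := (ZMod.isUnit_iff_coprime a q).2 ha
  have e1 : (q.totient : ℂ) * (S : ℂ) = ∑ χ : DirichletCharacter ℂ q, χ (a : ZMod q)⁻¹ * Psi χ N := by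
    simp only [Psi, mul_sum]
    rw [sum_comm, hS, sum_filter]
    push_cast
    rw [mul_sum]
    refine sum_congr rfl fun n _ => ?_
    have := sum_char_inv_mul_char_eq ℂ ha' (n : ZMod q)
    calc _ = (if (a : ZMod q) = n then (q.totient : ℂ) else 0) * ((ArithmeticFunction.vonMangoldt n : ℝ) * (log (N / n) : ℝ)) := by
          simp only [ZMod.natCast_eq_natCast_iff, Nat.ModEq.comm (a := a)]
          split_ifs <;> push_cast <;> simp
      _ = _ := by
          rw [← this, sum_mul]
          exact sum_congr rfl fun χ _ => by ring
  have hM : Psi (1 : DirichletCharacter ℂ 1) N = MN N := by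
    unfold Psi MN
    push_cast
    refine sum_congr rfl fun n _ => ?_
    rw [MulChar.one_apply (isUnit_of_subsingleton _), one_mul]
  have h1 := cl_psi (one_dvd q) (1 : DirichletCharacter ℂ 1) N
  rw [changeLevel_one, hM] at h1
  rw [← add_sum_erase _ _ (mem_univ (1 : DirichletCharacter ℂ q)), MulChar.one_apply (by
    rw [show (a : ZMod q)⁻¹ = ((ha'.unit⁻¹ : (ZMod q)ˣ) : ZMod q) from by
      rw [← ZMod.inv_coe_unit]; rfl]
    exact Units.isUnit _), one_mul] at e1
  have hrest : ∑ χ ∈ univ.erase (1 : DirichletCharacter ℂ q), (‖Psi χ N‖ - Eqn q N) ≤ ∑ D ∈ q.divisors.erase 1, Sp D N := by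
    rw [← sum_fiberwise_of_maps_to (s := univ.erase (1 : DirichletCharacter ℂ q)) (t := q.divisors.erase 1) (g := fun χ => χ.conductor)]
    · refine sum_le_sum fun D hD => ?_
      rw [mem_erase, Nat.mem_divisors] at hD
      refine le_of_eq_of_le ?_ (cond_sum hD.2.1)
      congr 1
      ext χ
      simp only [mem_filter, mem_erase, mem_univ, and_true, true_and, and_iff_right_iff_imp]
      rintro hc rfl
      rw [conductor_one] at hc
      exact hD.1 hc.symm
    · intro χ hχ
      rw [mem_erase] at hχ ⊢
      refine ⟨fun h => hχ.1 ?_, Nat.mem_divisors.2 ⟨conductor_dvd_level χ, NeZero.ne q⟩⟩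
      exact (eq_one_iff_conductor_eq_one).2 h
  have hcard : ((univ.erase (1 : DirichletCharacter ℂ q)).card : ℝ) +1 = q.totient := by
    have h3 := card_erase_add_one (mem_univ (1 : DirichletCharacter ℂ q))
    have h4 := card_eq_totient_of_hasEnoughRootsOfUnity ℂ q
    rw [Nat.card_eq_fintype_card, ← card_univ] at h4
    exact_mod_cast h3.trans h4
  have hn : ‖(q.totient : ℂ) * (S : ℂ) - MN N‖ ≤ ∑ D ∈ q.divisors.erase 1, Sp D N + q.totient * Eqn q N := by
    rw [e1]
    have h5 : ‖∑ χ ∈ univ.erase (1 : DirichletCharacter ℂ q), χ (a : ZMod q)⁻¹ * Psi χ N‖ ≤ ∑ χ ∈ univ.erase (1 : DirichletCharacter ℂ q), ‖Psi χ N‖ :=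
      (norm_sum_le _ _).trans (sum_le_sum fun χ _ => by
        rw [norm_mul]; exact mul_le_of_le_one_left (norm_nonneg _) (χ.norm_le_one _))
    rw [sum_sub_distrib, sum_const, nsmul_eq_mul] at hrest
    have h6 := norm_add_le (Psi (1 : DirichletCharacter ℂ q) N - MN N) (∑ χ ∈ univ.erase (1 : DirichletCharacter ℂ q), χ (a : ZMod q)⁻¹ * Psi χ N)
    rw [sub_add_eq_add_sub] at h6
    refine h6.trans ?_
    rw [← hcard]
    linarith
  have e2 : (q.totient : ℂ) * (S : ℂ) - MN N = ((q.totient * (S - MN N / q.totient) : ℝ) : ℂ) := by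
    have : (q.totient : ℂ) ≠0 := by exact_mod_cast hφ.ne'
    push_cast; field_simp
  rw [e2, Complex.norm_real, norm_mul, Real.norm_of_nonneg hφ.le, Real.norm_eq_abs] at hn
  rw [← mul_le_mul_iff_right₀ hφ]
  refine hn.trans ?_
  rw [mul_add, mul_div_cancel₀ _ hφ.ne']
  gcongr

theorem Sp_ls {Q N : ℕ} (hQ :1 ≤ Q) (h : Q ^16 ≤ N) (hN3 :3 ≤ N) : ∑ D ∈ Icc 2 Q, Sp D N ≤8 * N * log N ^3 := by
  classical
  let ι := Σ D : {D // D ∈ Icc 2 Q}, {χ : DirichletCharacter ℂ D.1 // χ.IsPrimitive}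
  have hD2 : ∀ D : {D // D ∈ Icc 2 Q}, 2 ≤ D.1 ∧ D.1 ≤ Q := fun D => mem_Icc.1 D.2
  have hnz : ∀ D : {D // D ∈ Icc 2 Q}, NeZero D.1 := fun D => ⟨by have := hD2 D; omega⟩
  have hne : ∀ i : ι, i.2.1 ≠1 := fun i h1 => by
    have := hnz i.1
    have h2 := i.2.2
    rw [h1, isPrimitive_def, conductor_one] at h2
    have := hD2 i.1
    omega
  have hcs : ∀ (D : ℕ) [NeZero D] (χ : DirichletCharacter ℂ D), χ ≠1 → ∀ a b : ℕ, ‖∑ n ∈ Ico a b, χ (n : ℕ)‖ ≤ D := by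
    intro D _ χ hχ a b
    have := per_sum (fun x => χ x) (MulChar.sum_eq_zero_of_ne_one hχ) 1 (fun x => χ.norm_le_one x) a b
    simpa using this
  have main := vaughan_ls (ι := ι) (fun i n => i.2.1 n) (Q ^2) N (Nat.one_le_pow _ _ hQ) (by rw [← pow_mul]; exact h) hN3
    (fun i n => i.2.1.norm_le_one _) (fun i m n => by push_cast; exact map_mul _ _ _) ?_ ?_ ?_
  · refine le_trans (le_of_eq ?_) main
    rw [Fintype.sum_sigma, ← sum_coe_sort]
    refine sum_congr rfl fun D _ => ?_
    unfold Sp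
    rw [← sum_subtype_of_mem (p := fun χ : DirichletCharacter ℂ D.1 => χ.IsPrimitive) (s := univ.filter (fun χ : DirichletCharacter ℂ D.1 => χ.IsPrimitive)) (fun χ => ‖Psi χ N‖) (by simp)]
    refine sum_congr ?_ fun _ _ => rfl
    ext x; simp [x.2]
  · intro i a b
    have := hnz i.1
    refine (hcs _ i.2.1 (hne i) a b).trans ?_
    have := (hD2 i.1).2
    exact_mod_cast this.trans (Nat.le_self_pow (by norm_num) Q)
  · intro i j hij a b
    have h1 := hnz i.1
    have h2 := hnz j.1
    have : NeZero (i.1.1 * j.1.1) := ⟨mul_ne_zero h1.ne h2.ne⟩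
    have hp : prodc i.2.1 j.2.1⁻¹ ≠1 := by
      intro h
      apply hij
      obtain ⟨⟨D, hD⟩, χ, hχ⟩ := i
      obtain ⟨⟨D', hD'⟩, ψ, hψ⟩ := j
      dsimp only at *
      have e : changeLevel (dvd_mul_right D D') χ = changeLevel (dvd_mul_left D' D) ψ := by
        rw [prodc, map_inv, mul_inv_eq_one] at h; exact h
      have hc : D = D' := by
        have h1 := congrArg conductor e
        rw [conductor_changeLevel, conductor_changeLevel] at h1
        exact (hχ.symm.trans h1).trans hψ
      subst hc
      have := changeLevel_injective _ e
      subst this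
      rfl
    have h3 := hcs _ (prodc i.2.1 j.2.1⁻¹) hp a b
    simp only [prodc_apply] at h3
    have h4 : ∀ n : ℕ, j.2.1⁻¹ (n : ZMod j.1.1) = (starRingEnd ℂ) (j.2.1 n) := fun n => (MulChar.star_apply' _ _).symm
    simp only [h4] at h3
    refine h3.trans ?_
    have a1 := (hD2 i.1).2
    have a2 := (hD2 j.1).2
    rw [sq]
    exact_mod_cast Nat.mul_le_mul a1 a2
  · rw [Fintype.card_sigma]
    calc _ ≤ ∑ D : {D // D ∈ Icc 2 Q}, Q := sum_le_sum fun D _ => by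
          have := hnz D
          refine (Fintype.card_subtype_le _).trans ?_
          rw [← Nat.card_eq_fintype_card, card_eq_totient_of_hasEnoughRootsOfUnity]
          exact (Nat.totient_le _).trans (hD2 D).2
      _ ≤ Q ^2 := by
          rw [sum_const, card_univ, Fintype.card_coe, Nat.card_Icc, smul_eq_mul, sq]
          exact Nat.mul_le_mul_right _ (by omega)

theorem Sp_small (A B : ℕ) : ∃ L0 : ℝ, ∀ N Q : ℕ, L0 ≤ log N → (Q : ℝ) ≤ log N ^ A → GoodQ Q →
    ∀ D : ℕ, 2 ≤ D → D ≤ Q → Sp D N ≤ D * (N / log N ^ B) := by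
  classical
  obtain ⟨L0, h⟩ := sw A B
  refine ⟨max L0 1, fun N Q hN hQ hg D hD2 hD => ?_⟩
  have : NeZero D := ⟨by omega⟩
  have hL :1 ≤ log N := (le_max_right _ _).trans hN
  unfold Sp
  refine (sum_le_card_nsmul _ _ (N / log N ^ B) fun χ hχ => ?_).trans ?_
  · have hp := (mem_filter.1 hχ).2
    refine h N Q ((le_max_left _ _).trans hN) hQ hg D χ hD (fun h1 => ?_) hp
    rw [h1, isPrimitive_def, conductor_one] at hp
    omega
  · rw [nsmul_eq_mul]
    gcongr
    refine (card_filter_le _ _).trans ?_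
    rw [card_univ, ← Nat.card_eq_fintype_card, card_eq_totient_of_hasEnoughRootsOfUnity]
    exact Nat.totient_le _

end
section
open Finset
theorem tensor {O : Type} [Fintype O] (n : ℕ) (P P' : Fin n → O → ℝ) (A A' : Fin n → O → O → ℝ)
    (hP : ∀ i x, 0 ≤ P i x) (hP' : ∀ i x, 0 ≤ P' i x)
    (h : ∀ i (v : O → ℝ), ∑ x, P i x * (∑ c, A i x c * v c) ^2 ≤ ∑ x, P' i x * (∑ c, A' i x c * v c) ^2)
    (v : (Fin n → O) → ℝ) :
    ∑ x : Fin n → O, (∏ i, P i (x i)) * (∑ c : Fin n → O, (∏ i, A i (x i) (c i)) * v c) ^2 ≤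
    ∑ x : Fin n → O, (∏ i, P' i (x i)) * (∑ c : Fin n → O, (∏ i, A' i (x i) (c i)) * v c) ^2 := by
  induction n with
  | zero => simp
  | succ n ih =>
    have e : ∀ F : (Fin (n +1) → O) → ℝ, ∑ x, F x = ∑ a : O, ∑ y : Fin n → O, F (Fin.cons a y) := fun F => by
      rw [← Fintype.sum_prod_type']
      exact (Fintype.sum_equiv (Fin.consEquiv (fun _ => O)) _ _ (fun x => rfl)).symm
    have e2 : ∀ (P : Fin (n +1) → O → ℝ) (A : Fin (n +1) → O → O → ℝ),
        ∑ x : Fin (n +1) → O, (∏ i, P i (x i)) * (∑ c : Fin (n +1) → O, (∏ i, A i (x i) (c i)) * v c) ^2 =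
        ∑ a : O, ∑ y : Fin n → O, P 0 a * (∏ i, P i.succ (y i)) *
          (∑ b : O, ∑ c : Fin n → O, A 0 a b * ((∏ i, A i.succ (y i) (c i)) * v (Fin.cons b c))) ^2 := by
      intro P A
      rw [e]
      refine sum_congr rfl fun a _ => sum_congr rfl fun y _ => ?_
      rw [e]
      simp only [Fin.prod_univ_succ, Fin.cons_zero, Fin.cons_succ, mul_assoc]
    rw [e2, e2]
    calc _ = ∑ a : O, P 0 a * ∑ y : Fin n → O, (∏ i, P i.succ (y i)) *
          (∑ c : Fin n → O, (∏ i, A i.succ (y i) (c i)) * (∑ b : O, A 0 a b * v (Fin.cons b c))) ^2 := by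
          refine sum_congr rfl fun a _ => ?_
          rw [mul_sum]
          refine sum_congr rfl fun y _ => ?_
          rw [mul_assoc, sum_comm]
          simp only [mul_sum]
          congr 3
          refine sum_congr rfl fun _ _ => sum_congr rfl fun _ _ => by ring
      _ ≤ ∑ a : O, P 0 a * ∑ y : Fin n → O, (∏ i, P' i.succ (y i)) *
          (∑ c : Fin n → O, (∏ i, A' i.succ (y i) (c i)) * (∑ b : O, A 0 a b * v (Fin.cons b c))) ^2 := by
          refine sum_le_sum fun a _ => mul_le_mul_of_nonneg_left ?_ (hP _ _)
          exact ih (fun i => P i.succ) (fun i => P' i.succ) (fun i => A i.succ) (fun i => A' i.succ) (fun i => hP _)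
            (fun i => hP' _) (fun i => h _) _
      _ = ∑ y : Fin n → O, (∏ i, P' i.succ (y i)) * ∑ a : O, P 0 a * (∑ b : O, A 0 a b *
            (∑ c : Fin n → O, (∏ i, A' i.succ (y i) (c i)) * v (Fin.cons b c))) ^2 := by
          simp only [mul_sum]
          rw [sum_comm]
          refine sum_congr rfl fun y _ => sum_congr rfl fun a _ => ?_
          rw [sum_comm, mul_left_comm]
          congr 3
          refine sum_congr rfl fun _ _ => sum_congr rfl fun _ _ => by ring
      _ ≤ ∑ y : Fin n → O, (∏ i, P' i.succ (y i)) * ∑ a : O, P' 0 a * (∑ b : O, A' 0 a b *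
            (∑ c : Fin n → O, (∏ i, A' i.succ (y i) (c i)) * v (Fin.cons b c))) ^2 := by
          refine sum_le_sum fun y _ => mul_le_mul_of_nonneg_left (h 0 _) (prod_nonneg fun i _ => hP' _ _)
      _ = _ := by
          simp only [mul_sum]
          rw [sum_comm]
          refine sum_congr rfl fun a _ => sum_congr rfl fun y _ => ?_
          ring

section
variable {k : ℕ}

noncomputable def xi (p : ℝ) (x : Option (Fin k)) : Option (Fin k) → ℝ
  | none => 1
  | some i => (if x = some i then 1 else 0) -1 / p
noncomputable def P1 (p : ℝ) : Option (Fin k) → ℝ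
  | none => 1 - k / p
  | some _ => 1 / p
noncomputable def P2 (m : Fin k) (p : ℝ) : Option (Fin k) → ℝ
  | none => 1 - (k -1) / (p -1)
  | some i => if i = m then 0 else 1 / (p -1)
noncomputable def P3 (m : Fin k) (p : ℝ) : Option (Fin k) → ℝ
  | none => 1 -1 / p ^2
  | some i => if i = m then 0 else 1 / p * (1 -2 * k / p)
noncomputable def A3 (m : Fin k) (p : ℝ) : Option (Fin k) → Option (Fin k) → ℝ
  | none, none => 1
  | none, some i => if i = m then - (1 / p) else 0
  | some i, c => if c = some i then 1 else 0
noncomputable def w0 (p : ℝ) : Option (Fin k) → ℝ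
  | none => 1
  | some _ => 1 / p
noncomputable def one (d x : Option (Fin k)) : ℝ := if d = none ∨ x = d then 1 else 0
noncomputable def Bm (p : ℝ) : Option (Fin k) → Option (Fin k) → ℝ
  | none, none => 1
  | none, some _ => 0
  | some _, none => - (1 / p)
  | some i, some j => if i = j then 1 else 0
noncomputable def kap (a b : Option (Fin k)) : ℝ := if a = none ∨ b = none ∨ a = b then 1 else 0

theorem xi_sum (p : ℝ) (v : Option (Fin k) → ℝ) (x : Option (Fin k)) :
    ∑ c, xi p x c * v c = v none - (∑ i, v (some i)) / p + (if x = none then 0 else v x) := by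
  rw [Fintype.sum_option]
  simp only [xi, one_mul, sub_mul, sum_sub_distrib, ite_mul, zero_mul]
  have : ∑ i : Fin k, 1 / p * v (some i) = (∑ i, v (some i)) / p := by rw [← mul_sum]; ring
  rw [this]
  cases x with
  | none => simp; ring
  | some j => simp; ring

theorem cs_k (S : Finset (Fin k)) (v : Fin k → ℝ) : (∑ i ∈ S, v i) ^2 ≤ S.card * ∑ i ∈ S, v i ^2 := sq_sum_le_card_mul_sum_sq

theorem form_up (p : ℝ) (hp :0 < p) (v : Option (Fin k) → ℝ) :
    ∑ x, P1 p x * (∑ c, xi p x c * v c) ^2 ≤ ∑ x, w0 p x * (∑ c, (if x = c then 1 else 0) * v c) ^2 := by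
  simp only [xi_sum]
  simp only [ite_mul, one_mul, zero_mul, sum_ite_eq, mem_univ, if_true]
  rw [Fintype.sum_option, Fintype.sum_option]
  simp only [P1, w0, if_true, reduceCtorEq, if_false, one_mul, add_zero]
  set s := ∑ i, v (some i) with hs
  have e : ∑ i : Fin k, 1 / p * (v none - s / p + v (some i)) ^2 =
      (k * (v none - s / p) ^2 +2 * (v none - s / p) * s + ∑ i, v (some i) ^2) / p := by
    rw [hs]
    simp only [add_sq, mul_add, sum_add_distrib, ← mul_sum, sum_const, card_univ, Fintype.card_fin, nsmul_eq_mul]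
    ring
  rw [e, ← mul_sum]
  have :0 ≤ s ^2 / p ^2 := by positivity
  have e2 : (1 - k / p) * (v none - s / p) ^2 + (k * (v none - s / p) ^2 +2 * (v none - s / p) * s + ∑ i, v (some i) ^2) / p
      = v none ^2 +1 / p * ∑ i, v (some i) ^2 - s ^2 / p ^2 := by field_simp; ring
  linarith

theorem form_low (m : Fin k) (p : ℝ) (hp :2 * k ≤ p) (hp2 :3 ≤ p) (v : Option (Fin k) → ℝ) :
    ∑ x, P3 m p x * (∑ c, A3 m p x c * v c) ^2 ≤ ∑ x, P2 m p x * (∑ c, xi p x c * v c) ^2 := by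
  simp only [xi_sum]
  rw [Fintype.sum_option (fun x => P3 m p x * _), Fintype.sum_option (fun x => P2 m p x * _)]
  have hsplit : ∀ f : Fin k → ℝ, ∑ i, f i = f m + ∑ i ∈ univ.erase m, f i := fun f => (add_sum_erase _ _ (mem_univ m)).symm
  have h1 : ∑ c, A3 m p none c * v c = v none - v (some m) / p := by
    rw [Fintype.sum_option]; simp [A3]; ring
  have h2 : ∀ i, ∑ c, A3 m p (some i) c * v c = v (some i) := fun i => by simp [A3]
  simp only [h1, h2, P2, P3, if_true, reduceCtorEq, if_false, add_zero]
  rw [hsplit (fun i => v (some i)), hsplit (fun i => (if i = m then 0 else 1 / p * (1 -2 * k / p)) * _),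
    hsplit (fun i => (if i = m then 0 else 1 / (p -1)) * _)]
  simp only [if_true, zero_mul, zero_add]
  set S := univ.erase m with hS
  have hc : ((S.card : ℕ) : ℝ) = k -1 := by
    have := card_erase_add_one (mem_univ m)
    rw [card_univ, Fintype.card_fin] at this
    rw [eq_sub_iff_add_eq]; exact_mod_cast this
  set s := ∑ i ∈ S, v (some i) with hs
  set T := ∑ i ∈ S, v (some i) ^2 with hT
  have hcs : s ^2 ≤ (k -1) * T := by rw [← hc]; exact cs_k S _
  have hT0 :0 ≤ T := sum_nonneg fun _ _ => sq_nonneg _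
  have e1 : ∑ i ∈ S, (if i = m then 0 else 1 / p * (1 -2 * k / p)) * v (some i) ^2 =1 / p * (1 -2 * k / p) * T := by
    rw [hT, mul_sum]; exact sum_congr rfl fun i hi => by rw [if_neg (ne_of_mem_erase hi)]
  set t := v none - v (some m) / p with ht
  have e0 : v none - (v (some m) + s) / p = t - s / p := by rw [ht]; ring
  have e2 : ∑ i ∈ S, (if i = m then 0 else 1 / (p -1)) * (v none - (v (some m) + s) / p + v (some i)) ^2 =
     ((k -1) * (t - s / p) ^2 +2 * (t - s / p) * s + T) / (p -1) := by
    rw [e0, ← hc]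
    have : ∀ i ∈ S, (if i = m then 0 else 1 / (p -1)) * (t - s / p + v (some i)) ^2 =1 / (p -1) * ((t - s / p) ^2 +2 * (t - s / p) * v (some i) + v (some i) ^2) :=
      fun i hi => by rw [if_neg (ne_of_mem_erase hi)]; ring
    rw [sum_congr rfl this, ← mul_sum, sum_add_distrib, sum_add_distrib, sum_const, nsmul_eq_mul, ← mul_sum]
    ring
  rw [e1, e2, e0]
  have hp1 :0 < p -1 := by linarith
  have hp0 :0 < p := by linarith
  have hk1 : (1:ℝ) ≤ k := by exact_mod_cast Fin.pos m
  have e3 : (1 - (k -1) / (p -1)) * (t - s / p) ^2 + ((k -1) * (t - s / p) ^2 +2 * (t - s / p) * s + T) / (p -1)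
     = (1 -1 / p ^2) * t ^2 + (t / p + s / (p -1)) ^2 + T / (p -1) - s ^2 * ((p +1) / (p ^2 * (p -1)) +1 / (p -1) ^2) := by
    field_simp; ring
  rw [e3]
  have h4 : s ^2 * ((p +1) / (p ^2 * (p -1)) +1 / (p -1) ^2) ≤ (k -1) * T * ((p +1) / (p ^2 * (p -1)) +1 / (p -1) ^2) := by gcongr
  have h5 : (k -1) * ((p +1) / (p ^2 * (p -1)) +1 / (p -1) ^2) ≤1 / (p -1) -1 / p * (1 -2 * k / p) := by
    have :1 / (p -1) -1 / p * (1 -2 * k / p) - (k -1) * ((p +1) / (p ^2 * (p -1)) +1 / (p -1) ^2)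
      = (p * (p -1) +2 * k * (p -1) ^2 - (k -1) * ((p +1) * (p -1) + p ^2)) / (p ^2 * (p -1) ^2) := by
      field_simp; ring
    have h6 :0 ≤ (p * (p -1) +2 * k * (p -1) ^2 - (k -1) * ((p +1) * (p -1) + p ^2)) / (p ^2 * (p -1) ^2) := by
      apply div_nonneg _ (by positivity)
      linarith [mul_nonneg hp0.le (sub_nonneg.2 hp), mul_pos hp0 hp1]
    linarith
  have h7 := mul_le_mul_of_nonneg_right h5 hT0
  have :0 ≤ (t / p + s / (p -1)) ^2 := sq_nonneg _
  have e8 : T / (p -1) =1 / (p -1) * T := by ring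
  linarith

variable {n : ℕ}

noncomputable def fS (p : Fin n → ℕ) (coef : (Fin n → Option (Fin k)) → ℝ) (x : Fin n → Option (Fin k)) : ℝ :=
  ∑ c, (∏ i, xi (p i) (x i) (c i)) * coef c
noncomputable def lam (p : Fin n → ℕ) (coef : (Fin n → Option (Fin k)) → ℝ) (d : Fin n → Option (Fin k)) : ℝ :=
  ∑ c, (∏ i, Bm (p i) (c i) (d i)) * coef c
def nm (p : Fin n → ℕ) (u : Fin n → Option (Fin k)) : ℕ := ∏ i, if u i = none then 1 else p i
noncomputable def ONE (u x : Fin n → Option (Fin k)) : ℝ := ∏ i, one (u i) (x i)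
noncomputable def KAP (d e : Fin n → Option (Fin k)) : ℝ := ∏ i, kap (d i) (e i)
def OR (d e : Fin n → Option (Fin k)) : Fin n → Option (Fin k) := fun i => (d i).or (e i)

theorem E_up (p : Fin n → ℕ) (hp : ∀ i, 1 ≤ p i) (hk : ∀ i, k ≤ p i) (coef : (Fin n → Option (Fin k)) → ℝ) :
    ∑ x, (∏ i, P1 (p i) (x i)) * fS p coef x ^2 ≤ ∑ c, (∏ i, w0 (p i) (c i)) * coef c ^2 := by
  have := tensor n (fun i => P1 (p i)) (fun i => w0 (p i)) (fun i => xi (k := k) (p i)) (fun i x c => if x = c then 1 else 0)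
    (fun i x => by
      cases x with
      | none =>
        have h1 : (0:ℝ) < p i := by exact_mod_cast hp i
        have h2 : (k:ℝ) ≤ p i := by exact_mod_cast hk i
        simp only [P1]; rw [sub_nonneg, div_le_one h1]; exact h2
      | some j => simp [P1])
    (fun i x => by cases x <;> simp [w0]) (fun i v => form_up _ (by exact_mod_cast hp i) v) coef
  refine this.trans (le_of_eq ?_)
  refine sum_congr rfl fun x _ => ?_
  congr 2
  rw [sum_eq_single x]
  · simp
  · intro b _ hb
    obtain ⟨i, hi⟩ := Function.ne_iff.1 hb
    rw [prod_eq_zero (mem_univ i) (if_neg (Ne.symm hi)), zero_mul]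
  · simp

theorem E_low (m : Fin k) (p : Fin n → ℕ) (hp : ∀ i, 3 ≤ p i) (hk : ∀ i, 2 * k ≤ p i) (coef : (Fin n → Option (Fin k)) → ℝ) :
    ∑ x : Fin n → Option (Fin k), (∏ i, P3 m (p i) (x i)) * (∑ c : Fin n → Option (Fin k), (∏ i, A3 m (p i) (x i) (c i)) * coef c) ^2
      ≤ ∑ x, (∏ i, P2 m (p i) (x i)) * fS p coef x ^2 := by
  have h3 : ∀ i, (3:ℝ) ≤ p i := fun i => by exact_mod_cast hp i
  have h4 : ∀ i, 2 * (k:ℝ) ≤ p i := fun i => by exact_mod_cast hk i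
  have h5 : (1:ℝ) ≤ k := by exact_mod_cast Fin.pos m
  refine tensor n (fun i => P3 m (p i)) (fun i => P2 m (p i)) (fun i => A3 m (p i)) (fun i => xi (k := k) (p i)) (fun i x => ?_)
    (fun i x => ?_) (fun i v => form_low m _ (h4 i) (h3 i) v) coef
  · have := h3 i; have := h4 i
    cases x with
    | none => simp only [P3]; rw [sub_nonneg, div_le_one (by positivity)]; nlinarith
    | some j =>
      simp only [P3]; split_ifs
      · rfl
      · refine mul_nonneg (by positivity) ?_
        rw [sub_nonneg, div_le_one (by linarith)]; linarith
  · have := h3 i; have := h4 i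
    cases x with
    | none => simp only [P2]; rw [sub_nonneg, div_le_one (by linarith)]; linarith
    | some j =>
      simp only [P2]; split_ifs
      · rfl
      · apply div_nonneg <;> linarith

theorem xi_exp (p : ℝ) (x c : Option (Fin k)) : xi p x c = ∑ d, Bm p c d * one d x := by
  rw [Fintype.sum_option]
  cases c with
  | none => simp [xi, Bm, one]
  | some i =>
    rw [sum_eq_single i (by intro b _ hb; simp [Bm, Ne.symm hb]) (by simp)]
    simp only [xi, Bm, one, reduceCtorEq, false_or, true_or, if_true, one_mul, mul_one]
    ring

theorem fS_exp (p : Fin n → ℕ) (coef : (Fin n → Option (Fin k)) → ℝ) (x : Fin n → Option (Fin k)) :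
    fS p coef x = ∑ d, lam p coef d * ONE d x := by
  unfold fS lam ONE
  simp only [xi_exp, prod_univ_sum, sum_mul, Fintype.piFinset_univ]
  rw [sum_comm]
  refine sum_congr rfl fun d _ => sum_congr rfl fun c _ => ?_
  rw [prod_mul_distrib]; ring

theorem one_mul_one (a b x : Option (Fin k)) : one a x * one b x = kap a b * one (a.or b) x := by
  unfold one kap
  cases a with
  | none => by_cases h : b = none ∨ x = b <;> simp [h]
  | some i =>
    cases b with
    | none => simp
    | some j =>
      simp only [reduceCtorEq, false_or, Option.or_some, Option.some.injEq]
      by_cases h1 : x = some i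
      · subst h1; by_cases h2 : i = j <;> simp [h2]
      · simp [h1]

theorem ONE_mul (d e x : Fin n → Option (Fin k)) : ONE d x * ONE e x = KAP d e * ONE (OR d e) x := by
  unfold ONE KAP OR
  rw [← prod_mul_distrib, ← prod_mul_distrib]
  exact prod_congr rfl fun i _ => one_mul_one _ _ _

theorem KAP_nonneg (d e : Fin n → Option (Fin k)) :0 ≤ KAP d e := prod_nonneg fun i _ => by
  unfold kap; split_ifs <;> norm_num

theorem fS_sq (p : Fin n → ℕ) (coef : (Fin n → Option (Fin k)) → ℝ) {ι : Type*} (J : Finset ι) (om : ι → ℝ) (X : ι → Fin n → Option (Fin k)) :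
    ∑ j ∈ J, om j * fS p coef (X j) ^2 = ∑ d, ∑ e, lam p coef d * lam p coef e * KAP d e * ∑ j ∈ J, om j * ONE (OR d e) (X j) := by
  have h : ∀ j, om j * fS p coef (X j) ^2 = ∑ d, ∑ e, om j * ((lam p coef d * ONE d (X j)) * (lam p coef e * ONE e (X j))) := fun j => by
    rw [fS_exp, sq, sum_mul_sum]; simp only [mul_sum]
  simp only [h, mul_sum]
  rw [sum_comm]
  refine sum_congr rfl fun d _ => ?_
  rw [sum_comm]
  refine sum_congr rfl fun e _ => sum_congr rfl fun j _ => ?_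
  have := ONE_mul d e (X j)
  linear_combination om j * lam p coef d * lam p coef e * this

theorem fS_err (p : Fin n → ℕ) (coef : (Fin n → Option (Fin k)) → ℝ) {ι : Type*} (J : Finset ι) (om : ι → ℝ) (X : ι → Fin n → Option (Fin k))
    (P : Fin n → Option (Fin k) → ℝ) (M : ℝ) (err : (Fin n → Option (Fin k)) → ℝ)
    (h : ∀ d e, lam p coef d ≠0 → lam p coef e ≠0 → |∑ j ∈ J, om j * ONE (OR d e) (X j) - M * ∏ i, ∑ x, P i x * one (OR d e i) x| ≤ err (OR d e)) :
    |∑ j ∈ J, om j * fS p coef (X j) ^2 - M * ∑ x, (∏ i, P i (x i)) * fS p coef x ^2| ≤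
      ∑ d, ∑ e, |lam p coef d| * |lam p coef e| * (KAP d e * err (OR d e)) := by
  have e2 : M * ∑ x, (∏ i, P i (x i)) * fS p coef x ^2 = ∑ d, ∑ e, lam p coef d * lam p coef e * KAP d e * (M * ∏ i, ∑ x, P i x * one (OR d e i) x) := by
    have h0 := fS_sq p coef univ (fun x : Fin n → Option (Fin k) => ∏ i, P i (x i)) id
    simp only [id] at h0
    rw [h0, mul_sum]
    refine sum_congr rfl fun d _ => ?_
    rw [mul_sum]
    refine sum_congr rfl fun e _ => ?_
    simp only [prod_univ_sum, Fintype.piFinset_univ, prod_mul_distrib, ONE]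
    ring
  rw [fS_sq, e2, ← sum_sub_distrib]
  refine (abs_sum_le_sum_abs _ _).trans (sum_le_sum fun d _ => ?_)
  rw [← sum_sub_distrib]
  refine (abs_sum_le_sum_abs _ _).trans (sum_le_sum fun e _ => ?_)
  rw [← mul_sub, abs_mul, abs_mul, abs_mul, abs_of_nonneg (KAP_nonneg d e), ← mul_assoc]
  by_cases hd : lam p coef d =0
  · simp [hd]
  by_cases he : lam p coef e =0
  · simp [he]
  have := KAP_nonneg d e
  gcongr
  exact h d e hd he
end

section
variable {k n : ℕ}

noncomputable def Vk (c : ℝ) (p : Fin n → ℕ) : ℝ := ∏ i, (1 + c / p i)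
noncomputable def ph (p : Fin n → ℕ) (u : Fin n → Option (Fin k)) : ℝ := ∏ i, if u i = none then 1 else (p i -1 : ℝ)

theorem Vk_one {c : ℝ} (hc :0 ≤ c) (p : Fin n → ℕ) :1 ≤ Vk c p :=
  le_of_eq_of_le (by simp) (prod_le_prod (s := univ) (f := fun _ => (1:ℝ)) (fun _ _ => zero_le_one) fun i _ => by
    have :0 ≤ c / p i := by positivity
    linarith)

theorem sum_nm (p : Fin n → ℕ) : ∑ d : Fin n → Option (Fin k), (1 : ℝ) / nm p d = Vk k p := by
  have e : ∀ d : Fin n → Option (Fin k), (1 : ℝ) / nm p d = ∏ i, w0 (p i) (d i) := fun d => by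
    unfold nm
    push_cast
    rw [one_div, ← prod_inv_distrib]
    refine prod_congr rfl fun i _ => ?_
    cases h : d i <;> simp [w0]
  simp only [e]
  rw [← Fintype.piFinset_univ, ← prod_univ_sum]
  refine prod_congr rfl fun i _ => ?_
  rw [Fintype.sum_option]
  simp [w0, div_eq_mul_inv]

theorem lam_bd (p : Fin n → ℕ) (coef : (Fin n → Option (Fin k)) → ℝ) (h1 : ∀ c, |coef c| ≤1) (d : Fin n → Option (Fin k)) :
    |lam p coef d| ≤ Vk k p := by
  unfold lam
  calc _ ≤ ∑ c, ∏ i, |Bm (p i) (c i) (d i)| := (abs_sum_le_sum_abs _ _).trans (sum_le_sum fun c _ => by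
        rw [abs_mul, abs_prod]
        exact mul_le_of_le_one_right (prod_nonneg fun _ _ => abs_nonneg _) (h1 c))
    _ = ∏ i, ∑ c, |Bm (p i) c (d i)| := by rw [prod_univ_sum, Fintype.piFinset_univ]
    _ ≤ Vk k p := prod_le_prod (fun _ _ => sum_nonneg fun _ _ => abs_nonneg _) fun i _ => by
        rw [Fintype.sum_option]
        cases h : d i with
        | none => simp [Bm, div_eq_mul_inv]
        | some j =>
          have : (0:ℝ) ≤ k / p i := by positivity
          simp only [Bm, abs_zero, zero_add]
          rw [sum_eq_single j (by intro b _ hb; simp [hb]) (by simp)]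
          simpa using this

theorem lam_supp (p : Fin n → ℕ) (hp : ∀ i, 1 ≤ p i) (coef : (Fin n → Option (Fin k)) → ℝ) {R : ℕ} (hR : ∀ c, coef c ≠0 → nm p c ≤ R)
    {d : Fin n → Option (Fin k)} (h : lam p coef d ≠0) : nm p d ≤ R := by
  obtain ⟨c, _, hc⟩ := exists_ne_zero_of_sum_ne_zero h
  refine le_trans ?_ (hR c (right_ne_zero_of_mul hc))
  have h2 := prod_ne_zero_iff.1 (left_ne_zero_of_mul hc)
  refine prod_le_prod' fun i _ => ?_
  have h3 := h2 i (mem_univ i)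
  split_ifs with g1 g2 g2
  · rfl
  · exact hp i
  · exfalso
    rw [g2] at h3
    cases hd : d i with
    | none => exact g1 hd
    | some j => rw [hd] at h3; exact h3 rfl
  · rfl

theorem lam_sum (p : Fin n → ℕ) (hp : ∀ i, 1 ≤ p i) (coef : (Fin n → Option (Fin k)) → ℝ) (h1 : ∀ c, |coef c| ≤1) {R : ℕ} (hR : ∀ c, coef c ≠0 → nm p c ≤ R) :
    ∑ d, |lam p coef d| ≤ R * Vk k p ^2 := by
  have hV := Vk_one (Nat.cast_nonneg (α := ℝ) k) p
  calc _ ≤ ∑ d : Fin n → Option (Fin k), R * Vk k p * (1 / nm p d) := sum_le_sum fun d _ => by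
        by_cases h : lam p coef d =0
        · rw [h, abs_zero]; positivity
        have h2 := lam_bd p coef h1 d
        have h3 : (nm p d : ℝ) ≤ R := by exact_mod_cast lam_supp p hp coef hR h
        have h4 : (0:ℝ) < nm p d := by
          have :0 < nm p d := prod_pos fun i _ => by split_ifs <;> [norm_num; exact hp i]
          exact_mod_cast this
        rw [mul_one_div, le_div_iff₀ h4, mul_comm]
        gcongr
    _ = _ := by rw [← mul_sum, sum_nm]; ring

theorem ONE_le (u x : Fin n → Option (Fin k)) :0 ≤ ONE u x ∧ ONE u x ≤1 := by
  constructor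
  · exact prod_nonneg fun i _ => by unfold one; split_ifs <;> norm_num
  · exact prod_le_one (fun i _ => by unfold one; split_ifs <;> norm_num) fun i _ => by unfold one; split_ifs <;> norm_num

theorem fS_bd (p : Fin n → ℕ) (hp : ∀ i, 1 ≤ p i) (coef : (Fin n → Option (Fin k)) → ℝ) (h1 : ∀ c, |coef c| ≤1) {R : ℕ} (hR : ∀ c, coef c ≠0 → nm p c ≤ R)
    (x : Fin n → Option (Fin k)) : |fS p coef x| ≤ R * Vk k p ^2 := by
  rw [fS_exp]
  refine ((abs_sum_le_sum_abs _ _).trans (sum_le_sum fun d _ => ?_)).trans (lam_sum p hp coef h1 hR)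
  rw [abs_mul, abs_of_nonneg (ONE_le d x).1]
  exact mul_le_of_le_one_right (abs_nonneg _) (ONE_le d x).2

theorem gcd_prod (D : ℕ) (s : Finset (Fin n)) (f : Fin n → ℕ) : D.gcd (∏ i ∈ s, f i) ∣ ∏ i ∈ s, D.gcd (f i) := by
  classical
  induction s using Finset.induction_on with
  | empty => simp
  | insert a s ha ih =>
    rw [prod_insert ha, prod_insert ha]
    exact (Nat.gcd_mul_right_dvd_mul_gcd _ _ _).trans (mul_dvd_mul_left _ ih)

theorem KAP_le (d e : Fin n → Option (Fin k)) : KAP d e ≤1 :=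
  prod_le_one (fun i _ => by unfold kap; split_ifs <;> norm_num) fun i _ => by unfold kap; split_ifs <;> norm_num

theorem or_sum (a b : ℝ) (h : Option (Fin k) → ℝ) (h0 : h none = a) (h1 : ∀ i, h (some i) = b) :
    ∑ x : Option (Fin k), ∑ y : Option (Fin k), kap x y * h (x.or y) = a +3 * k * b := by
  rw [Fintype.sum_option, Fintype.sum_option]
  have e : ∀ i : Fin k, ∑ y : Option (Fin k), kap (some i) y * h ((some i).or y) =2 * b := fun i => by
    rw [Fintype.sum_option, sum_eq_single i (by intro j _ hj; simp [kap, Ne.symm hj]) (by simp)]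
    simp [kap, h1]; ring
  simp only [e]
  simp [kap, h0, h1]; ring

theorem sum_D (p : Fin n → ℕ) (hp : ∀ i, (p i).Prime) (hinj : Function.Injective p) (hpk : ∀ i, 36 * k ^2 ≤ p i) (D : ℕ) (hD :1 ≤ D) :
    ∑ d : Fin n → Option (Fin k), ∑ e : Fin n → Option (Fin k), (if D ∣ nm p (OR d e) then KAP d e / ph p (OR d e) else 0) ≤ Vk (6 * k) p / √D := by
  classical
  have hVk := Vk_one (show (0:ℝ) ≤6 * k by positivity) p
  by_cases hex : ∃ u : Fin n → Option (Fin k), D ∣ nm p u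
  swap
  · have : ∀ d e : Fin n → Option (Fin k), ¬ D ∣ nm p (OR d e) := fun d e h => hex ⟨_, h⟩
    simp only [this, if_false, sum_const_zero]; positivity
  obtain ⟨u, hu⟩ := hex
  have hp2 : ∀ i, (2:ℝ) ≤ p i := fun i => by exact_mod_cast (hp i).two_le
  have hDle : (D : ℝ) ≤ ∏ i, if p i ∣ D then (p i : ℝ) else 1 := by
    have h1 : D ∣ ∏ i, D.gcd (if u i = none then 1 else p i) := by
      have := gcd_prod D univ (fun i => if u i = none then 1 else p i)
      change D.gcd (nm p u) ∣ _ at this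
      rwa [Nat.gcd_eq_left hu] at this
    have h2 : D ≤ ∏ i, D.gcd (if u i = none then 1 else p i) := Nat.le_of_dvd (prod_pos fun i _ => Nat.gcd_pos_of_pos_left _ hD) h1
    have h3 : ∏ i, D.gcd (if u i = none then 1 else p i) ≤ ∏ i, if p i ∣ D then p i else 1 := prod_le_prod' fun i _ => by
      split_ifs with g1 g2 g2
      · simp; exact (hp i).one_lt.le
      · simp
      · exact Nat.gcd_le_right _ (hp i).pos
      · rw [((hp i).coprime_iff_not_dvd.2 g2).symm]
    exact_mod_cast h2.trans h3
  let h : Fin n → Option (Fin k) → ℝ := fun i x => if x = none then (if p i ∣ D then 0 else 1) else 1 / (p i -1)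
  have hh0 : ∀ i x, 0 ≤ h i x := fun i x => by
    have := hp2 i
    simp only [h]; split_ifs
    · rfl
    · norm_num
    · apply div_nonneg <;> linarith
  calc _ ≤ ∑ d : Fin n → Option (Fin k), ∑ e : Fin n → Option (Fin k), ∏ i, kap (d i) (e i) * h i ((d i).or (e i)) := by
        refine sum_le_sum fun d _ => sum_le_sum fun e _ => ?_
        rw [prod_mul_distrib]
        split_ifs with hd
        · rw [div_eq_mul_inv]
          refine mul_le_mul_of_nonneg_left (le_of_eq ?_) (KAP_nonneg d e)
          unfold ph
          rw [← prod_inv_distrib]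
          refine prod_congr rfl fun i _ => ?_
          simp only [h]
          change _ = if OR d e i = none then _ else _
          split_ifs with g1 g2
          · exfalso
            obtain ⟨j, _, hj⟩ := (Nat.Prime.prime (hp i)).exists_mem_finset_dvd (g2.trans hd)
            split_ifs at hj with g3
            · exact (hp i).one_lt.ne' (Nat.dvd_one.1 hj)
            · rw [hinj ((Nat.prime_dvd_prime_iff_eq (hp i) (hp j)).1 hj)] at g1
              exact g3 g1
          · simp
          · simp
        · exact mul_nonneg (KAP_nonneg d e) (prod_nonneg fun i _ => hh0 _ _)
    _ = ∏ i, ∑ x : Option (Fin k), ∑ y : Option (Fin k), kap x y * h i (x.or y) := by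
        rw [prod_univ_sum, Fintype.piFinset_univ]
        refine sum_congr rfl fun d _ => ?_
        rw [prod_univ_sum, Fintype.piFinset_univ]
    _ = ∏ i, ((if p i ∣ D then (0:ℝ) else 1) +3 * (k:ℝ) * (1 / ((p i:ℝ) -1))) := prod_congr rfl fun i _ =>
        or_sum _ _ _ (by simp [h]) (fun j => by simp [h])
    _ ≤ ∏ i, ((1 +6 * k / p i) * (if p i ∣ D then 1 / √(p i) else 1)) := by
        refine prod_le_prod (fun i _ => ?_) fun i _ => ?_
        · have := hp2 i
          have : (0:ℝ) ≤1 / (p i -1) := by apply div_nonneg <;> linarith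
          split_ifs <;> positivity
        · have h2 := hp2 i
          have h3 :3 * k * (1 / (p i -1 : ℝ)) ≤6 * k / p i := by
            rw [mul_one_div, div_le_div_iff₀ (by linarith) (by linarith)]
            have : (0:ℝ) ≤ k := by positivity
            nlinarith
          split_ifs
          · have h4 : (6 * k : ℝ) ≤ √(p i) := by
              apply Real.le_sqrt_of_sq_le
              have : ((36 * k ^2 : ℕ) : ℝ) ≤ p i := by exact_mod_cast hpk i
              push_cast at this; nlinarith
            have h5 :6 * k / p i ≤1 / √(p i) := by
              rw [div_le_div_iff₀ (by linarith) (by positivity)]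
              nlinarith [Real.mul_self_sqrt (show (0:ℝ) ≤ p i by linarith), Real.sqrt_nonneg (p i : ℝ)]
            have h6 :0 ≤6 * k / (p i : ℝ) * (1 / √(p i)) := by positivity
            nlinarith
          · linarith
    _ = Vk (6 * k) p * ∏ i, (if p i ∣ D then 1 / √(p i) else 1) := by rw [prod_mul_distrib]; rfl
    _ = Vk (6 * k) p / √(∏ i, if p i ∣ D then (p i : ℝ) else 1) := by
        rw [div_eq_mul_inv, Real.sqrt_eq_rpow, ← Real.finsetProd_rpow _ _ (fun i _ => by split_ifs <;> positivity), ← prod_inv_distrib]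
        congr 1
        refine prod_congr rfl fun i _ => ?_
        split_ifs
        · rw [Real.sqrt_eq_rpow]; simp
        · simp
    _ ≤ _ := by
        have : (0:ℝ) < D := by exact_mod_cast hD
        gcongr

theorem err_sum (p : Fin n → ℕ) (hp : ∀ i, (p i).Prime) (hinj : Function.Injective p) (hpk : ∀ i, 36 * k ^2 ≤ p i)
    (coef : (Fin n → Option (Fin k)) → ℝ) (h1 : ∀ c, |coef c| ≤1) {R : ℕ} (hR : ∀ c, coef c ≠0 → nm p c ≤ R)
    {W : ℕ} (hW :1 ≤ W) (F : ℕ → ℝ) (hF : ∀ D, 0 ≤ F D) (E0 : ℝ) (hE0 :0 ≤ E0) :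
    ∑ d, ∑ e, |lam p coef d| * |lam p coef e| * (KAP d e * ((∑ D ∈ (W * nm p (OR d e)).divisors.erase 1, F D) / ph p (OR d e) + E0))
      ≤ Vk k p ^2 * (Vk (6 * k) p * W) * ∑ D ∈ Icc 2 (W * R ^2), F D / √D + E0 * (R * Vk k p ^2) ^2 := by
  have hV := Vk_one (Nat.cast_nonneg (α := ℝ) k) p
  have hp1 : ∀ i, 1 ≤ p i := fun i => (hp i).one_lt.le
  have hph : ∀ u : Fin n → Option (Fin k), 0 ≤ ph p u := fun u => prod_nonneg fun i _ => by
    have : (1:ℝ) ≤ p i := by exact_mod_cast hp1 i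
    split_ifs <;> linarith
  have step : ∀ d e : Fin n → Option (Fin k), |lam p coef d| * |lam p coef e| * (KAP d e * ((∑ D ∈ (W * nm p (OR d e)).divisors.erase 1, F D) / ph p (OR d e) + E0))
      ≤ Vk k p ^2 * ∑ D ∈ Icc 2 (W * R ^2), F D * (if D / D.gcd W ∣ nm p (OR d e) then KAP d e / ph p (OR d e) else 0) + E0 * (|lam p coef d| * |lam p coef e|) := by
    intro d e
    have hK0 := KAP_nonneg d e
    have hK1 := KAP_le d e
    have hpp := hph (OR d e)
    have nn :0 ≤ ∑ D ∈ Icc 2 (W * R ^2), F D * (if D / D.gcd W ∣ nm p (OR d e) then KAP d e / ph p (OR d e) else 0) :=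
      sum_nonneg fun D _ => mul_nonneg (hF D) (by split_ifs <;> positivity)
    by_cases hd : lam p coef d =0
    · simp only [hd, abs_zero, zero_mul, mul_zero, add_zero]; positivity
    by_cases he : lam p coef e =0
    · simp only [he, abs_zero, zero_mul, mul_zero, add_zero]; positivity
    have hd' := lam_supp p hp1 coef hR hd
    have he' := lam_supp p hp1 coef hR he
    have hor : nm p (OR d e) ≤ R ^2 := by
      rw [sq]
      refine le_trans ?_ (Nat.mul_le_mul hd' he')
      unfold nm
      rw [← prod_mul_distrib]
      refine prod_le_prod' fun i _ => ?_
      have := hp1 i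
      simp only [OR, Option.or_eq_none_iff]
      split_ifs with a b c <;> simp_all
      nlinarith
    have key : KAP d e * ((∑ D ∈ (W * nm p (OR d e)).divisors.erase 1, F D) / ph p (OR d e)) ≤
        ∑ D ∈ Icc 2 (W * R ^2), F D * (if D / D.gcd W ∣ nm p (OR d e) then KAP d e / ph p (OR d e) else 0) := by
      have e1 : KAP d e * ((∑ D ∈ (W * nm p (OR d e)).divisors.erase 1, F D) / ph p (OR d e)) =
          ∑ D ∈ (W * nm p (OR d e)).divisors.erase 1, F D * (if D / D.gcd W ∣ nm p (OR d e) then KAP d e / ph p (OR d e) else 0) := by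
        rw [mul_div_assoc', mul_comm, mul_div_assoc, sum_mul]
        refine sum_congr rfl fun D hD => ?_
        rw [if_pos]
        have := (Nat.mem_divisors.1 (mem_erase.1 hD).2)
        have hD0 :0 < D := Nat.pos_of_dvd_of_pos this.1 (Nat.pos_of_ne_zero this.2)
        have hg :0 < D.gcd W := Nat.gcd_pos_of_pos_left _ hD0
        refine (Nat.coprime_div_gcd_div_gcd hg).dvd_of_dvd_mul_left ?_
        have h5 := Nat.div_dvd_div (Nat.gcd_dvd_left D W) this.1
        rwa [Nat.mul_div_right_comm (Nat.gcd_dvd_right D W)] at h5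
      rw [e1]
      refine sum_le_sum_of_subset_of_nonneg ?_ fun D _ _ => mul_nonneg (hF D) (by split_ifs <;> positivity)
      intro D hD
      rw [mem_erase, Nat.mem_divisors] at hD
      have h6 := Nat.le_of_dvd (Nat.pos_of_ne_zero hD.2.2) hD.2.1
      have h7 := Nat.pos_of_dvd_of_pos hD.2.1 (Nat.pos_of_ne_zero hD.2.2)
      rw [mem_Icc]
      refine ⟨by have := hD.1; omega, h6.trans (Nat.mul_le_mul_left _ hor)⟩
    rw [mul_add, mul_add]
    refine add_le_add ?_ ?_
    · rw [sq (Vk k p)]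
      exact mul_le_mul (mul_le_mul (lam_bd p coef h1 d) (lam_bd p coef h1 e) (abs_nonneg _) (by linarith)) key
        (mul_nonneg hK0 (div_nonneg (sum_nonneg fun _ _ => hF _) hpp)) (by positivity)
    · rw [mul_comm E0]
      refine mul_le_mul_of_nonneg_left ?_ (by positivity)
      exact mul_le_of_le_one_left hE0 hK1
  refine (sum_le_sum fun d _ => sum_le_sum fun e _ => step d e).trans ?_
  simp only [sum_add_distrib]
  refine add_le_add ?_ ?_
  · simp only [← mul_sum]
    rw [mul_assoc]
    refine mul_le_mul_of_nonneg_left ?_ (by positivity)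
    have e2 : ∑ d : Fin n → Option (Fin k), ∑ e : Fin n → Option (Fin k), ∑ D ∈ Icc 2 (W * R ^2), F D * (if D / D.gcd W ∣ nm p (OR d e) then KAP d e / ph p (OR d e) else 0)
       = ∑ D ∈ Icc 2 (W * R ^2), F D * ∑ d : Fin n → Option (Fin k), ∑ e : Fin n → Option (Fin k), (if D / D.gcd W ∣ nm p (OR d e) then KAP d e / ph p (OR d e) else 0) := by
      simp only [mul_sum]
      rw [sum_congr rfl fun d _ => sum_comm, sum_comm]
    rw [e2, mul_sum]
    refine sum_le_sum fun D hD => ?_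
    have hD2 := (mem_Icc.1 hD).1
    have hg :0 < D.gcd W := Nat.gcd_pos_of_pos_left _ (by omega)
    have hgW : D.gcd W ≤ W := Nat.gcd_le_right _ hW
    have hdd : D / D.gcd W * D.gcd W = D := Nat.div_mul_cancel (Nat.gcd_dvd_left D W)
    have h7 :1 ≤ D / D.gcd W := Nat.div_pos (Nat.gcd_le_left _ (by omega)) hg
    have h8 := sum_D p hp hinj hpk (D / D.gcd W) h7
    have hVk := Vk_one (show (0:ℝ) ≤6 * k by positivity) p
    have h9 : Vk (6 * k) p / √((D / D.gcd W : ℕ) : ℝ) ≤ Vk (6 * k) p * W / √D := by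
      have a1 : (0:ℝ) < ((D / D.gcd W : ℕ) : ℝ) := by exact_mod_cast h7
      have a2 : (0:ℝ) < D := by exact_mod_cast (by omega :0 < D)
      rw [div_le_div_iff₀ (Real.sqrt_pos.2 a1) (Real.sqrt_pos.2 a2), mul_assoc]
      refine mul_le_mul_of_nonneg_left ?_ (by linarith)
      have a3 : (1:ℝ) ≤ W := by exact_mod_cast hW
      rw [← Real.sqrt_sq (show (0:ℝ) ≤ W by linarith), ← Real.sqrt_mul (by positivity)]
      apply Real.sqrt_le_sqrt
      have a4 : (D:ℝ) ≤ ((D / D.gcd W : ℕ) : ℝ) * W := by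
        exact_mod_cast hdd.symm.le.trans (Nat.mul_le_mul_left _ hgW)
      nlinarith
    calc _ ≤ F D * (Vk (6 * k) p * W / √D) := mul_le_mul_of_nonneg_left (h8.trans h9) (hF D)
      _ = _ := by ring
  · simp only [← mul_sum]
    rw [← sum_mul, sq]
    have := lam_sum p hp1 coef h1 hR
    have h0 :0 ≤ ∑ d, |lam p coef d| := sum_nonneg fun _ _ => abs_nonneg _
    gcongr
end

section
variable {k n : ℕ}

def sg : Option (Fin k) → ℝ
  | none => 1
  | some _ => -1
def rr (p : Fin n → ℕ) (c : Fin n → Option (Fin k)) (i : Fin k) : ℕ := ∏ t, if c t = some i then p t else 1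
noncomputable def yy (p : Fin n → ℕ) (g : ℕ → ℝ) (R : ℕ) (c : Fin n → Option (Fin k)) : ℝ :=
  if nm p c ≤ R then ∏ i, g (rr p c i) else 0
noncomputable def cof (p : Fin n → ℕ) (g : ℕ → ℝ) (R : ℕ) (c : Fin n → Option (Fin k)) : ℝ := (∏ t, sg (c t)) * yy p g R c
def II (W z : ℕ) : Finset ℕ := (Icc 1 z).filter (fun u => u.Coprime W)

theorem sg_abs (x : Option (Fin k)) : |sg x| =1 := by cases x <;> simp [sg]

theorem sg_sq (c : Fin n → Option (Fin k)) : (∏ t, sg (c t)) ^2 =1 := by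
  rw [← sq_abs, abs_prod, prod_congr rfl fun t _ => sg_abs (c t)]; simp

theorem yy_nonneg {g : ℕ → ℝ} (h0 : ∀ u, 0 ≤ g u) (p : Fin n → ℕ) (R : ℕ) (c : Fin n → Option (Fin k)) :0 ≤ yy p g R c := by
  unfold yy; split_ifs
  · exact prod_nonneg fun _ _ => h0 _
  · rfl

theorem cof_le {g : ℕ → ℝ} (h0 : ∀ u, 0 ≤ g u) (h1 : ∀ u, g u ≤1) (p : Fin n → ℕ) (R : ℕ) (c : Fin n → Option (Fin k)) : |cof p g R c| ≤1 := by
  unfold cof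
  rw [abs_mul, abs_prod, prod_congr rfl fun t _ => sg_abs (c t), abs_of_nonneg (yy_nonneg h0 p R c)]
  simp only [prod_const_one, one_mul]
  unfold yy; split_ifs
  · exact prod_le_one (fun _ _ => h0 _) fun _ _ => h1 _
  · norm_num

theorem cof_supp {g : ℕ → ℝ} {p : Fin n → ℕ} {R : ℕ} (c : Fin n → Option (Fin k)) (h : cof p g R c ≠0) : nm p c ≤ R := by
  by_contra h2
  apply h
  simp [cof, yy, h2]

theorem nm_rr (p : Fin n → ℕ) (c : Fin n → Option (Fin k)) : ∏ i, rr p c i = nm p c := by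
  unfold rr nm
  rw [Finset.prod_comm]
  refine prod_congr rfl fun t _ => ?_
  cases h : c t with
  | none => simp
  | some j => simp [eq_comm]

theorem dvd_rr {p : Fin n → ℕ} (hp : ∀ i, (p i).Prime) (hinj : Function.Injective p) (c : Fin n → Option (Fin k)) (i : Fin k) (t : Fin n) :
    p t ∣ rr p c i ↔ c t = some i := by
  constructor
  · intro h
    obtain ⟨s, _, hs⟩ := (Nat.Prime.prime (hp t)).exists_mem_finset_dvd h
    split_ifs at hs with g
    · rwa [hinj ((Nat.prime_dvd_prime_iff_eq (hp t) (hp s)).1 hs)]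
    · exact absurd (Nat.dvd_one.1 hs) (hp t).one_lt.ne'
  · intro h
    have := dvd_prod_of_mem (fun t => if c t = some i then p t else 1) (mem_univ t)
    simp only [h, if_true] at this
    exact this

theorem rr_inj {p : Fin n → ℕ} (hp : ∀ i, (p i).Prime) (hinj : Function.Injective p) : Function.Injective (rr (k := k) p) := by
  intro c d h
  funext t
  apply Option.ext
  intro i
  rw [← dvd_rr hp hinj, ← dvd_rr hp hinj, h]

theorem w0_nm (p : Fin n → ℕ) (d : Fin n → Option (Fin k)) : ∏ i, w0 (p i : ℝ) (d i) =1 / nm p d := by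
  unfold nm
  push_cast
  rw [one_div, ← prod_inv_distrib]
  refine prod_congr rfl fun i _ => ?_
  cases h : d i <;> simp [w0]

theorem rr_pos {p : Fin n → ℕ} (hp : ∀ i, (p i).Prime) (c : Fin n → Option (Fin k)) (i : Fin k) :1 ≤ rr p c i :=
  Nat.succ_le_of_lt (prod_pos (f := fun t => if c t = some i then p t else 1) fun t _ => by
    split_ifs <;> [exact (hp t).pos; norm_num])

theorem opt_up {p : Fin n → ℕ} (hp : ∀ i, (p i).Prime) (hinj : Function.Injective p) {W z : ℕ} (hW : ∀ i, (p i).Coprime W)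
    {g : ℕ → ℝ} (hz : ∀ u, z < u → g u =0) (R : ℕ) :
    ∑ c : Fin n → Option (Fin k), (∏ i, w0 (p i : ℝ) (c i)) * cof p g R c ^2 ≤ (∑ u ∈ II W z, g u ^2 / u) ^ k := by
  classical
  have h1 : ∀ c : Fin n → Option (Fin k), (∏ i, w0 (p i : ℝ) (c i)) * cof p g R c ^2 ≤ ∏ i, g (rr p c i) ^2 / rr p c i := fun c => by
    rw [w0_nm, prod_div_distrib, prod_pow, ← Nat.cast_prod, nm_rr, div_mul_eq_mul_div, one_mul, cof, mul_pow, sg_sq, one_mul]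
    gcongr ?_ / _
    unfold yy; split_ifs
    · rfl
    · rw [zero_pow two_ne_zero]; exact sq_nonneg _
  calc _ ≤ ∑ c : Fin n → Option (Fin k), ∏ i, g (rr p c i) ^2 / rr p c i := sum_le_sum fun c _ => h1 c
    _ = ∑ c ∈ univ.filter (fun c : Fin n → Option (Fin k) => rr p c ∈ Fintype.piFinset fun _ => II W z), ∏ i, g (rr p c i) ^2 / rr p c i := by
        symm
        refine sum_subset (filter_subset _ _) fun c _ hc => ?_
        have : ∃ i, rr p c i ∉ II W z := by
          by_contra! h
          exact hc (mem_filter.2 ⟨mem_univ _, Fintype.mem_piFinset.2 h⟩)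
        obtain ⟨i, hi⟩ := this
        refine prod_eq_zero (mem_univ i) ?_
        rw [hz, zero_pow two_ne_zero, zero_div]
        by_contra hlt
        refine hi (mem_filter.2 ⟨mem_Icc.2 ⟨rr_pos hp c i, not_lt.1 hlt⟩, ?_⟩)
        exact Nat.Coprime.prod_left fun t _ => by split_ifs <;> [exact hW t; exact Nat.coprime_one_left _]
    _ = ∑ r ∈ (univ.filter (fun c : Fin n → Option (Fin k) => rr p c ∈ Fintype.piFinset fun _ => II W z)).image (rr p), ∏ i, g (r i) ^2 / r i :=
        (sum_image (f := fun r : Fin k → ℕ => ∏ i, g (r i) ^2 / (r i : ℝ)) (rr_inj hp hinj).injOn).symm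
    _ ≤ ∑ r ∈ Fintype.piFinset fun _ : Fin k => II W z, ∏ i, g (r i) ^2 / r i := by
        refine sum_le_sum_of_subset_of_nonneg ?_ fun r _ _ => prod_nonneg fun i _ => by positivity
        intro r hr
        obtain ⟨c, hc, rfl⟩ := mem_image.1 hr
        exact (mem_filter.1 hc).2
    _ = _ := by rw [← prod_univ_sum (fun _ : Fin k => II W z) (fun _ u => g u ^2 / (u:ℝ))]; simp

open Classical in
noncomputable def cf (p : Fin n → ℕ) (r : Fin k → ℕ) (t : Fin n) : Option (Fin k) :=
  if h : ∃ i, p t ∣ r i then some h.choose else none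

structure GT (p : Fin n → ℕ) (r : Fin k → ℕ) : Prop where
  pos : ∀ i, r i ≠0
  sq : ∀ t i, ¬ p t ^2 ∣ r i
  co : ∀ t i j, i ≠ j → p t ∣ r i → ¬ p t ∣ r j
  pr : ∀ i q, q.Prime → q ∣ r i → ∃ t, p t = q

theorem cf_some {p : Fin n → ℕ} {r : Fin k → ℕ} (h : GT p r) (t : Fin n) (i : Fin k) : cf p r t = some i ↔ p t ∣ r i := by
  unfold cf
  constructor
  · intro h1
    split_ifs at h1 with h2
    rw [← Option.some_injective _ h1]; exact h2.choose_spec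
  · intro h1
    have h2 : ∃ i, p t ∣ r i := ⟨i, h1⟩
    rw [dif_pos h2]
    congr 1
    by_contra h3
    exact h.co t _ _ h3 h2.choose_spec h1

theorem cf_none {p : Fin n → ℕ} {r : Fin k → ℕ} (t : Fin n) (h : ∀ i, ¬ p t ∣ r i) : cf p r t = none := by
  unfold cf
  rw [dif_neg (by simpa using h)]

theorem prod_dvd {p : Fin n → ℕ} (hp : ∀ i, (p i).Prime) (hinj : Function.Injective p) {u : ℕ} (h0 : u ≠0) (hs : ∀ t, ¬ p t ^2 ∣ u)
    (hq : ∀ q, q.Prime → q ∣ u → ∃ t, p t = q) : ∏ t, (if p t ∣ u then p t else 1) = u := by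
  have hsq : Squarefree u := Nat.squarefree_iff_prime_squarefree.2 fun q h1 h2 => by
    obtain ⟨t, rfl⟩ := hq q h1 ((Dvd.intro_left q rfl).trans h2)
    exact hs t (by rwa [sq])
  conv_rhs => rw [← Nat.prod_primeFactors_of_squarefree hsq]
  rw [← prod_filter, ← prod_image (s := univ.filter fun t => p t ∣ u) (g := p) (f := fun x => x) hinj.injOn]
  refine prod_congr ?_ fun _ _ => rfl
  ext q
  simp only [mem_image, mem_filter, mem_univ, true_and, Nat.mem_primeFactors]
  constructor
  · rintro ⟨t, h1, rfl⟩; exact ⟨hp t, h1, h0⟩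
  · rintro ⟨h1, h2, _⟩
    obtain ⟨t, rfl⟩ := hq q h1 h2
    exact ⟨t, h2, rfl⟩

theorem rr_cf {p : Fin n → ℕ} (hp : ∀ i, (p i).Prime) (hinj : Function.Injective p) {r : Fin k → ℕ} (h : GT p r) : rr p (cf p r) = r := by
  funext i
  unfold rr
  simp only [cf_some h]
  exact prod_dvd hp hinj (h.pos i) (fun t => h.sq t i) (h.pr i)

noncomputable def A4 (m : Fin k) (p : ℝ) (x c : Option (Fin k)) : ℝ := A3 m p x c * sg c * sg x

theorem A4_nonneg (m : Fin k) {p : ℝ} (hp :0 ≤ p) (x c : Option (Fin k)) :0 ≤ A4 m p x c := by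
  unfold A4
  cases x with
  | none =>
    cases c with
    | none => simp [A3, sg]
    | some i => simp only [A3, sg]; split_ifs <;> simp [hp]
  | some j => simp only [A3]; split_ifs with h <;> simp [h, sg]

theorem A3_A4 (m : Fin k) (p : Fin n → ℕ) (g : ℕ → ℝ) (R : ℕ) (x : Fin n → Option (Fin k)) :
    (∑ c, (∏ t, A3 m (p t) (x t) (c t)) * cof p g R c) ^2 = (∑ c, (∏ t, A4 m (p t) (x t) (c t)) * yy p g R c) ^2 := by
  have : ∑ c, (∏ t, A4 m (p t) (x t) (c t)) * yy p g R c = (∏ t, sg (x t)) * ∑ c, (∏ t, A3 m (p t) (x t) (c t)) * cof p g R c := by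
    rw [mul_sum]
    refine sum_congr rfl fun c _ => ?_
    unfold A4 cof
    rw [prod_mul_distrib, prod_mul_distrib]; ring
  rw [this, mul_pow, sg_sq, one_mul]
end

section
variable {k n : ℕ}

theorem dvd_sum {W z q : ℕ} (hq :1 ≤ q) {G : ℕ → ℝ} (h0 : ∀ u, 0 ≤ G u) (ha : ∀ u v, 1 ≤ u → u ≤ v → G v ≤ G u) :
    ∑ u ∈ II W z, G u / u * (if q ∣ u then 1 else 0) ≤1 / q * ∑ u ∈ II W z, G u / u := by
  simp only [mul_ite, mul_one, mul_zero]
  rw [← sum_filter, mul_sum]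
  have hq0 : (0:ℝ) < q := by exact_mod_cast hq
  calc _ ≤ ∑ u ∈ (II W z).filter (q ∣ ·), 1 / q * (G (u / q) / (u / q : ℕ)) := by
        refine sum_le_sum fun u hu => ?_
        obtain ⟨hu, v, rfl⟩ := mem_filter.1 hu
        have hv :1 ≤ v := by
          have := (mem_Icc.1 (mem_filter.1 hu).1).1
          rcases Nat.eq_zero_or_pos v with h | h
          · rw [h] at this; omega
          · exact h
        rw [Nat.mul_div_cancel_left _ hq]
        have hv0 : (0:ℝ) < v := by exact_mod_cast hv
        push_cast
        rw [one_div_mul_eq_div, div_div, mul_comm (v:ℝ)]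
        gcongr
        exact ha _ _ hv (Nat.le_mul_of_pos_left _ hq)
    _ = ∑ v ∈ ((II W z).filter (q ∣ ·)).image (· / q), 1 / q * (G v / v) := by
        rw [sum_image]
        intro a h1 b h2 h
        obtain ⟨a', rfl⟩ := (mem_filter.1 (mem_coe.1 h1)).2
        obtain ⟨b', rfl⟩ := (mem_filter.1 (mem_coe.1 h2)).2
        simp only [Nat.mul_div_cancel_left _ hq] at h
        rw [h]
    _ ≤ _ := by
        refine sum_le_sum_of_subset_of_nonneg ?_ fun v _ _ => mul_nonneg (by positivity) (div_nonneg (h0 _) (by positivity))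
        intro v hv
        obtain ⟨u, hu, rfl⟩ := mem_image.1 hv
        obtain ⟨hu, v, rfl⟩ := mem_filter.1 hu
        obtain ⟨h1, h2⟩ := mem_filter.1 hu
        rw [mem_Icc] at h1
        simp only [Nat.mul_div_cancel_left _ hq]
        refine mem_filter.2 ⟨mem_Icc.2 ⟨?_, (Nat.le_mul_of_pos_left _ hq).trans h1.2⟩, h2.coprime_mul_left⟩
        rcases Nat.eq_zero_or_pos v with h | h
        · rw [h] at h1; omega
        · exact h

theorem one_sub_le_prod (s : Finset (Fin n)) (δ : Fin n → ℝ) (h0 : ∀ i, 0 ≤ δ i) (h1 : ∀ i, δ i ≤1) :1 - ∑ i ∈ s, δ i ≤ ∏ i ∈ s, (1 - δ i) := by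
  classical
  induction s using Finset.induction_on with
  | empty => simp
  | insert a s ha ih =>
    rw [sum_insert ha, prod_insert ha]
    have h2 : ∏ i ∈ s, (1 - δ i) ≤1 := prod_le_one (fun i _ => by linarith [h1 i]) fun i _ => by linarith [h0 i]
    nlinarith [h0 a]

noncomputable def wW (p : Fin n → ℕ) (r : Fin k → ℕ) : ℝ := ∑ t, ∑ i, if p t ∣ r i then 1 / (p t : ℝ) else 0

theorem wW_nonneg (p : Fin n → ℕ) (r : Fin k → ℕ) :0 ≤ wW p r := sum_nonneg fun t _ => sum_nonneg fun i _ => by split_ifs <;> positivity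

theorem GT_upd {p : Fin n → ℕ} {r : Fin k → ℕ} (h : GT p r) {m : Fin k} {u : ℕ} (hu : u ≠0) (h1 : ∀ t, ¬ p t ^2 ∣ u)
    (h2 : ∀ t, p t ∣ u → ∀ i, ¬ p t ∣ r i) (h3 : ∀ q, q.Prime → q ∣ u → ∃ t, p t = q) : GT p (Function.update r m u) where
  pos i := by rw [Function.update_apply]; split_ifs <;> [exact hu; exact h.pos i]
  sq t i := by rw [Function.update_apply]; split_ifs <;> [exact h1 t; exact h.sq t i]
  co t i j hij := by
    simp only [Function.update_apply]
    split_ifs with a b b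
    · exact absurd (a.trans b.symm) hij
    · exact fun g => h2 t g j
    · exact fun g g' => h2 t g' i g
    · exact h.co t i j hij
  pr i q := by rw [Function.update_apply]; split_ifs <;> [exact h3 q; exact h.pr i q]

theorem P3_ge {p : Fin n → ℕ} (hp : ∀ i, (p i).Prime) (hinj : Function.Injective p) (hpk : ∀ i, 2 * k ≤ p i) {ε : ℝ} (hε : ∑ t, 1 / (p t : ℝ) ^2 ≤ ε)
    {r : Fin k → ℕ} (h : GT p r) {m : Fin k} (hm : r m =1) :
    1 / (∏ i, (r i : ℝ)) * (1 - ε -2 * k * wW p r) ≤ ∏ t, P3 m (p t : ℝ) (cf p r t) := by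
  have hr : (∏ i, (r i : ℝ)) = nm p (cf p r) := by rw [← nm_rr, rr_cf hp hinj h]; push_cast; rfl
  let δ : Fin n → ℝ := fun t => if cf p r t = none then 1 / (p t : ℝ) ^2 else 2 * k / p t
  have hp1 : ∀ t, (1:ℝ) ≤ p t := fun t => by exact_mod_cast (hp t).one_lt.le
  have e : ∏ t, P3 m (p t : ℝ) (cf p r t) =1 / nm p (cf p r) * ∏ t, (1 - δ t) := by
    rw [← w0_nm, ← prod_mul_distrib]
    refine prod_congr rfl fun t _ => ?_
    cases hc : cf p r t with
    | none => simp [P3, w0, δ, hc]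
    | some i =>
      have : i ≠ m := by
        rintro rfl
        have := (cf_some h t i).1 hc
        rw [hm] at this
        exact (hp t).one_lt.ne' (Nat.dvd_one.1 this)
      simp [P3, w0, δ, hc, this]
  rw [e, hr]
  refine mul_le_mul_of_nonneg_left ?_ (by positivity)
  refine le_trans ?_ (one_sub_le_prod univ δ (fun t => by simp only [δ]; split_ifs <;> positivity) fun t => ?_)
  · have : ∑ t, δ t ≤ ∑ t, 1 / (p t : ℝ) ^2 +2 * k * wW p r := by
      unfold wW
      rw [mul_sum, ← sum_add_distrib]
      refine sum_le_sum fun t _ => ?_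
      have h0 : ∀ i, (0:ℝ) ≤ if p t ∣ r i then 1 / (p t : ℝ) else 0 := fun i => by split_ifs <;> positivity
      simp only [δ]
      cases hc : cf p r t with
      | none =>
        have := sum_nonneg fun i (_ : i ∈ univ) => h0 i
        simp only [if_true]
        have :0 ≤2 * k * ∑ i, if p t ∣ r i then 1 / (p t : ℝ) else 0 := by positivity
        linarith
      | some i =>
        have h2 := single_le_sum (fun i (_ : i ∈ univ) => h0 i) (mem_univ i)
        rw [if_pos ((cf_some h t i).1 hc)] at h2
        have h3 : (0:ℝ) ≤1 / (p t : ℝ) ^2 := by positivity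
        have h4 :2 * (k:ℝ) * (1 / p t) ≤2 * k * ∑ i, if p t ∣ r i then 1 / (p t : ℝ) else 0 := mul_le_mul_of_nonneg_left h2 (by positivity)
        simp only [reduceCtorEq, if_false]
        rw [mul_one_div] at h4
        linarith
    linarith
  · have := hp1 t
    have h2 : (2 * k : ℝ) ≤ p t := by exact_mod_cast hpk t
    simp only [δ]; split_ifs
    · rw [div_le_one (by positivity)]; nlinarith
    · rw [div_le_one (by positivity)]; exact h2

theorem inner_ge {p : Fin n → ℕ} (hp : ∀ i, (p i).Prime) (hinj : Function.Injective p) {W z R : ℕ} (hS : ∀ q, q.Prime → q ≤ z → q.Coprime W → ∃ t, p t = q)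
    {g : ℕ → ℝ} (h0 : ∀ u, 0 ≤ g u) (h1 : g 1 =1) (ha : ∀ u v, 1 ≤ u → u ≤ v → g v ≤ g u)
    {ε : ℝ} (hε : ∑ t, 1 / (p t : ℝ) ^2 ≤ ε) {r : Fin k → ℕ} (h : GT p r) {m : Fin k} (hm : r m =1) (hR : (∏ i, r i) * z ≤ R) :
    (∏ i, g (r i)) * ((∑ u ∈ II W z, g u / u) * (1 - ε - wW p r)) ≤ ∑ c, (∏ t, A4 m (p t) (cf p r t) (c t)) * yy p g R c := by
  classical
  set G1 := ∑ u ∈ II W z, g u / u with hG1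
  have hG0 :0 ≤ G1 := sum_nonneg fun u _ => div_nonneg (h0 _) (by positivity)
  let U := (II W z).filter fun u => (∀ t, ¬ p t ^2 ∣ u) ∧ ∀ t, p t ∣ u → ∀ i, ¬ p t ∣ r i
  have hUG : ∀ u ∈ U, GT p (Function.update r m u) := fun u hu => by
    obtain ⟨hu1, hu2, hu3⟩ := mem_filter.1 hu
    obtain ⟨hu4, hu5⟩ := mem_filter.1 hu1
    rw [mem_Icc] at hu4
    exact GT_upd h (by omega) hu2 hu3 fun q hq hqu => hS q hq ((Nat.le_of_dvd (by omega) hqu).trans hu4.2) (Nat.Coprime.coprime_dvd_left hqu hu5)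
  have hU : G1 * (1 - ε - wW p r) ≤ ∑ u ∈ U, g u / u := by
    have s1 : ∀ t, ∑ u ∈ II W z, g u / u * (if p t ^2 ∣ u then 1 else 0) ≤1 / (p t : ℝ) ^2 * G1 := fun t => by
      have := dvd_sum (W := W) (z := z) (q := p t ^2) (Nat.one_le_pow _ _ (hp t).pos) h0 ha
      push_cast at this; exact this
    have s2 : ∀ t i, ∑ u ∈ II W z, g u / u * (if p t ∣ r i ∧ p t ∣ u then 1 else 0) ≤ (if p t ∣ r i then 1 / (p t : ℝ) else 0) * G1 := fun t i => by
      by_cases hd : p t ∣ r i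
      · simp only [hd, true_and, if_true]
        exact dvd_sum (hp t).one_lt.le h0 ha
      · simp [hd]
    have s3 : ∑ u ∈ II W z, g u / u * (1 - ∑ t, (if p t ^2 ∣ u then (1:ℝ) else 0) - ∑ t, ∑ i, (if p t ∣ r i ∧ p t ∣ u then (1:ℝ) else 0)) ≤ ∑ u ∈ U, g u / u := by
      rw [sum_filter]
      refine sum_le_sum fun u hu => ?_
      have hgu :0 ≤ g u / u := div_nonneg (h0 _) (by positivity)
      have n1 : ∀ t, (0:ℝ) ≤ if p t ^2 ∣ u then (1:ℝ) else 0 := fun t => by split_ifs <;> norm_num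
      have n2 : ∀ t i, (0:ℝ) ≤ if p t ∣ r i ∧ p t ∣ u then (1:ℝ) else 0 := fun t i => by split_ifs <;> norm_num
      have N1 := sum_nonneg fun t (_ : t ∈ univ) => n1 t
      have N2 := sum_nonneg fun t (_ : t ∈ univ) => sum_nonneg fun i (_ : i ∈ univ) => n2 t i
      split_ifs with hc
      · exact mul_le_of_le_one_right hgu (by linarith)
      · refine mul_nonpos_of_nonneg_of_nonpos hgu ?_
        rw [not_and_or] at hc
        rcases hc with hc | hc <;> push Not at hc
        · obtain ⟨t, ht⟩ := hc
          have := single_le_sum (fun t (_ : t ∈ univ) => n1 t) (mem_univ t)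
          rw [if_pos ht] at this; linarith
        · obtain ⟨t, ht, i, hi⟩ := hc
          have h5 := single_le_sum (fun t (_ : t ∈ univ) => sum_nonneg fun i (_ : i ∈ univ) => n2 t i) (mem_univ t)
          have h6 := single_le_sum (fun i (_ : i ∈ univ) => n2 t i) (mem_univ i)
          rw [if_pos ⟨hi, ht⟩] at h6; linarith
    refine le_trans ?_ s3
    simp only [mul_sub, mul_one, sum_sub_distrib, mul_sum]
    rw [sum_comm, sum_comm (s := II W z)]
    simp only [sum_comm (s := II W z)]
    have t1 := sum_le_sum fun t (_ : t ∈ univ) => s1 t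
    have t2 := sum_le_sum fun t (_ : t ∈ univ) => sum_le_sum fun i (_ : i ∈ univ) => s2 t i
    simp only [← sum_mul] at t1 t2
    change _ ≤ wW p r * G1 at t2
    nlinarith
  have hc : ∀ u ∈ U, (∏ i, g (r i)) * (g u / u) = (∏ t, A4 m (p t) (cf p r t) (cf p (Function.update r m u) t)) * yy p g R (cf p (Function.update r m u)) := fun u hu => by
    have hG := hUG u hu
    obtain ⟨hu1, hu2, hu3⟩ := mem_filter.1 hu
    obtain ⟨hu4, hu5⟩ := mem_filter.1 hu1
    rw [mem_Icc] at hu4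
    have e1 : ∏ i, Function.update r m u i = (∏ i, r i) * u := by
      rw [prod_update_of_mem (mem_univ m), ← mul_prod_erase univ r (mem_univ m), hm, one_mul, mul_comm, sdiff_singleton_eq_erase]
    have e2 : ∏ i, g (Function.update r m u i) = (∏ i, g (r i)) * g u := by
      rw [← mul_prod_erase univ _ (mem_univ m), ← mul_prod_erase univ (fun i => g (r i)) (mem_univ m), hm, h1, one_mul, mul_comm, Function.update_self]
      congr 1
      exact prod_congr rfl fun i hi => by rw [Function.update_of_ne (ne_of_mem_erase hi)]
    have e3 : yy p g R (cf p (Function.update r m u)) = (∏ i, g (r i)) * g u := by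
      unfold yy
      rw [← nm_rr, rr_cf hp hinj hG, e1, e2, if_pos ((Nat.mul_le_mul_left _ hu4.2).trans hR)]
    have e4 : ∏ t, A4 m (p t : ℝ) (cf p r t) (cf p (Function.update r m u) t) =1 / u := by
      have hgm := congrFun (rr_cf hp hinj hG) m
      rw [Function.update_self] at hgm
      conv_rhs => rw [← hgm]
      unfold rr
      push_cast
      rw [one_div, ← prod_inv_distrib]
      refine prod_congr rfl fun t _ => ?_
      split_ifs with hd
      · have hdu := (cf_some hG t m).1 hd
        rw [Function.update_self] at hdu
        rw [hd, cf_none t (hu3 t hdu)]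
        simp [A4, A3, sg]
      · have : cf p (Function.update r m u) t = cf p r t := by
          apply Option.ext
          intro i
          rw [cf_some hG, cf_some h]
          by_cases him : i = m
          · subst him
            rw [cf_some hG] at hd
            refine iff_of_false hd ?_
            rw [hm]; exact fun h => (hp t).one_lt.ne' (Nat.dvd_one.1 h)
          · rw [Function.update_of_ne him]
        rw [this]
        cases cf p r t <;> simp [A4, A3, sg]
    rw [e3, e4]; ring
  calc _ ≤ (∏ i, g (r i)) * ∑ u ∈ U, g u / u := mul_le_mul_of_nonneg_left hU (prod_nonneg fun _ _ => h0 _)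
    _ = ∑ u ∈ U, (∏ t, A4 m (p t) (cf p r t) (cf p (Function.update r m u) t)) * yy p g R (cf p (Function.update r m u)) := by
        rw [mul_sum]; exact sum_congr rfl hc
    _ = ∑ c ∈ U.image fun u => cf p (Function.update r m u), (∏ t, A4 m (p t) (cf p r t) (c t)) * yy p g R c := by
        rw [sum_image]
        intro u hu v hv huv
        have h3 := rr_cf hp hinj (hUG u hu)
        simp only at huv
        rw [huv, rr_cf hp hinj (hUG v hv)] at h3
        have h4 := congrFun h3 m
        rw [Function.update_self, Function.update_self] at h4
        exact h4.symm
    _ ≤ _ := sum_le_sum_of_subset_of_nonneg (subset_univ _) fun c _ _ =>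
        mul_nonneg (prod_nonneg fun t _ => A4_nonneg m (by positivity) _ _) (yy_nonneg h0 _ _ _)

theorem term_ge {p : Fin n → ℕ} (hp : ∀ i, (p i).Prime) (hinj : Function.Injective p) (hpk : ∀ i, 2 * k ≤ p i) {W z R : ℕ} (hS : ∀ q, q.Prime → q ≤ z → q.Coprime W → ∃ t, p t = q)
    {g : ℕ → ℝ} (h0 : ∀ u, 0 ≤ g u) (h1 : g 1 =1) (ha : ∀ u v, 1 ≤ u → u ≤ v → g v ≤ g u)
    {ε : ℝ} (hε0 :0 ≤ ε) (hε : ∑ t, 1 / (p t : ℝ) ^2 ≤ ε) {r : Fin k → ℕ} (h : GT p r) {m : Fin k} (hm : r m =1) (hR : (∏ i, r i) * z ≤ R)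
    (hP :0 ≤ ∏ t, P3 m (p t : ℝ) (cf p r t)) :
    (∑ u ∈ II W z, g u / u) ^2 * ((∏ i, g (r i) ^2 / r i) * (1 -3 * ε - (2 * k +2) * wW p r)) ≤
      (∏ t, P3 m (p t : ℝ) (cf p r t)) * (∑ c, (∏ t, A3 m (p t) (cf p r t) (c t)) * cof p g R c) ^2 := by
  have hw := wW_nonneg p r
  rw [A3_A4]
  have a1 := inner_ge hp hinj hS h0 h1 ha hε h hm hR
  have a2 := P3_ge hp hinj hpk hε h hm
  have hk : (0:ℝ) ≤ k := by positivity
  have hkw :0 ≤ k * wW p r := by positivity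
  set G1 := ∑ u ∈ II W z, g u / u with hG1
  have hG0 :0 ≤ G1 := sum_nonneg fun u _ => div_nonneg (h0 _) (by positivity)
  have hg0 :0 ≤ ∏ i, g (r i) := prod_nonneg fun _ _ => h0 _
  have hPi :0 ≤ ∏ i, g (r i) ^2 / (r i:ℝ) := prod_nonneg fun _ _ => by positivity
  rcases lt_or_ge (1 - ε - wW p r) 0 with hn | hn
  · refine le_trans (mul_nonpos_of_nonneg_of_nonpos (by positivity) (mul_nonpos_of_nonneg_of_nonpos hPi ?_)) (mul_nonneg hP (sq_nonneg _))
    linarith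
  rcases lt_or_ge (1 - ε -2 * k * wW p r) 0 with hn2 | hn2
  · refine le_trans (mul_nonpos_of_nonneg_of_nonpos (by positivity) (mul_nonpos_of_nonneg_of_nonpos hPi ?_)) (mul_nonneg hP (sq_nonneg _))
    linarith
  calc _ ≤ (1 / (∏ i, (r i : ℝ)) * (1 - ε -2 * k * wW p r)) * ((∏ i, g (r i)) * (G1 * (1 - ε - wW p r))) ^2 := by
        rw [prod_div_distrib, prod_pow]
        have : (1 -3 * ε - (2 * k +2) * wW p r) ≤ (1 - ε -2 * k * wW p r) * (1 - ε - wW p r) ^2 := by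
          nlinarith [mul_nonneg hn2 (sq_nonneg (ε + wW p r)), mul_nonneg (add_nonneg hε0 (mul_nonneg (mul_nonneg zero_le_two hk) hw)) (add_nonneg hε0 hw)]
        have h5 := mul_le_mul_of_nonneg_left this (show 0 ≤ G1 ^2 * ((∏ i, g (r i)) ^2 / (∏ i, (r i : ℝ))) by positivity)
        calc _ = _ := by ring
          _ ≤ _ := h5
          _ = _ := by ring
    _ ≤ _ := mul_le_mul a2 (pow_le_pow_left₀ (by positivity) a1 2) (sq_nonneg _) hP
end

section
variable {k n : ℕ}

theorem tup1 (Im : Fin k → Finset ℕ) (F : ℕ → ℝ) (hF : ∀ u, 0 ≤ F u) (i : Fin k) (φ : ℕ → ℝ) (a : ℝ)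
    (h : ∑ u ∈ Im i, F u * φ u ≤ a * ∑ u ∈ Im i, F u) :
    ∑ r ∈ Fintype.piFinset Im, (∏ j, F (r j)) * φ (r i) ≤ a * ∏ j, ∑ u ∈ Im j, F u := by
  have e : ∀ r : Fin k → ℕ, (∏ j, F (r j)) * φ (r i) = ∏ j, (F (r j) * if j = i then φ (r j) else 1) := fun r => by
    rw [prod_mul_distrib, prod_ite_eq' univ i]; simp
  simp only [e]
  rw [← prod_univ_sum Im (fun j u => F u * if j = i then φ u else 1)]
  rw [← mul_prod_erase univ _ (mem_univ i), ← mul_prod_erase univ (fun j => ∑ u ∈ Im j, F u) (mem_univ i), ← mul_assoc]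
  simp only [if_true]
  rw [prod_congr rfl fun j hj => sum_congr rfl fun u _ => by rw [if_neg (ne_of_mem_erase hj), mul_one]]
  exact mul_le_mul_of_nonneg_right h (prod_nonneg fun _ _ => sum_nonneg fun _ _ => hF _)

theorem tup2 (Im : Fin k → Finset ℕ) (F : ℕ → ℝ) (hF : ∀ u, 0 ≤ F u) {i j : Fin k} (hij : i ≠ j) (φ : ℕ → ℝ) (hφ : ∀ u, 0 ≤ φ u) (a : ℝ)
    (h : ∀ i, ∑ u ∈ Im i, F u * φ u ≤ a * ∑ u ∈ Im i, F u) :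
    ∑ r ∈ Fintype.piFinset Im, (∏ j, F (r j)) * (φ (r i) * φ (r j)) ≤ a ^2 * ∏ j, ∑ u ∈ Im j, F u := by
  have e : ∀ r : Fin k → ℕ, (∏ j, F (r j)) * (φ (r i) * φ (r j)) = ∏ l, ((F (r l) * if l = i then φ (r l) else 1) * if l = j then φ (r l) else 1) := fun r => by
    rw [prod_mul_distrib, prod_mul_distrib, prod_ite_eq' univ i, prod_ite_eq' univ j]; simp [mul_assoc]
  simp only [e]
  rw [← prod_univ_sum Im (fun l u => (F u * if l = i then φ u else 1) * if l = j then φ u else 1)]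
  have e2 : a ^2 * ∏ j, ∑ u ∈ Im j, F u = ∏ l, (((if l = i then a else 1) * (if l = j then a else 1)) * ∑ u ∈ Im l, F u) := by
    rw [prod_mul_distrib, prod_mul_distrib, prod_ite_eq' univ i, prod_ite_eq' univ j]; simp [sq]
  rw [e2]
  refine prod_le_prod (fun l _ => sum_nonneg fun u _ => mul_nonneg (mul_nonneg (hF u) ?_) ?_) fun l _ => ?_
  · split_ifs <;> [exact hφ u; exact zero_le_one]
  · split_ifs <;> [exact hφ u; exact zero_le_one]
  · by_cases h1 : l = i
    · have h2 : l ≠ j := h1 ▸ hij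
      simpa [h1, h2, hij] using h i
    · by_cases h2 : l = j
      · simpa [h1, h2, hij.symm] using h j
      · simp [h1, h2]

theorem P3_nonneg (m : Fin k) {p : ℝ} (hp :1 ≤ p) (hk :2 * k ≤ p) (x : Option (Fin k)) :0 ≤ P3 m p x := by
  have :2 * k / p ≤1 := by rw [div_le_one (by linarith)]; exact hk
  cases x with
  | none =>
    simp only [P3]
    have :1 / p ^2 ≤1 := by rw [div_le_one (by positivity)]; nlinarith
    linarith
  | some i =>
    simp only [P3]
    split_ifs
    · rfl
    · exact mul_nonneg (by positivity) (by linarith)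

theorem opt_low {p : Fin n → ℕ} (hp : ∀ i, (p i).Prime) (hinj : Function.Injective p) (hpk : ∀ i, 2 * k ≤ p i) {W z R : ℕ} (hS : ∀ q, q.Prime → q ≤ z → q.Coprime W → ∃ t, p t = q)
    {g : ℕ → ℝ} (h0 : ∀ u, 0 ≤ g u) (h1 : g 1 =1) (ha : ∀ u v, 1 ≤ u → u ≤ v → g v ≤ g u)
    {ε : ℝ} (hε : ∑ t, 1 / (p t : ℝ) ^2 ≤ ε) (hε9 :9 * k ^2 * ε ≤1 /4) (hz1 :1 ≤ z) (hzR : z < R)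
    (hZ : k * ∑ u ∈ II W z, g u ^2 / u * log u ≤1 /4 * log (R / z) * ∑ u ∈ II W z, g u ^2 / u) (m : Fin k) :
    1 /2 * (∑ u ∈ II W z, g u / u) ^2 * (∑ u ∈ II W z, g u ^2 / u) ^ (k -1) ≤
      ∑ x : Fin n → Option (Fin k), (∏ t, P3 m (p t : ℝ) (x t)) * (∑ c, (∏ t, A3 m (p t) (x t) (c t)) * cof p g R c) ^2 := by
  classical
  set G1 := ∑ u ∈ II W z, g u / u with hG1
  set G2 := ∑ u ∈ II W z, g u ^2 / u with hG2
  let F : ℕ → ℝ := fun u => g u ^2 / u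
  have hF : ∀ u, 0 ≤ F u := fun u => by simp only [F]; positivity
  let Im : Fin k → Finset ℕ := fun i => if i = m then {1} else II W z
  have hIm : ∀ i, Im i ⊆ II W z := fun i => by
    simp only [Im]; split_ifs
    · simp [II, hz1]
    · rfl
  have hF1 : F 1 =1 := by simp [F, h1]
  have hG2p :1 ≤ G2 := by
    have := single_le_sum (f := F) (fun u (_ : u ∈ II W z) => hF u) (show 1 ∈ II W z by simp [II, hz1])
    rwa [hF1] at this
  set T := ∏ j, ∑ u ∈ Im j, F u with hT
  have hTG : T = G2 ^ (k -1) := by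
    rw [hT, ← mul_prod_erase univ _ (mem_univ m)]
    simp only [Im, if_true, sum_singleton, hF1, one_mul]
    rw [prod_congr rfl fun j hj => by rw [if_neg (ne_of_mem_erase hj)]]
    simp [hG2, F, card_erase_of_mem]
  have hT0 :0 < T := by rw [hTG]; positivity
  have hk1 : (1:ℝ) ≤ k := by exact_mod_cast m.pos
  have hε0 :0 ≤ ε := le_trans (sum_nonneg fun t _ => by positivity) hε
  have hL :0 < log (R / z) := Real.log_pos (by rw [one_lt_div (by exact_mod_cast hz1)]; exact_mod_cast hzR)
  set L := log (R / z) with hLdef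
  have hI1 : ∀ i, ∀ u ∈ Im i, 1 ≤ u := fun i u hu => (mem_Icc.1 (mem_filter.1 (hIm i hu)).1).1
  have dv : ∀ q : ℕ, 1 < q → ∀ i, ∑ u ∈ Im i, F u * (if q ∣ u then 1 else 0) ≤1 / q * ∑ u ∈ Im i, F u := fun q hq i => by
    simp only [Im]; split_ifs with him
    · rw [sum_singleton, sum_singleton, if_neg (by rw [Nat.dvd_one]; omega), hF1, mul_zero]; positivity
    · exact dvd_sum hq.le (fun u => sq_nonneg _) fun u v hu huv => pow_le_pow_left₀ (h0 _) (ha u v hu huv) 2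
  have B1 : ∀ t i, ∑ r ∈ Fintype.piFinset Im, (∏ j, F (r j)) * (if p t ^2 ∣ r i then 1 else 0) ≤1 / (p t : ℝ) ^2 * T := fun t i => by
    refine tup1 Im F hF i (fun u => if p t ^2 ∣ u then 1 else 0) _ ?_
    have := dv (p t ^2) (Nat.one_lt_pow two_ne_zero (hp t).one_lt) i
    push_cast at this; exact this
  have B2 : ∀ t i j, ∑ r ∈ Fintype.piFinset Im, (∏ j, F (r j)) * (if i ≠ j ∧ p t ∣ r i ∧ p t ∣ r j then 1 else 0) ≤1 / (p t : ℝ) ^2 * T := fun t i j => by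
    by_cases hij : i = j
    · simp only [hij, ne_eq, not_true, false_and, if_false, mul_zero, sum_const_zero]; positivity
    have := tup2 Im F hF hij (fun u => if p t ∣ u then 1 else 0) (fun u => by positivity) _ (dv (p t) (hp t).one_lt)
    rw [one_div, inv_pow, ← one_div] at this
    refine le_trans (le_of_eq ?_) this
    refine sum_congr rfl fun r _ => ?_
    congr 1
    by_cases a1 : p t ∣ r i <;> by_cases a2 : p t ∣ r j <;> simp [a1, a2, hij]
  have B3 : ∀ t i, ∑ r ∈ Fintype.piFinset Im, (∏ j, F (r j)) * (if p t ∣ r i then 1 / (p t : ℝ) else 0) ≤1 / (p t : ℝ) ^2 * T := fun t i => by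
    have := tup1 Im F hF i (fun u => if p t ∣ u then 1 else 0) _ (dv (p t) (hp t).one_lt i)
    have h2 := mul_le_mul_of_nonneg_left this (show (0:ℝ) ≤1 / p t by positivity)
    rw [mul_sum] at h2
    calc _ = _ := sum_congr rfl fun r _ => by split_ifs <;> ring
      _ ≤ _ := h2
      _ = _ := by rw [← hT]; ring
  have B4 : ∀ i, ∑ r ∈ Fintype.piFinset Im, (∏ j, F (r j)) * log (r i) ≤ L / (4 * k) * T := fun i => by
    refine tup1 Im F hF i (fun u => log u) _ ?_
    simp only [Im]; split_ifs with him
    · simp [hF1]; positivity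
    · rw [div_mul_eq_mul_div, le_div_iff₀ (by positivity)]
      change (∑ u ∈ II W z, g u ^2 / u * log u) * _ ≤ L * G2
      linarith
  let Bd : (Fin k → ℕ) → ℝ := fun r => ∑ t, (∑ i, (if p t ^2 ∣ r i then (1:ℝ) else 0) + ∑ i, ∑ j, (if i ≠ j ∧ p t ∣ r i ∧ p t ∣ r j then (1:ℝ) else 0))
  let Zd : (Fin k → ℕ) → ℝ := fun r => (∑ i, log (r i)) / L
  have main : T /2 ≤ ∑ r ∈ Fintype.piFinset Im, (∏ j, F (r j)) * (1 -3 * ε - (2 * k +2) * wW p r - Bd r - Zd r) := by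
    have e0 : ∑ r ∈ Fintype.piFinset Im, ∏ j, F (r j) = T := by rw [hT, prod_univ_sum]
    have e1 : ∑ r ∈ Fintype.piFinset Im, (∏ j, F (r j)) * wW p r ≤ k * ε * T := by
      unfold wW
      simp only [mul_sum]
      rw [sum_comm]
      simp only [sum_comm (s := Fintype.piFinset Im)]
      calc _ ≤ ∑ t, ∑ i : Fin k, 1 / (p t : ℝ) ^2 * T := sum_le_sum fun t _ => sum_le_sum fun i _ => B3 t i
        _ = k * (∑ t, 1 / (p t : ℝ) ^2) * T := by simp [← sum_mul, ← mul_sum]; ring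
        _ ≤ _ := by gcongr
    have e2 : ∑ r ∈ Fintype.piFinset Im, (∏ j, F (r j)) * Bd r ≤ (k + k ^2) * ε * T := by
      simp only [Bd, mul_sum, mul_add, sum_add_distrib]
      rw [sum_comm, sum_comm (s := Fintype.piFinset Im)]
      simp only [sum_comm (s := Fintype.piFinset Im)]
      calc _ ≤ ∑ t, ∑ i : Fin k, 1 / (p t : ℝ) ^2 * T + ∑ t, ∑ i : Fin k, ∑ j : Fin k, 1 / (p t : ℝ) ^2 * T :=
            add_le_add (sum_le_sum fun t _ => sum_le_sum fun i _ => B1 t i) (sum_le_sum fun t _ => sum_le_sum fun i _ => sum_le_sum fun j _ => B2 t i j)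
        _ = (k + k ^2) * (∑ t, 1 / (p t : ℝ) ^2) * T := by simp [← sum_mul, ← mul_sum]; ring
        _ ≤ _ := by gcongr
    have e3 : ∑ r ∈ Fintype.piFinset Im, (∏ j, F (r j)) * Zd r ≤1 /4 * T := by
      simp only [Zd, ← mul_div_assoc]
      rw [← sum_div, div_le_iff₀ hL]
      simp only [mul_sum]
      rw [sum_comm]
      calc _ ≤ ∑ i : Fin k, L / (4 * k) * T := sum_le_sum fun i _ => B4 i
        _ = _ := by simp; field_simp
    have e4 : ∑ r ∈ Fintype.piFinset Im, (∏ j, F (r j)) * (1 -3 * ε - (2 * k +2) * wW p r - Bd r - Zd r) =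
        (1 -3 * ε) * ∑ r ∈ Fintype.piFinset Im, ∏ j, F (r j) - (2 * k +2) * ∑ r ∈ Fintype.piFinset Im, (∏ j, F (r j)) * wW p r
        - ∑ r ∈ Fintype.piFinset Im, (∏ j, F (r j)) * Bd r - ∑ r ∈ Fintype.piFinset Im, (∏ j, F (r j)) * Zd r := by
      rw [mul_sum, mul_sum, ← sum_sub_distrib, ← sum_sub_distrib, ← sum_sub_distrib]
      exact sum_congr rfl fun r _ => by ring
    rw [e4, e0]
    have e5 : (2 * k +2) * ∑ r ∈ Fintype.piFinset Im, (∏ j, F (r j)) * wW p r ≤ (2 * k +2) * (k * ε * T) := by gcongr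
    have e6 : (3 + (2 * k +2) * k + (k + k ^2)) * ε ≤1 /4 := le_trans (mul_le_mul_of_nonneg_right (by nlinarith) hε0) hε9
    have e7 := mul_le_mul_of_nonneg_right e6 hT0.le
    linarith
  let Gd := (Fintype.piFinset Im).filter fun r => GT p r ∧ (∏ i, r i) * z ≤ R
  have hP3 : ∀ x : Fin n → Option (Fin k), 0 ≤ ∏ t, P3 m (p t : ℝ) (x t) := fun x => prod_nonneg fun t _ =>
    P3_nonneg m (by exact_mod_cast (hp t).one_lt.le) (by exact_mod_cast hpk t) _
  calc _ = G1 ^2 * (T /2) := by rw [hTG]; ring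
    _ ≤ G1 ^2 * ∑ r ∈ Gd, (∏ j, F (r j)) * (1 -3 * ε - (2 * k +2) * wW p r) := by
        refine mul_le_mul_of_nonneg_left (main.trans ?_) (sq_nonneg _)
        rw [sum_filter]
        refine sum_le_sum fun r hr => ?_
        have hr' := Fintype.mem_piFinset.1 hr
        have hPi :0 ≤ ∏ j, F (r j) := prod_nonneg fun _ _ => hF _
        have hw := wW_nonneg p r
        have n1 : ∀ t i, (0:ℝ) ≤ if p t ^2 ∣ r i then (1:ℝ) else 0 := fun t i => by positivity
        have n2 : ∀ t i j, (0:ℝ) ≤ if i ≠ j ∧ p t ∣ r i ∧ p t ∣ r j then (1:ℝ) else 0 := fun t i j => by positivity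
        have n3 : ∀ t, (0:ℝ) ≤ (∑ i, (if p t ^2 ∣ r i then (1:ℝ) else 0) + ∑ i, ∑ j, (if i ≠ j ∧ p t ∣ r i ∧ p t ∣ r j then (1:ℝ) else 0)) :=
          fun t => add_nonneg (sum_nonneg fun i _ => n1 t i) (sum_nonneg fun i _ => sum_nonneg fun j _ => n2 t i j)
        have hB0 :0 ≤ Bd r := sum_nonneg fun t _ => n3 t
        have hZ0 :0 ≤ Zd r := div_nonneg (sum_nonneg fun i _ => Real.log_natCast_nonneg _) hL.le
        have hkw :0 ≤ (2 * k +2) * wW p r := by positivity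
        split_ifs with hg
        · exact mul_le_mul_of_nonneg_left (by linarith) hPi
        refine mul_nonpos_of_nonneg_of_nonpos hPi ?_
        rw [not_and_or] at hg
        suffices 1 ≤ Bd r ∨ 1 ≤ Zd r by rcases this with h | h <;> linarith
        rcases hg with hg | hg
        · left
          by_contra hB
          apply hg
          refine ⟨fun i => by have := hI1 i _ (hr' i); omega, fun t i ht => hB ?_, fun t i j hij h1 h2 => hB ?_, fun i q hq hqr => ?_⟩
          · have a1 := single_le_sum (fun t (_ : t ∈ univ) => n3 t) (mem_univ t)
            have a2 := single_le_sum (fun i (_ : i ∈ univ) => n1 t i) (mem_univ i)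
            have a3 := sum_nonneg fun i (_ : i ∈ univ) => sum_nonneg fun j (_ : j ∈ univ) => n2 t i j
            rw [if_pos ht] at a2
            exact le_trans (by linarith) a1
          · have a1 := single_le_sum (fun t (_ : t ∈ univ) => n3 t) (mem_univ t)
            have a2 := single_le_sum (fun i (_ : i ∈ univ) => sum_nonneg fun j (_ : j ∈ univ) => n2 t i j) (mem_univ i)
            have a4 := single_le_sum (fun j (_ : j ∈ univ) => n2 t i j) (mem_univ j)
            have a3 := sum_nonneg fun i (_ : i ∈ univ) => n1 t i
            rw [if_pos ⟨hij, h1, h2⟩] at a4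
            exact le_trans (by linarith) a1
          · obtain ⟨a1, a2⟩ := mem_filter.1 (hIm i (hr' i))
            rw [mem_Icc] at a1
            exact hS q hq ((Nat.le_of_dvd a1.1 hqr).trans a1.2) (Nat.Coprime.coprime_dvd_left hqr a2)
        · right
          simp only [Zd]
          rw [le_div_iff₀ hL, one_mul, ← Real.log_prod (fun i _ => by have := hI1 i _ (hr' i); positivity), hLdef]
          have hz0 : (0:ℝ) < z := by exact_mod_cast hz1
          refine Real.log_le_log (div_pos (by exact_mod_cast (by omega :0 < R)) hz0) ?_
          rw [div_le_iff₀ hz0]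
          exact_mod_cast (not_le.1 hg).le
    _ ≤ ∑ r ∈ Gd, (∏ t, P3 m (p t : ℝ) (cf p r t)) * (∑ c, (∏ t, A3 m (p t) (cf p r t) (c t)) * cof p g R c) ^2 := by
        rw [mul_sum]
        refine sum_le_sum fun r hr => ?_
        obtain ⟨b1, b2, b3⟩ := mem_filter.1 hr
        have hrm : r m =1 := by
          have := Fintype.mem_piFinset.1 b1 m
          simpa [Im] using this
        exact term_ge hp hinj hpk hS h0 h1 ha hε0 hε b2 hrm b3 (hP3 _)
    _ = ∑ x ∈ Gd.image (cf p), (∏ t, P3 m (p t : ℝ) (x t)) * (∑ c, (∏ t, A3 m (p t) (x t) (c t)) * cof p g R c) ^2 := by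
        rw [sum_image]
        intro r hr s hs hrs
        rw [← rr_cf hp hinj (mem_filter.1 (mem_coe.1 hr)).2.1, hrs, rr_cf hp hinj (mem_filter.1 (mem_coe.1 hs)).2.1]
    _ ≤ _ := sum_le_sum_of_subset_of_nonneg (subset_univ _) fun x _ _ => mul_nonneg (hP3 x) (sq_nonneg _)
end

section
theorem H_bd {W z : ℕ} (hW :1 ≤ W) {t : ℝ} (ht :0 ≤ t) (hz : t < log (z +1)) :
    |∑ u ∈ II W z, (1 / u : ℝ) * (if log u ≤ t then 1 else 0) - (W.totient / W : ℝ) * t| ≤ W +1 := by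
  have : NeZero W := ⟨by omega⟩
  set ρ : ℝ := W.totient / W with hρ
  have hW0 : (0:ℝ) < W := by exact_mod_cast hW
  have hρ0 :0 ≤ ρ := by positivity
  have hρ1 : ρ ≤1 := by rw [hρ, div_le_one hW0]; exact_mod_cast Nat.totient_le W
  set y := ⌊Real.exp t⌋₊ with hy
  have hy1 :1 ≤ y := Nat.le_floor (by simpa using ht)
  have hyz : y ≤ z := by
    have : Real.exp t < z +1 := by
      rw [← Real.exp_log (show (0:ℝ) < z +1 by positivity)]; exact Real.exp_lt_exp.2 hz
    have h2 := Nat.floor_le (Real.exp_pos t).le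
    have h3 : (y:ℝ) < ((z +1 : ℕ) : ℝ) := by push_cast; linarith
    have := Nat.cast_lt.1 h3
    omega
  classical
  let f : ZMod W → ℝ := fun x => (if IsUnit x then 1 else 0) - ρ
  have hf0 : ∑ x, f x =0 := by
    simp only [f]
    rw [sum_sub_distrib, sum_boole, sum_const, card_univ, ZMod.card]
    have : ((univ.filter fun x : ZMod W => IsUnit x).card : ℝ) = W.totient := by
      rw [← ZMod.card_units_eq_totient, ← Fintype.card_subtype]
      congr 1
      exact Fintype.card_congr Submonoid.unitsTypeEquivIsUnitSubmonoid.symm.toEquiv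
    rw [this, nsmul_eq_mul, hρ]; field_simp; ring
  have hf1 : ∀ x, ‖f x‖ ≤1 := fun x => by
    simp only [f, Real.norm_eq_abs]; split_ifs
    · rw [abs_le]; constructor <;> linarith
    · rw [abs_le]; constructor <;> linarith
  have hA := abel_mono (fun i => f (i : ZMod W)) (fun i => 1 / (i:ℝ)) (W *1) 1 (fun m => per_sum f hf0 1 hf1 1 m)
    (fun i hi => by
      have : (0:ℝ) < i := by exact_mod_cast hi
      push_cast
      exact one_div_le_one_div_of_le this (by linarith)) (fun i _ => by positivity) (y +1)
  have e1 : ∑ u ∈ II W z, (1 / u : ℝ) * (if log u ≤ t then 1 else 0) = ∑ i ∈ Ico 1 (y +1), 1 / (i:ℝ) * (if IsUnit (i : ZMod W) then 1 else 0) := by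
    simp only [mul_ite, mul_one, mul_zero]
    rw [← sum_filter, ← sum_filter, II, filter_filter]
    refine sum_congr ?_ fun _ _ => rfl
    ext u
    simp only [mem_filter, mem_Icc, mem_Ico, ZMod.isUnit_iff_coprime]
    constructor
    · rintro ⟨⟨h1, h2⟩, h3, h4⟩
      refine ⟨⟨h1, Nat.lt_succ_of_le (Nat.le_floor ?_)⟩, h3⟩
      rwa [Real.log_le_iff_le_exp (by exact_mod_cast h1)] at h4
    · rintro ⟨⟨h1, h2⟩, h3⟩
      refine ⟨⟨h1, by omega⟩, h3, ?_⟩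
      rw [Real.log_le_iff_le_exp (by exact_mod_cast h1)]
      exact (Nat.le_floor_iff (Real.exp_pos t).le).1 (by omega)
  have e2 : ∑ i ∈ Ico 1 (y +1), 1 / (i:ℝ) = harmonic y := by
    rw [harmonic, sum_Ico_eq_sum_range]
    push_cast
    exact sum_congr (by simp) fun i _ => by rw [add_comm, one_div]
  have e3 : ∑ i ∈ Ico 1 (y +1), (1 / (i:ℝ)) • f (i : ZMod W) = ∑ u ∈ II W z, (1 / u : ℝ) * (if log u ≤ t then 1 else 0) - ρ * harmonic y := by
    rw [e1, ← e2, mul_sum, ← sum_sub_distrib]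
    exact sum_congr rfl fun i _ => by simp only [f, smul_eq_mul]; ring
  rw [e3, Real.norm_eq_abs] at hA
  have b1 := log_add_one_le_harmonic y
  have b2 := harmonic_le_one_add_log y
  have b3 : log y ≤ t := by
    rw [Real.log_le_iff_le_exp (by exact_mod_cast hy1)]; exact Nat.floor_le (Real.exp_pos t).le
  have b4 : t ≤ log ((y +1 : ℕ) : ℝ) := by
    rw [Real.le_log_iff_exp_le (by positivity)]; push_cast; exact (Nat.lt_floor_add_one _).le
  rw [abs_le] at hA ⊢
  have c1 : ρ * t ≤ ρ * harmonic y := mul_le_mul_of_nonneg_left (b4.trans b1) hρ0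
  have c2 : ρ * harmonic y ≤ ρ * (1 + t) := mul_le_mul_of_nonneg_left (by linarith) hρ0
  have c3 : (1:ℝ) / (1:ℕ) =1 := by norm_num
  simp only [c3] at hA
  constructor <;> nlinarith

noncomputable def ff : ℕ → ℝ → ℝ → ℝ
  | 0, b, L => if L ≤ b then 1 else 0
  | J +1, b, L => 1 /2 * (if L ≤ b then 1 else 0) +1 /2 * ff J (2 * b) L

theorem ff_01 (J : ℕ) (b L : ℝ) :0 ≤ ff J b L ∧ ff J b L ≤1 := by
  induction J generalizing b with
  | zero => simp only [ff]; split_ifs <;> norm_num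
  | succ J ih =>
    obtain ⟨h1, h2⟩ := ih (2 * b)
    simp only [ff]; split_ifs <;> constructor <;> linarith

theorem ff_one (J : ℕ) {b L : ℝ} (hb :0 ≤ b) (h : L ≤ b) : ff J b L =1 := by
  induction J generalizing b with
  | zero => simp only [ff, h, if_true]
  | succ J ih => simp only [ff, h, if_true, ih (show 0 ≤2 * b by linarith) (by linarith)]; norm_num

theorem ff_anti (J : ℕ) (b : ℝ) {L L' : ℝ} (h : L ≤ L') : ff J b L' ≤ ff J b L := by
  induction J generalizing b with
  | zero => simp only [ff]; split_ifs <;> (try norm_num); linarith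
  | succ J ih =>
    have := ih (2 * b)
    simp only [ff]; split_ifs <;> linarith

theorem ff_zero (J : ℕ) {b L : ℝ} (hb :0 ≤ b) (h :2 ^ J * b < L) : ff J b L =0 := by
  induction J generalizing b with
  | zero => simp only [ff]; rw [if_neg]; simpa using h
  | succ J ih =>
    have h1 := ih (show 0 ≤2 * b by linarith) (by rw [pow_succ] at h; linarith)
    simp only [ff, h1]; rw [if_neg]; · norm_num
    have : (1:ℝ) ≤2 ^ (J +1) := one_le_pow₀ (by norm_num)
    nlinarith

theorem ff_log (J : ℕ) {b L : ℝ} (hb :0 ≤ b) : L * ff J b L ≤ b := by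
  induction J generalizing b with
  | zero => simp only [ff]; split_ifs <;> linarith
  | succ J ih =>
    have h1 := ih (show 0 ≤2 * b by linarith)
    by_cases h : L ≤ b
    · rw [ff_one _ hb h]; linarith
    · simp only [ff, h, if_false]; linarith

theorem ff_sq (J : ℕ) (b L : ℝ) : ff (J +1) b L ^2 ≤ (if L ≤ b then 1 else 0) +1 /4 * ff J (2 * b) L ^2 := by
  have h1 := ff_01 (J +1) b L
  have h2 := sq_nonneg (ff J (2 * b) L)
  by_cases h : L ≤ b
  · simp only [h, if_true]; nlinarith
  · simp only [ff, h, if_false]; nlinarith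

theorem G1_bd {W z : ℕ} (hW :1 ≤ W) (J : ℕ) {b : ℝ} (hb :0 ≤ b) (hz :2 ^ J * b < log (z +1)) :
    |∑ u ∈ II W z, ff J b (log u) / u - (W.totient / W : ℝ) * b * (1 + J /2)| ≤ W +1 := by
  induction J generalizing b with
  | zero =>
    have := H_bd (z := z) hW hb (by simpa using hz)
    simpa [ff, div_eq_mul_inv, mul_comm] using this
  | succ J ih =>
    have h1 := ih (show 0 ≤2 * b by linarith) (by rw [pow_succ] at hz; linarith)
    have h2 := H_bd (z := z) hW hb (lt_of_le_of_lt (by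
      have : (1:ℝ) ≤2 ^ (J +1) := one_le_pow₀ (by norm_num)
      nlinarith) hz)
    have e : ∑ u ∈ II W z, ff (J +1) b (log u) / u =1 /2 * ∑ u ∈ II W z, (1 / u : ℝ) * (if log u ≤ b then 1 else 0) +1 /2 * ∑ u ∈ II W z, ff J (2 * b) (log u) / u := by
      rw [mul_sum, mul_sum, ← sum_add_distrib]
      exact sum_congr rfl fun u _ => by simp only [ff]; ring
    rw [e]
    push_cast
    rw [abs_le] at h1 h2 ⊢
    constructor <;> linarith

theorem G2_bd {W z : ℕ} (hW :1 ≤ W) (J : ℕ) {b : ℝ} (hb :0 ≤ b) (hz :2 ^ J * b < log (z +1)) :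
    ∑ u ∈ II W z, ff J b (log u) ^2 / u ≤ (W.totient / W : ℝ) * b *2 +4 /3 * (W +1) := by
  have hρ :0 ≤ (W.totient / W : ℝ) * b := by positivity
  have hW0 : (0:ℝ) ≤ W := by positivity
  induction J generalizing b with
  | zero =>
    have := (abs_le.1 (H_bd (z := z) hW hb (by simpa using hz))).2
    have e : ∑ u ∈ II W z, ff 0 b (log u) ^2 / u = ∑ u ∈ II W z, (1 / u : ℝ) * (if log u ≤ b then 1 else 0) :=
      sum_congr rfl fun u _ => by simp only [ff]; split_ifs <;> simp
    rw [e]; linarith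
  | succ J ih =>
    have h1 := ih (show 0 ≤2 * b by linarith) (by rw [pow_succ] at hz; linarith) (by linarith)
    have h2 := (abs_le.1 (H_bd (z := z) hW hb (lt_of_le_of_lt (by
      have : (1:ℝ) ≤2 ^ (J +1) := one_le_pow₀ (by norm_num)
      nlinarith) hz))).2
    have e : ∑ u ∈ II W z, ff (J +1) b (log u) ^2 / u ≤ ∑ u ∈ II W z, (1 / u : ℝ) * (if log u ≤ b then 1 else 0) +1 /4 * ∑ u ∈ II W z, ff J (2 * b) (log u) ^2 / u := by
      rw [mul_sum, ← sum_add_distrib]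
      refine sum_le_sum fun u _ => ?_
      have := div_le_div_of_nonneg_right (ff_sq J b (log u)) (Nat.cast_nonneg (α := ℝ) u)
      refine this.trans (le_of_eq (by ring))
    linarith

theorem G2_low {W z : ℕ} (hW :1 ≤ W) (J : ℕ) {b : ℝ} (hb :0 ≤ b) (hz :2 ^ J * b < log (z +1)) :
    (W.totient / W : ℝ) * b - (W +1) ≤ ∑ u ∈ II W z, ff J b (log u) ^2 / u := by
  have h2 := (abs_le.1 (H_bd (z := z) hW hb (lt_of_le_of_lt (by
      have : (1:ℝ) ≤2 ^ J := one_le_pow₀ (by norm_num)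
      nlinarith) hz))).1
  refine le_trans (by linarith) (sum_le_sum (f := fun u : ℕ => (1 / u : ℝ) * (if log u ≤ b then 1 else 0)) fun u _ => ?_)
  split_ifs with h
  · rw [ff_one J hb h]; simp
  · rw [mul_zero]; positivity

theorem GL_bd {W z : ℕ} (J : ℕ) {b : ℝ} (hb :0 ≤ b) :
    ∑ u ∈ II W z, ff J b (log u) ^2 / u * log u ≤ b * ∑ u ∈ II W z, ff J b (log u) / u := by
  rw [mul_sum]
  refine sum_le_sum fun u _ => ?_
  have h1 := ff_log J (L := log u) hb
  have h2 :0 ≤ ff J b (log u) / u := div_nonneg (ff_01 _ _ _).1 (by positivity)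
  calc _ = (log u * ff J b (log u)) * (ff J b (log u) / u) := by ring
    _ ≤ _ := mul_le_mul_of_nonneg_right h1 h2
end

section
variable {k n : ℕ}

structure Hy (k : ℕ) (p : Fin n → ℕ) (W : ℕ) : Prop where
  pr : ∀ t, (p t).Prime
  inj : Function.Injective p
  cop : ∀ t, (p t).Coprime W
  big : ∀ t, 36 * k ^2 ≤ p t
  w1 :1 ≤ W

theorem Hy.uq {p : Fin n → ℕ} {W : ℕ} (H : Hy k p W) {x : ℕ} {t : Fin n} {i j : Fin k} (hi : p t ∣ x + i * W) (hj : p t ∣ x + j * W) : i = j := by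
  have h := (Nat.ModEq.add_left_cancel' x (((Nat.modEq_zero_iff_dvd.2 hi).trans (Nat.modEq_zero_iff_dvd.2 hj).symm) : x + i * W ≡ x + j * W [MOD p t]))
  have h2 := Nat.ModEq.cancel_right_of_coprime (H.cop t) h
  have hb := H.big t
  have := i.2; have := j.2
  have hk : k < p t := by nlinarith
  exact Fin.ext (Nat.ModEq.eq_of_lt_of_lt h2 (by omega) (by omega))

open Classical in
noncomputable def XX (k : ℕ) (p : Fin n → ℕ) (W x : ℕ) (t : Fin n) : Option (Fin k) :=
  if h : ∃ i : Fin k, p t ∣ x + i * W then some h.choose else none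

theorem XX_some {p : Fin n → ℕ} {W : ℕ} (H : Hy k p W) (x : ℕ) (t : Fin n) (i : Fin k) : XX k p W x t = some i ↔ p t ∣ x + i * W := by
  unfold XX
  split_ifs with h
  · refine ⟨fun e => ?_, fun e => ?_⟩
    · rw [← Option.some.inj e]; exact h.choose_spec
    · rw [H.uq h.choose_spec e]
  · refine ⟨fun e => by simp at e, fun e => (h ⟨i, e⟩).elim⟩

open Classical in
theorem ONE_XX {p : Fin n → ℕ} {W : ℕ} (H : Hy k p W) (u : Fin n → Option (Fin k)) (x : ℕ) :
    ONE u (XX k p W x) = if ∀ t i, u t = some i → p t ∣ x + i * W then 1 else 0 := by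
  unfold ONE one
  split_ifs with h
  · refine prod_eq_one fun t _ => if_pos ?_
    rcases hu : u t with _ | i
    · simp
    · right; exact (XX_some H x t i).2 (h t i hu)
  · push Not at h
    obtain ⟨t, i, hu, hd⟩ := h
    refine prod_eq_zero (mem_univ t) (if_neg ?_)
    rw [hu, XX_some H]; simp [hd]

theorem nm_cop {p : Fin n → ℕ} {W : ℕ} (H : Hy k p W) (u : Fin n → Option (Fin k)) (s : Finset (Fin n)) :
    (∏ t ∈ s, if u t = none then 1 else p t).Coprime W ∧ ∀ t ∉ s, (p t).Coprime (∏ t ∈ s, if u t = none then 1 else p t) :=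
  ⟨Nat.Coprime.prod_left fun t _ => by
    split_ifs
    exacts [Nat.coprime_one_left W, H.cop t], fun t ht => Nat.Coprime.prod_right fun r hr => by
    split_ifs
    · simp
    · exact (Nat.coprime_primes (H.pr t) (H.pr r)).2 fun e => ht (H.inj e ▸ hr)⟩

theorem crt {p : Fin n → ℕ} {W : ℕ} (H : Hy k p W) (u : Fin n → Option (Fin k)) (s : Finset (Fin n)) :
    (∃ a, ∀ j, (j ≡ 1 [MOD W] ∧ ∀ t ∈ s, ∀ i, u t = some i → p t ∣ j + i * W) ↔ j ≡ a [MOD W * ∏ t ∈ s, if u t = none then 1 else p t]) ∧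
    (((W * ∏ t ∈ s, if u t = none then 1 else p t).totient : ℕ) : ℝ) = W.totient * ∏ t ∈ s, if u t = none then 1 else (p t -1 : ℝ) := by
  induction s using Finset.induction_on with
  | empty => exact ⟨⟨1, fun j => by simp⟩, by simp⟩
  | insert t s ht ih =>
    obtain ⟨⟨a, ha⟩, hφ⟩ := ih
    have hc := (nm_cop H u s).2 t ht
    have hc2 : (W * ∏ t ∈ s, if u t = none then 1 else p t).Coprime (p t) := Nat.Coprime.mul_left (H.cop t).symm hc.symm
    rw [prod_insert ht, prod_insert ht]
    rcases hu : u t with _ | i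
    · refine ⟨⟨a, fun j => ?_⟩, by simpa using hφ⟩
      simp only [if_true, one_mul]
      rw [← ha]
      simp [hu]
    · simp only [reduceCtorEq, if_false]
      rw [mul_left_comm, mul_comm (p t), Nat.totient_mul hc2, Nat.totient_prime (H.pr t)]
      constructor
      · refine ⟨Nat.chineseRemainder hc2 a ((p t -1) * (i * W)), fun j => ?_⟩
        obtain ⟨h1, h2⟩ := (Nat.chineseRemainder hc2 a ((p t -1) * (i * W))).2
        rw [← Nat.modEq_and_modEq_iff_modEq_mul hc2]
        have e1 := ha j
        have e2 : p t ∣ j + i * W ↔ j ≡ (p t -1) * (i * W) [MOD p t] := by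
          have e3 : (p t -1) * (i * W) + i * W ≡ 0 [MOD p t] := by
            have := (H.pr t).one_lt
            rw [← Nat.succ_mul, Nat.succ_eq_add_one, Nat.sub_add_cancel this.le]
            exact Nat.modEq_zero_iff_dvd.2 (dvd_mul_right _ _)
          rw [← Nat.modEq_zero_iff_dvd]
          exact ⟨fun h => Nat.ModEq.add_right_cancel' _ (h.trans e3.symm), fun h => (h.add_right _).trans e3⟩
        constructor
        · rintro ⟨g1, g2⟩
          exact ⟨((ha j).1 ⟨g1, fun r hr => g2 r (mem_insert_of_mem hr)⟩).trans h1.symm, (e2.1 (g2 t (mem_insert_self _ _) i hu)).trans h2.symm⟩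
        · rintro ⟨g1, g2⟩
          obtain ⟨g3, g4⟩ := (ha j).2 (g1.trans h1)
          refine ⟨g3, fun r hr l hl => ?_⟩
          rcases mem_insert.1 hr with rfl | hr
          · rw [hu] at hl; rw [← Option.some.inj hl]; exact e2.2 (g2.trans h2)
          · exact g4 r hr l hl
      · push_cast [(H.pr t).one_lt.le]
        rw [hφ]; ring

theorem nm_or {p : Fin n → ℕ} {W : ℕ} (H : Hy k p W) (d e : Fin n → Option (Fin k)) : nm p (OR d e) ≤ nm p d * nm p e := by
  unfold nm
  rw [← prod_mul_distrib]
  refine prod_le_prod' fun i _ => ?_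
  have := (H.pr i).one_lt
  unfold OR
  rcases d i with _ | a <;> rcases e i with _ | b <;> simp <;> nlinarith

theorem wt_ap {q : ℕ} (hq :1 ≤ q) (N a : ℕ) (hN :1 ≤ N) :
    |∑ j ∈ Icc 1 N, wt N j * (if j ≡ a [MOD q] then 1 else 0) - (∑ j ∈ Icc 1 N, wt N j) / q| ≤ q * log N := by
  have : NeZero q := ⟨by omega⟩
  have hq0 : (0:ℝ) < q := by exact_mod_cast hq
  have hq1 : (1:ℝ) ≤ q := by exact_mod_cast hq
  have h := abel_mono (fun j : ℕ => (if (j : ZMod q) = a then 1 else 0) -1 / (q:ℝ)) (wt N) q 1 (fun m => by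
      have := per_sum (fun x : ZMod q => (if x = a then 1 else 0) -1 / (q:ℝ)) (by
        simp [sum_sub_distrib, ZMod.card, hq0.ne']) 1 (fun x => by
          have :1 / (q:ℝ) ≤1 := by rw [div_le_one hq0]; exact hq1
          have :0 ≤1 / (q:ℝ) := by positivity
          rw [Real.norm_eq_abs, abs_le]; split_ifs <;> constructor <;> linarith) 1 m
      simpa using this) (fun i hi => wt_anti hi (by omega)) (fun i _ => wt_nonneg N i) (N +1)
  rw [wt_eq le_rfl hN, Nat.cast_one, div_one] at h
  rw [Real.norm_eq_abs] at h
  refine le_of_eq_of_le ?_ h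
  congr 1
  have e : Ico 1 (N +1) = Icc 1 N := by ext; simp
  rw [e]
  simp only [smul_eq_mul, mul_sub, sum_sub_distrib, ZMod.natCast_eq_natCast_iff]
  rw [← sum_mul]; ring

theorem S1_thm {p : Fin n → ℕ} {W : ℕ} (H : Hy k p W) (coef : (Fin n → Option (Fin k)) → ℝ) (h1 : ∀ c, |coef c| ≤1) {R : ℕ} (hR : ∀ c, coef c ≠0 → nm p c ≤ R)
    {N : ℕ} (hN :1 ≤ N) :
    |∑ j ∈ (Icc 1 N).filter (fun j => j ≡ 1 [MOD W]), wt N j * fS p coef (XX k p W j) ^2 -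
      (∑ j ∈ Icc 1 N, wt N j) / W * ∑ x : Fin n → Option (Fin k), (∏ i, P1 (p i) (x i)) * fS p coef x ^2| ≤ W * R ^2 * log N * (R * Vk k p ^2) ^2 := by
  have hl :0 ≤ log N := Real.log_natCast_nonneg N
  have hp1 : ∀ i, 1 ≤ p i := fun i => (H.pr i).one_lt.le
  have h := fS_err p coef ((Icc 1 N).filter (fun j => j ≡ 1 [MOD W])) (wt N) (XX k p W) (fun i => P1 (p i)) ((∑ j ∈ Icc 1 N, wt N j) / W)
    (fun u => (∑ D ∈ (W * nm p u).divisors.erase 1, (fun _ => (0:ℝ)) D) / ph p u + W * R ^2 * log N) (fun d e hd he => by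
      obtain ⟨⟨a, ha⟩, -⟩ := crt H (OR d e) univ
      have hq :1 ≤ nm p (OR d e) := Finset.one_le_prod' fun i _ => by split_ifs; exacts [le_rfl, hp1 i]
      have hq2 : nm p (OR d e) ≤ R ^2 := (nm_or H d e).trans (by rw [sq]; exact Nat.mul_le_mul (lam_supp p hp1 coef hR hd) (lam_supp p hp1 coef hR he))
      have key := wt_ap (q := W * nm p (OR d e)) (Nat.mul_pos H.w1 hq) N a hN
      have e1 : ∏ i, ∑ x, P1 (p i : ℝ) x * one (OR d e i) x =1 / nm p (OR d e) := by
        rw [nm]; push_cast; rw [one_div, ← prod_inv_distrib]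
        refine prod_congr rfl fun i _ => ?_
        rcases hu : OR d e i with _ | m
        · simp only [one, true_or, if_true, mul_one, Fintype.sum_option, P1]
          simp; field_simp; ring
        · simp [one, Fintype.sum_option, P1]
      rw [e1]
      have e2 : ∑ j ∈ (Icc 1 N).filter (fun j => j ≡ 1 [MOD W]), wt N j * ONE (OR d e) (XX k p W j) = ∑ j ∈ Icc 1 N, wt N j * (if j ≡ a [MOD W * nm p (OR d e)] then 1 else 0) := by
        rw [sum_filter]
        refine sum_congr rfl fun j _ => ?_
        have := ha j
        simp only [mem_univ, true_implies] at this
        rw [ONE_XX H]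
        have e3 : (j ≡ a [MOD W * nm p (OR d e)]) ↔ _ := this.symm
        simp only [e3]
        split_ifs <;> simp_all
      rw [e2]
      simp only [sum_const_zero, zero_div, zero_add]
      push_cast at key
      rw [div_mul_div_comm, mul_one]
      refine key.trans ?_
      gcongr
      exact_mod_cast hq2)
  refine h.trans ((err_sum p H.pr H.inj H.big coef h1 hR H.w1 (fun _ => 0) (fun _ => le_rfl) _ (by positivity)).trans ?_)
  simp

set_option maxHeartbeats 400000 in
open scoped ArithmeticFunction.vonMangoldt in
theorem S2_thm {p : Fin n → ℕ} {W : ℕ} (H : Hy k p W) (coef : (Fin n → Option (Fin k)) → ℝ) (h1 : ∀ c, |coef c| ≤1) {R : ℕ} (hR : ∀ c, coef c ≠0 → nm p c ≤ R)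
    {N : ℕ} (hN :3 ≤ N) (hWR : W * R ^2 ≤ N) (hkW : k * W ≤ N) (m : Fin k) (J : Finset ℕ)
    (hJ : ∀ v, v ∈ J ↔ (1 ≤ v ∧ v ≤ N) ∧ v ≡ 1 [MOD W] ∧ m * W < v ∧ ∀ t, ¬ p t ∣ v) :
    |∑ v ∈ J, Λ v * log (N / v) * fS p coef (XX k p W (v - m * W)) ^2 -
      MN N / W.totient * ∑ x : Fin n → Option (Fin k), (∏ i, P2 m (p i) (x i)) * fS p coef x ^2| ≤
     Vk k p ^2 * (Vk (6 * k) p * W) * ∑ D ∈ Icc 2 (W * R ^2), Sp D N / √D + (k * W * log N ^2 + n * (3 * log N ^3) +9 * log N ^4) * (R * Vk k p ^2) ^2 := by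
  have hl :0 ≤ log N := Real.log_natCast_nonneg N
  have hp1 : ∀ i, 1 ≤ p i := fun i => (H.pr i).one_lt.le
  have hL : ∀ v ∈ Icc 1 N, 0 ≤ Λ v * log (N / v) ∧ Λ v * log (N / v) ≤ log N ^2 := fun v hv => (lam_le (mem_Icc.1 hv).1 (mem_Icc.1 hv).2).symm
  have E := err_sum p H.pr H.inj H.big coef h1 hR H.w1 (fun D => Sp D N) (fun D => Sp_nonneg D N)
    (k * W * log N ^2 + n * (3 * log N ^3) +9 * log N ^4) (by positivity)
  refine le_trans (fS_err p coef J (fun v => Λ v * log (N / v)) (fun v => XX k p W (v - m * W)) (fun i => P2 m (p i)) (MN N / W.totient)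
    (fun u => (∑ D ∈ (W * nm p u).divisors.erase 1, Sp D N) / ph p u + (k * W * log N ^2 + n * (3 * log N ^3) +9 * log N ^4)) fun d e hd he => ?_) E
  set u := OR d e
  have hp2 : ∀ i, (1:ℝ) ≤ p i -1 := fun i => by
    have : (2:ℝ) ≤ p i := by exact_mod_cast (H.pr i).two_le
    linarith
  have hph :1 ≤ ph p u := by
    unfold ph
    refine le_of_eq_of_le (by simp) (prod_le_prod (s := univ) (f := fun _ => (1:ℝ)) (fun _ _ => zero_le_one) fun i _ => ?_)
    split_ifs; exacts [le_rfl, hp2 i]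
  have hS0 :0 ≤ ∑ D ∈ (W * nm p u).divisors.erase 1, Sp D N := sum_nonneg fun D _ => Sp_nonneg D N
  have hE0 :0 ≤ (∑ D ∈ (W * nm p u).divisors.erase 1, Sp D N) / ph p u := div_nonneg hS0 (by linarith)
  by_cases hm : ∃ t, u t = some m
  · obtain ⟨t, ht⟩ := hm
    have e1 : ∏ i, ∑ x, P2 m (p i : ℝ) x * one (u i) x =0 := by
      refine prod_eq_zero (mem_univ t) ?_
      rw [ht]; simp [one, P2]
    rw [e1, sum_eq_zero]
    · simp; positivity
    · intro v hv
      obtain ⟨-, -, h3, h4⟩ := (hJ v).1 hv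
      rw [ONE_XX H, if_neg, mul_zero]
      intro h
      have := h t m ht
      rw [Nat.sub_add_cancel h3.le] at this
      exact h4 t this
  push Not at hm
  obtain ⟨⟨a, ha⟩, hφ⟩ := crt H u univ
  have hq :1 ≤ nm p u := Finset.one_le_prod' fun i _ => by split_ifs; exacts [le_rfl, hp1 i]
  have hq2 : nm p u ≤ R ^2 := (nm_or H d e).trans (by rw [sq]; exact Nat.mul_le_mul (lam_supp p hp1 coef hR hd) (lam_supp p hp1 coef hR he))
  change ∀ j, _ ↔ j ≡ a [MOD W * nm p u] at ha
  change (((W * nm p u).totient : ℕ) : ℝ) = W.totient * ph p u at hφ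
  simp only [mem_univ, true_implies] at ha
  obtain ⟨a1, a2⟩ := (ha a).2 rfl
  have hac : (a + m * W).Coprime (W * nm p u) := by
    refine Nat.Coprime.mul_right ?_ (Nat.Coprime.prod_right fun t _ => ?_)
    · rw [Nat.coprime_add_mul_right_left]
      exact (Nat.ModEq.gcd_eq a1).trans (by simp)
    · rcases hu : u t with _ | i
      · simp
      · simp only [reduceCtorEq, if_false]
        refine ((Nat.Prime.coprime_iff_not_dvd (H.pr t)).2 fun hd => hm t ?_).symm
        rw [hu, H.uq (a2 t i hu) hd]
  have key := ap_thm hN (q := W * nm p u) (Nat.mul_pos H.w1 hq) ((Nat.mul_le_mul_left W hq2).trans hWR) hac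
  have e1 : ∏ i, ∑ x, P2 m (p i : ℝ) x * one (u i) x =1 / ph p u := by
    rw [ph, one_div, ← prod_inv_distrib]
    refine prod_congr rfl fun i _ => ?_
    have := hp2 i
    rcases hu : u i with _ | l
    · simp only [one, true_or, if_true, mul_one, Fintype.sum_option, P2]
      have : ∑ x : Fin k, (if x = m then 0 else 1 / ((p i:ℝ) -1)) = ((k:ℝ) -1) * (1 / ((p i:ℝ) -1)) := by
        have e : ∀ x : Fin k, (if x = m then 0 else 1 / ((p i:ℝ) -1)) =1 / ((p i:ℝ) -1) - if x = m then 1 / ((p i:ℝ) -1) else 0 := fun x => by split_ifs <;> simp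
        simp only [e, sum_sub_distrib]
        simp; ring
      rw [this]; simp; field_simp; ring
    · have : l ≠ m := fun h => hm i (by rw [hu, h])
      simp [one, P2, this]
  rw [e1, div_mul_div_comm, mul_one, ← hφ]
  have hφ1 : ph p u ≤ ((W * nm p u).totient : ℕ) := by
    rw [hφ]
    have : (1:ℝ) ≤ W.totient := by exact_mod_cast Nat.totient_pos.2 H.w1
    nlinarith
  have k1 : (∑ D ∈ (W * nm p u).divisors.erase 1, Sp D N) / ((W * nm p u).totient : ℕ) ≤ (∑ D ∈ (W * nm p u).divisors.erase 1, Sp D N) / ph p u := by gcongr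
  set A := (Icc 1 N).filter (fun v => v ≡ a + m * W [MOD W * nm p u]) with hA
  set K := J.filter (fun v => ∀ t i, u t = some i → p t ∣ v - m * W + i * W) with hK
  have e2 : ∑ v ∈ J, Λ v * log (N / v) * ONE u (XX k p W (v - m * W)) = ∑ v ∈ K, Λ v * log (N / v) := by
    rw [hK, sum_filter]
    refine sum_congr rfl fun v _ => ?_
    rw [ONE_XX H]; split_ifs <;> simp
  have hmod : ∀ v, m * W < v → (v ≡ a + m * W [MOD W * nm p u] ↔ (v ≡ 1 [MOD W] ∧ ∀ t i, u t = some i → p t ∣ v - m * W + i * W)) := by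
    intro v hv
    obtain ⟨w, rfl⟩ := Nat.exists_eq_add_of_le hv.le
    rw [add_comm _ w, Nat.add_sub_cancel]
    have c1 : w + m * W ≡ 1 [MOD W] ↔ w ≡ 1 [MOD W] := by simp [Nat.ModEq]
    rw [c1, ha]
    exact ⟨fun h => Nat.ModEq.add_right_cancel' _ h, fun h => h.add_right _⟩
  have hKA : K ⊆ A := by
    intro v hv
    obtain ⟨hv1, hv2⟩ := mem_filter.1 hv
    obtain ⟨g1, g2, g3, g4⟩ := (hJ v).1 hv1
    exact mem_filter.2 ⟨mem_Icc.2 g1, (hmod v g3).2 ⟨g2, hv2⟩⟩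
  obtain ⟨T, hT⟩ : ∃ T : Finset ℕ, T = univ.image p := ⟨_, rfl⟩
  have hAK : A \ K ⊆ Icc 1 (m * W) ∪ (Icc 1 N).filter (fun v => ∃ q ∈ T, q.Prime ∧ q ∣ v) := by
    intro v hv
    obtain ⟨hv1, hv2⟩ := mem_sdiff.1 hv
    obtain ⟨g1, g2⟩ := mem_filter.1 hv1
    rw [mem_union]
    by_contra hc
    push Not at hc
    obtain ⟨c1, c2⟩ := hc
    have hv3 : m * W < v := by
      have := (mem_Icc.1 g1).1
      rw [mem_Icc] at c1; push Not at c1; exact c1 this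
    have hm' := (hmod v hv3).1 g2
    refine hv2 (mem_filter.2 ⟨(hJ v).2 ⟨mem_Icc.1 g1, hm'.1, hv3, fun t ht => c2 (mem_filter.2 ⟨g1, p t, hT ▸ mem_image_of_mem _ (mem_univ t), H.pr t, ht⟩)⟩, hm'.2⟩)
  have hmk : (m:ℕ) * W ≤ k * W := Nat.mul_le_mul_right _ m.2.le
  have hd1 : ∑ v ∈ A, Λ v * log (N / v) - ∑ v ∈ K, Λ v * log (N / v) ≤ k * W * log N ^2 + n * (3 * log N ^3) := by
    rw [← sum_sdiff hKA, add_sub_cancel_right]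
    have hpos : ∀ v ∈ Icc 1 (m * W) ∪ (Icc 1 N).filter (fun v => ∃ q ∈ T, q.Prime ∧ q ∣ v), 0 ≤ Λ v * log (N / v) := fun v hv => by
      refine (hL v ?_).1
      rcases mem_union.1 hv with h | h
      · rw [mem_Icc] at h ⊢; exact ⟨h.1, h.2.trans (hmk.trans hkW)⟩
      · exact (mem_filter.1 h).1
    refine (sum_le_sum_of_subset_of_nonneg hAK fun v hv _ => hpos v hv).trans ?_
    rw [← union_sdiff_self_eq_union, sum_union disjoint_sdiff]
    refine add_le_add ?_ ?_
    · calc _ ≤ ∑ v ∈ Icc 1 (m * W), log N ^2 := sum_le_sum fun v hv => (hL v (by rw [mem_Icc] at hv ⊢; exact ⟨hv.1, hv.2.trans (hmk.trans hkW)⟩)).2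
        _ ≤ _ := by
          rw [sum_const, nsmul_eq_mul, Nat.card_Icc, Nat.add_sub_cancel]
          gcongr
          exact_mod_cast hmk
    · refine (sum_le_sum_of_subset_of_nonneg sdiff_subset fun v hv _ => hpos v (mem_union_right _ hv)).trans ((pp_bd _ hN).trans ?_)
      gcongr
      exact hT ▸ card_image_le.trans (by simp)
  have hd0 : ∑ v ∈ K, Λ v * log (N / v) ≤ ∑ v ∈ A, Λ v * log (N / v) :=
    sum_le_sum_of_subset_of_nonneg hKA fun v hv _ => (hL v (mem_filter.1 hv).1).1
  rw [e2]
  rw [abs_le] at key ⊢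
  constructor <;> linarith [key.1, key.2]
end

section
variable {k n : ℕ}

theorem Vk_bd {p : Fin n → ℕ} {W : ℕ} (H : Hy k p W) {R : ℕ} (hR : ∀ t, p t ≤ R) (hL :1 ≤ log R) (c : ℕ) : Vk c p ≤ (40 * log R) ^ (3 * c) := by
  set L := log R
  have hL0 :0 < L := by linarith
  obtain ⟨hs, hb⟩ := zsum_bd (a :=1 / L) (by positivity) (by rw [div_le_one hL0]; exact hL)
  rw [div_div_eq_mul_div, div_one] at hb
  have h1 : ∏ t, (1 + (p t : ℝ) ^ (-(1 +1 / L))) ≤40 * L := by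
    refine le_trans ?_ hb
    rw [Finset.prod_one_add]
    have e : ∀ s ∈ (univ : Finset (Fin n)).powerset, ∏ t ∈ s, (p t : ℝ) ^ (-(1 +1 / L)) = ((∏ t ∈ s, p t : ℕ) : ℝ) ^ (-(1 +1 / L)) := fun s _ => by
      push_cast
      rw [Real.finsetProd_rpow _ _ fun t _ => by positivity]
    rw [sum_congr rfl e, ← sum_image (f := fun m : ℕ => (m : ℝ) ^ (-(1 +1 / L))) (g := fun s => ∏ t ∈ s, p t)]
    · exact hs.sum_le_tsum _ fun m _ => by positivity
    · intro s _ s' _ h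
      have key : ∀ (s : Finset (Fin n)) t, t ∈ s ↔ p t ∣ ∏ r ∈ s, p r := fun s t => by
        refine ⟨fun ht => dvd_prod_of_mem p ht, fun hd => ?_⟩
        obtain ⟨r, hr, hd⟩ := (H.pr t).prime.exists_mem_finset_dvd hd
        rwa [H.inj ((Nat.prime_dvd_prime_iff_eq (H.pr t) (H.pr r)).1 hd)]
      ext t
      rw [key s, key s', show ∏ t ∈ s, p t = ∏ t ∈ s', p t from h]
  have h2 : Vk c p ≤ ∏ t, (1 + (p t : ℝ) ^ (-(1 +1 / L))) ^ (3 * c) := by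
    refine prod_le_prod (fun t _ => by positivity) fun t _ => ?_
    have hp : (1:ℝ) < p t := by exact_mod_cast (H.pr t).one_lt
    have hp0 : (0:ℝ) < p t := by linarith
    have h3 :1 / (p t : ℝ) ≤3 * (p t : ℝ) ^ (-(1 +1 / L)) := by
      rw [show -(1 +1 / L) = -1 + -(1 / L) by ring, Real.rpow_add hp0, Real.rpow_neg_one, Real.rpow_neg hp0.le]
      have : (p t : ℝ) ^ (1 / L) ≤3 := by
        calc (p t : ℝ) ^ (1 / L) ≤ Real.exp 1 := by
              rw [Real.rpow_def_of_pos hp0, Real.exp_le_exp, mul_one_div, div_le_one hL0]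
              exact Real.log_le_log hp0 (by exact_mod_cast hR t)
          _ ≤3 := Real.exp_one_lt_three.le
      rw [one_div, mul_left_comm]
      refine le_mul_of_one_le_right (by positivity) ?_
      rw [← div_eq_mul_inv, le_div_iff₀ (by positivity)]; linarith
    have h4 :0 ≤ (p t : ℝ) ^ (-(1 +1 / L)) := by positivity
    have := one_add_mul_le_pow (a := (p t : ℝ) ^ (-(1 +1 / L))) (by linarith) (3 * c)
    refine le_trans ?_ this
    push_cast
    rw [div_eq_mul_one_div]
    nlinarith [Nat.cast_nonneg (α := ℝ) c]
  rw [prod_pow] at h2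
  refine h2.trans ?_
  gcongr

theorem wt_sum {N : ℕ} (hN :1 ≤ N) : ∑ j ∈ Icc 1 N, wt N j ≤ N := by
  have hN0 : (0:ℝ) < N := by exact_mod_cast hN
  have e : ∑ j ∈ Icc 1 N, wt N j = log (N ^ N / N.factorial) := by
    rw [sum_congr rfl fun j hj => wt_eq (mem_Icc.1 hj).1 (mem_Icc.1 hj).2, ← Real.log_prod]
    · rw [prod_div_distrib, prod_const, Nat.card_Icc, Nat.add_sub_cancel, ← prod_Ico_id_eq_factorial, Ico_add_one_right_eq_Icc]
      push_cast; rfl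
    · intro j hj
      have : (0:ℝ) < j := by exact_mod_cast (mem_Icc.1 hj).1
      positivity
  rw [e, Real.log_le_iff_le_exp (by positivity)]
  exact Real.pow_div_factorial_le_exp _ hN0.le N

theorem MN_low {N : ℕ} (hN :1000 ≤ N) : (N : ℝ) /10 ≤ MN N := by
  have hl2 := Real.log_two_gt_d9
  have h1 := Chebyshev.psi_ge (N /2)
  rw [Chebyshev.psi_eq_sum_Icc, Nat.floor_natCast] at h1
  have h2 : log 2 * ∑ v ∈ Icc 1 (N /2), ArithmeticFunction.vonMangoldt v ≤ MN N := by
    unfold MN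
    rw [mul_sum]
    have hsub : Icc 1 (N /2) ⊆ Icc 1 N := Icc_subset_Icc_right (by omega)
    refine le_trans (sum_le_sum fun v hv => ?_) (sum_le_sum_of_subset_of_nonneg hsub fun v hv _ => (lam_le (mem_Icc.1 hv).1 (mem_Icc.1 hv).2).2)
    rw [mul_comm]
    have hv0 : (0:ℝ) < v := by exact_mod_cast (mem_Icc.1 hv).1
    refine mul_le_mul_of_nonneg_left (Real.log_le_log (by norm_num) ?_) ArithmeticFunction.vonMangoldt_nonneg
    rw [le_div_iff₀ hv0]
    have := (mem_Icc.1 hv).2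
    exact_mod_cast (by omega :2 * v ≤ N)
  have h0 : ∑ v ∈ Icc 1 (N /2), ArithmeticFunction.vonMangoldt v = ∑ v ∈ Icc 0 (N /2), ArithmeticFunction.vonMangoldt v := by
    refine sum_subset (Icc_subset_Icc_left (by norm_num)) fun v h1 h2 => ?_
    have : v =0 := by rw [mem_Icc] at h1 h2; omega
    simp [this]
  rw [← h0] at h1
  have hM : (500:ℝ) ≤ (N /2 : ℕ) := by exact_mod_cast (by omega :500 ≤ N /2)
  have hM2 : (N:ℝ) ≤2 * (N /2 : ℕ) +1 := by exact_mod_cast (by omega : N ≤2 * (N /2) +1)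
  have h3 : log ((N /2 : ℕ) +1) ≤ ((N /2 : ℕ) +1) /20 +3 := by
    have a1 := Real.log_le_sub_one_of_pos (x := (((N /2 : ℕ) : ℝ) +1) /20) (by positivity)
    rw [Real.log_div (by positivity) (by norm_num)] at a1
    have : log 20 ≤4 := by
      calc log 20 ≤ log (2 ^5) := Real.log_le_log (by norm_num) (by norm_num)
        _ ≤4 := by rw [Real.log_pow]; have := Real.log_two_lt_d9; push_cast; linarith
    linarith
  have h4 : (0.6:ℝ) * (N /2 : ℕ) ≤ ∑ v ∈ Icc 1 (N /2), ArithmeticFunction.vonMangoldt v := by nlinarith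
  nlinarith

theorem D_sum {N Q Y B : ℕ} (hN :3 ≤ N) (hQ :1 ≤ Q) (hY :1 ≤ Y) (hYN : Y ^16 ≤ N) (h : ∀ D : ℕ, 2 ≤ D → D ≤ Q → Sp D N ≤ D * (N / log N ^ B)) :
    ∑ D ∈ Icc 2 Y, Sp D N / √D ≤ Q ^2 * (N / log N ^ B) +8 * N * log N ^3 / √Q := by
  have hl :0 ≤ log N := Real.log_natCast_nonneg N
  have hQ0 : (0:ℝ) < Q := by exact_mod_cast hQ
  rw [← sum_filter_add_sum_filter_not _ (fun D => D ≤ Q)]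
  refine add_le_add ?_ ?_
  · calc _ ≤ ∑ D ∈ Icc 1 Q, (Q:ℝ) * (N / log N ^ B) := by
          refine le_trans (sum_le_sum (g := fun _ => (Q:ℝ) * (N / log N ^ B)) fun D hD => ?_) (sum_le_sum_of_subset_of_nonneg (fun D hD => ?_) fun _ _ _ => by positivity)
          · obtain ⟨h1, h2⟩ := mem_filter.1 hD
            have h3 := (mem_Icc.1 h1).1
            have : (1:ℝ) ≤ √D := by rw [Real.one_le_sqrt]; exact_mod_cast (by omega :1 ≤ D)
            calc _ ≤ Sp D N := div_le_self (Sp_nonneg D N) this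
              _ ≤ _ := h D h3 h2
              _ ≤ _ := by gcongr
          · obtain ⟨h1, h2⟩ := mem_filter.1 hD
            have h3 := (mem_Icc.1 h1).1
            exact mem_Icc.2 ⟨by omega, h2⟩
      _ = _ := by simp; ring
  · calc _ ≤ ∑ D ∈ (Icc 2 Y).filter (fun D => ¬ D ≤ Q), Sp D N / √Q := sum_le_sum fun D hD => by
          obtain ⟨h1, h2⟩ := mem_filter.1 hD
          have := Sp_nonneg D N
          have :0 < √(Q:ℝ) := by positivity
          gcongr
          omega
      _ ≤ _ := by
        rw [← sum_div]
        gcongr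
        exact (sum_le_sum_of_subset_of_nonneg (filter_subset _ _) fun D _ _ => Sp_nonneg D N).trans (Sp_ls hY hYN hN)

def JJ (p : Fin n → ℕ) (W N m : ℕ) : Finset ℕ := (Icc 1 N).filter (fun v => v ≡ 1 [MOD W] ∧ m * W < v ∧ ∀ t, ¬ p t ∣ v)

open scoped ArithmeticFunction.vonMangoldt in
theorem cmpS {p : Fin n → ℕ} {W N n0 : ℕ} (hN :3 ≤ N) (f : ℕ → ℝ) {F : ℝ} (hF : ∀ j, f j ^2 ≤ F)
    (hno : ∀ j, n0 < j → ∀ i i' : Fin k, (j + i * W).Prime → (j + i' * W).Prime → i = i') :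
    ∑ m : Fin k, ∑ v ∈ JJ p W N m, Λ v * log (N / v) * f (v - m * W) ^2 ≤
      log N * ∑ j ∈ (Icc 1 N).filter (fun j => j ≡ 1 [MOD W]), wt N j * f j ^2 + k * F * log N ^2 * (2 * √N + n0) := by
  have hl :0 ≤ log N := Real.log_natCast_nonneg N
  have hF0 :0 ≤ F := (sq_nonneg _).trans (hF 0)
  set I := (Icc 1 N).filter (fun j => j ≡ 1 [MOD W])
  have h1 : ∀ m : Fin k, ∑ v ∈ JJ p W N m, Λ v * log (N / v) * f (v - m * W) ^2 ≤
      F * log N ^2 * (2 * √N) + ∑ j ∈ I, if (j + m * W).Prime then log N * (wt N j * f j ^2) else 0 := by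
    intro m
    have hJ : ∀ v ∈ JJ p W N m, 1 ≤ v ∧ v ≤ N ∧ v ≡ 1 [MOD W] ∧ m * W < v := fun v hv => by
      obtain ⟨a, b, c, -⟩ := mem_filter.1 hv
      exact ⟨(mem_Icc.1 a).1, (mem_Icc.1 a).2, b, c⟩
    have hw : ∀ v ∈ JJ p W N m, log (N / v) = wt N v := fun v hv => (wt_eq (hJ v hv).1 (hJ v hv).2.1).symm
    rw [← sum_filter_not_add_sum_filter _ (fun v => v.Prime)]
    refine add_le_add ?_ ?_
    · have hc := Chebyshev.psi_sub_theta_le (x := N) (by exact_mod_cast (by omega :1 ≤ N))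
      rw [Chebyshev.psi_sub_theta_eq_sum_not_prime, Nat.floor_natCast] at hc
      calc _ ≤ ∑ v ∈ (JJ p W N m).filter (fun v => ¬ v.Prime), Λ v * (log N * F) := sum_le_sum fun v hv => by
            rw [mul_assoc, hw v (mem_filter.1 hv).1]
            exact mul_le_mul_of_nonneg_left (mul_le_mul (wt_le N v) (hF _) (sq_nonneg _) hl) ArithmeticFunction.vonMangoldt_nonneg
        _ ≤ ∑ v ∈ (Ioc 0 N).filter (fun v => ¬ v.Prime), Λ v * (log N * F) := by
            refine sum_le_sum_of_subset_of_nonneg (fun v hv => ?_) fun v _ _ => mul_nonneg ArithmeticFunction.vonMangoldt_nonneg (by positivity)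
            obtain ⟨a, b⟩ := mem_filter.1 hv
            exact mem_filter.2 ⟨mem_Ioc.2 ⟨(hJ v a).1, (hJ v a).2.1⟩, b⟩
        _ ≤ (2 * √N * log N) * (log N * F) := by rw [← sum_mul]; gcongr
        _ = _ := by ring
    · rw [← sum_filter]
      calc _ ≤ ∑ v ∈ (JJ p W N m).filter (fun v => v.Prime), (fun j => log N * (wt N j * f j ^2)) (v - m * W) := sum_le_sum fun v hv => by
            obtain ⟨g1, g2, g3, g4⟩ := hJ v (mem_filter.1 hv).1
            have gv :1 ≤ v - m * W := by omega
            rw [mul_assoc, hw v (mem_filter.1 hv).1]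
            have : Λ v ≤ log N := ArithmeticFunction.vonMangoldt_le_log.trans (Real.log_le_log (by exact_mod_cast g1) (by exact_mod_cast g2))
            have := wt_anti (N := N) gv (Nat.sub_le _ _)
            have := wt_nonneg N v
            dsimp only
            gcongr
        _ = ∑ j ∈ ((JJ p W N m).filter (fun v => v.Prime)).image (fun v => v - m * W), log N * (wt N j * f j ^2) := by
            rw [sum_image]
            intro v hv v' hv' e
            have g1 := (hJ v (mem_filter.1 hv).1).2.2.2
            have g2 := (hJ v' (mem_filter.1 hv').1).2.2.2
            simp only at e
            omega
        _ ≤ _ := by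
            refine sum_le_sum_of_subset_of_nonneg (fun j hj => ?_) fun j _ _ => mul_nonneg hl (mul_nonneg (wt_nonneg _ _) (sq_nonneg _))
            obtain ⟨v, hv, rfl⟩ := mem_image.1 hj
            obtain ⟨hv1, hv2⟩ := mem_filter.1 hv
            obtain ⟨g1, g2, g3, g4⟩ := hJ v hv1
            refine mem_filter.2 ⟨mem_filter.2 ⟨mem_Icc.2 ⟨by omega, by omega⟩, ?_⟩, by rwa [Nat.sub_add_cancel g4.le]⟩
            obtain ⟨w, rfl⟩ := Nat.exists_eq_add_of_le g4.le
            rw [Nat.add_sub_cancel_left]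
            simpa [Nat.ModEq] using g3
  refine (sum_le_sum fun m _ => h1 m).trans ?_
  rw [sum_add_distrib, sum_comm]
  have h2 : ∀ j ∈ I, ∑ m : Fin k, (if (j + m * W).Prime then log N * (wt N j * f j ^2) else 0) ≤
      log N * (wt N j * f j ^2) + if j ≤ n0 then k * F * log N ^2 else 0 := by
    intro j _
    have hx :0 ≤ log N * (wt N j * f j ^2) := mul_nonneg hl (mul_nonneg (wt_nonneg _ _) (sq_nonneg _))
    split_ifs with hj
    · refine le_add_of_nonneg_of_le hx ((sum_le_sum (g := fun _ => F * log N ^2) fun m _ => ?_).trans (by simp; linarith))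
      have : log N * (wt N j * f j ^2) ≤ F * log N ^2 := by
        have := mul_le_mul_of_nonneg_left (mul_le_mul (wt_le N j) (hF j) (sq_nonneg _) hl) hl
        linarith
      split_ifs
      · exact this
      · exact hx.trans this
    · rw [add_zero]
      by_cases h : ∃ i : Fin k, (j + i * W).Prime
      · obtain ⟨i, hi⟩ := h
        rw [sum_eq_single i]
        · rw [if_pos hi]
        · exact fun i' _ hne => if_neg fun h => hne (hno j (by omega) i' i h hi)
        · simp
      · push Not at h
        rw [sum_eq_zero fun i _ => if_neg (h i)]; exact hx
  have h3 := sum_le_sum h2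
  rw [sum_add_distrib, ← mul_sum, ← sum_filter, sum_const, nsmul_eq_mul] at h3
  have h4 : (((I.filter (fun j => j ≤ n0)).card : ℕ) : ℝ) ≤ n0 := by
    have : I.filter (fun j => j ≤ n0) ⊆ Icc 1 n0 := fun j hj => by
      obtain ⟨a, b⟩ := mem_filter.1 hj
      exact mem_Icc.2 ⟨(mem_Icc.1 (mem_filter.1 a).1).1, b⟩
    have := card_le_card this
    simp at this
    exact_mod_cast this
  have h5 : ((I.filter (fun j => j ≤ n0)).card : ℝ) * (k * F * log N ^2) ≤ n0 * (k * F * log N ^2) := by gcongr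
  simp only [sum_const, card_univ, Fintype.card_fin, nsmul_eq_mul]
  linarith
end

section
variable {k n : ℕ}

set_option maxHeartbeats 1000000 in
theorem step {p : Fin n → ℕ} {W R N n0 J : ℕ} (H : Hy k p W) (hk : k =2 ^ J) (hJ :1228800 ≤ J)
    (hpR : ∀ t, p t ≤ R) (hnR : n ≤ R) (hS : ∀ q, q.Prime → q ≤ R → q.Coprime W → ∃ t, p t = q)
    {ε : ℝ} (hε : ∑ t, 1 / (p t : ℝ) ^2 ≤ ε) (hε9 :9 * k ^2 * ε ≤1 /4) (hNR : N = R ^40)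
    {L V l : ℝ} (hL : L = log R) (hL1 :1 ≤ L) (hl : l =40 * L) (hV : V = l ^ (18 * k))
    (hb :2 * (W +1) ≤ (W.totient / W : ℝ) * (L / (48 * k * J))) (hN :1000 ≤ N) (hWR : W * R ^2 ≤ N) (hkW : k * W ≤ N)
    (hno : ∀ j, n0 < j → ∀ i i' : Fin k, (j + i * W).Prime → (j + i' * W).Prime → i = i') :
    (N : ℝ) / W ≤ k * (V ^2 * (V * W) * ∑ D ∈ Icc 2 (W * R ^2), Sp D N / √D + (k * W * l ^2 + R * (3 * l ^3) +9 * l ^4) * (R * V ^2) ^2)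
      + l * (W * R ^2 * l * (R * V ^2) ^2) + k * (R * V ^2) ^2 * l ^2 * (2 * √N + n0) := by
  have hkr : (k:ℝ) =2 ^ J := by rw [hk]; push_cast; rfl
  have hk1 : (1:ℝ) ≤ k := by rw [hkr]; exact one_le_pow₀ (by norm_num)
  have hk1n :1 ≤ k := by exact_mod_cast hk1
  have hJr : (1228800:ℝ) ≤ J := by exact_mod_cast hJ
  have hL0 :0 < L := by linarith
  have hR1 :1 ≤ R := by
    rcases Nat.eq_zero_or_pos R with h | h
    · rw [h] at hL; simp at hL; linarith
    · exact h
  have hR0 : (0:ℝ) < R := by exact_mod_cast hR1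
  have hW0 : (0:ℝ) < W := by exact_mod_cast H.w1
  have hφ0 : (0:ℝ) < W.totient := by exact_mod_cast Nat.totient_pos.2 H.w1
  have hlN : log N = l := by rw [hNR, hl, hL]; push_cast; rw [Real.log_pow]; norm_num
  have hl1 :1 ≤ l := by linarith
  obtain ⟨b, hbd⟩ : ∃ b, b = L / (48 * k * J) := ⟨_, rfl⟩
  rw [← hbd] at hb
  have hbL : k * b * J = L /48 := by rw [hbd]; field_simp
  have hb0 :0 < b := by rw [hbd]; positivity
  obtain ⟨a, had⟩ : ∃ a, a = (W.totient / W : ℝ) * b := ⟨_, rfl⟩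
  obtain ⟨z, hzd⟩ : ∃ z, z = ⌊Real.exp (2 ^ J * b)⌋₊ := ⟨_, rfl⟩
  have hkb :2 ^ J * b ≤ L /2 := by
    rw [← hkr]
    have : k * b *1228800 ≤ k * b * J := by gcongr
    have :0 < k * b := by positivity
    linarith
  have hzlt : Real.exp (2 ^ J * b) < z +1 := by rw [hzd]; exact Nat.lt_floor_add_one _
  have hz :2 ^ J * b < log (z +1) := (Real.lt_log_iff_exp_lt (by positivity)).2 hzlt
  have hzle : (z:ℝ) ≤ Real.exp (2 ^ J * b) := by rw [hzd]; exact Nat.floor_le (Real.exp_pos _).le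
  have hz1 :1 ≤ z := by rw [hzd, Nat.le_floor_iff (Real.exp_pos _).le]; simpa using (Real.one_le_exp (by positivity))
  have hz0 : (0:ℝ) < z := by exact_mod_cast hz1
  have hlz : log z ≤ L /2 := ((Real.log_le_iff_le_exp hz0).2 hzle).trans hkb
  have hzR : z < R := by
    have : log z < log R := by rw [← hL]; linarith
    exact_mod_cast (Real.log_lt_log_iff hz0 hR0).1 this
  obtain ⟨g, hg⟩ : ∃ g : ℕ → ℝ, g = fun u : ℕ => ff J b (log u) := ⟨_, rfl⟩
  obtain ⟨G1, hG1⟩ : ∃ G, G = ∑ u ∈ II W z, g u / u := ⟨_, rfl⟩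
  obtain ⟨G2, hG2⟩ : ∃ G, G = ∑ u ∈ II W z, g u ^2 / u := ⟨_, rfl⟩
  have b1 := abs_le.1 (G1_bd H.w1 J hb0.le hz)
  have b2 := G2_bd H.w1 J hb0.le hz
  have b3 := G2_low H.w1 J hb0.le hz
  have b4 := GL_bd (W := W) (z := z) J hb0.le
  rw [← had] at b1 b2 b3 hb
  have hf0 : ∀ u, 0 ≤ g u := fun u => by rw [hg]; exact (ff_01 _ _ _).1
  have hf1 : ∀ u, g u ≤1 := fun u => by rw [hg]; exact (ff_01 _ _ _).2
  have eG1 : ∑ u ∈ II W z, ff J b (log u) / u = G1 := by rw [hG1, hg]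
  have eG2 : ∑ u ∈ II W z, ff J b (log u) ^2 / u = G2 := by rw [hG2, hg]
  rw [eG1] at b1 b4
  rw [eG2] at b2 b3
  have ha2 :4 ≤ a := by
      have : (1:ℝ) ≤ W := by exact_mod_cast H.w1
      linarith
  have c1 : a * J /2 ≤ G1 := by linarith [b1.1]
  have c2 : G1 ≤ a * J := by 
    have : a *1228800 ≤ a * J := by gcongr
    linarith [b1.2]
  have c3 : G2 ≤4 * a := by linarith
  have c4 : a /2 ≤ G2 := by linarith
  have hcof := cof_le (k := k) (n := n) hf0 hf1 p R
  have hsup : ∀ c : Fin n → Option (Fin k), cof p g R c ≠0 → nm p c ≤ R := fun c h => cof_supp c h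
  have hpk : ∀ i, 36 * k ≤ p i := fun i => le_trans (Nat.mul_le_mul_left _ (Nat.le_self_pow two_ne_zero k)) (H.big i)
  have u1 := (E_up p (fun i => (H.pr i).one_lt.le) (fun i => le_trans (by omega) (hpk i)) (cof (k := k) p g R)).trans
    (opt_up H.pr H.inj H.cop (z := z) (fun u hu => by
      rw [hg]; refine ff_zero J hb0.le (hz.trans_le (Real.log_le_log (by positivity) ?_)); exact_mod_cast hu) R)
  rw [← hG2] at u1
  have hZ : k * ∑ u ∈ II W z, g u ^2 / u * log u ≤1 /4 * log (R / z) * ∑ u ∈ II W z, g u ^2 / u := by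
    rw [← hG2, Real.log_div hR0.ne' hz0.ne', ← hL]
    have e : ∑ u ∈ II W z, g u ^2 / u * log u ≤ b * G1 := by rw [hg]; exact b4
    calc _ ≤ k * (b * (a * J)) := by gcongr; exact e.trans (by gcongr)
      _ = a * (k * b * J) := by ring
      _ = a * (L /48) := by rw [hbL]
      _ ≤1 /4 * (L /2) * (a /2) := by linarith [mul_pos (by linarith :0 < a) hL0]
      _ ≤ _ := by gcongr <;> linarith
  have hpk2 : ∀ i, 2 * k ≤ p i := fun i => le_trans (by omega) (hpk i)
  have hSz : ∀ q, q.Prime → q ≤ z → q.Coprime W → ∃ t, p t = q := fun q h1 h2 h3 => hS q h1 (h2.trans hzR.le) h3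
  have hg1 : g 1 =1 := by rw [hg]; simp only [Nat.cast_one, Real.log_one]; exact ff_one J hb0.le hb0.le
  have hga : ∀ u v, 1 ≤ u → u ≤ v → g v ≤ g u := fun u v hu huv => by
    rw [hg]; exact ff_anti J b (Real.log_le_log (by exact_mod_cast hu) (by exact_mod_cast huv))
  have l1 : ∀ m : Fin k, 1 /2 * G1 ^2 * G2 ^ (k -1) ≤ ∑ x, (∏ i, P2 m (p i) (x i)) * fS p (cof p g R) x ^2 := fun m => by
    have := opt_low (k := k) (g := g) (W := W) (z := z) (R := R) H.pr H.inj hpk2 hSz hf0 hg1 hga hε hε9 hz1 hzR hZ m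
    rw [← hG1, ← hG2] at this
    exact this.trans (E_low m p (fun i => le_trans (by omega) (hpk i)) (fun i => le_trans (by omega) (hpk i)) _)
  have hV0 := Vk_one (Nat.cast_nonneg (α := ℝ) k) p
  have hV60 := Vk_one (c :=6 * k) (by positivity) p
  have hV6 : Vk (6 * k) p ≤ V := by
    have := Vk_bd H hpR (by rw [← hL]; exact hL1) (6 * k)
    rw [← hL, ← hl, show 3 * (6 * k) =18 * k by ring, ← hV] at this
    push_cast at this; exact this
  have hV1 : Vk k p ≤ V := by
    have := Vk_bd H hpR (by rw [← hL]; exact hL1) k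
    rw [← hL, ← hl] at this
    exact this.trans (by rw [hV]; exact pow_le_pow_right₀ hl1 (by omega))
  have hV2 :0 ≤ V := by linarith
  have hT :0 ≤ ∑ D ∈ Icc 2 (W * R ^2), Sp D N / √D := sum_nonneg fun D _ => div_nonneg (Sp_nonneg D N) (by positivity)
  have s1 := (abs_le.1 (S1_thm H (cof p g R) hcof hsup (N := N) (by omega))).2
  have s2 := fun m : Fin k => (abs_le.1 (S2_thm H (cof p g R) hcof hsup (by omega) hWR hkW m (JJ p W N m) (fun v => by simp [JJ]))).1
  have s3 := cmpS (p := p) (W := W) (n0 := n0) (N := N) (by omega) (fun j => fS p (cof p g R) (XX k p W j)) (F := (R * V ^2) ^2) (fun j => by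
    rw [← sq_abs]
    have := fS_bd p (fun i => (H.pr i).one_lt.le) (cof p g R) hcof hsup (XX k p W j)
    refine pow_le_pow_left₀ (abs_nonneg _) (this.trans ?_) 2
    gcongr) hno
  rw [hlN] at s1 s3
  simp only [hlN] at s2
  have hXX :1 ≤ G2 ^ (k -1) := one_le_pow₀ (by linarith)
  set X := G2 ^ (k -1)
  have hGX : G2 ^ k = G2 * X := by rw [← pow_succ', Nat.sub_add_cancel hk1n]
  have hMN := MN_low hN
  obtain ⟨T, hTd⟩ : ∃ T, T = ∑ D ∈ Icc 2 (W * R ^2), Sp D N / √D := ⟨_, rfl⟩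
  rw [← hTd] at hT ⊢
  simp only [← hTd] at s2
  obtain ⟨E2, hE2⟩ : ∃ E, E = V ^2 * (V * W) * T + (k * W * l ^2 + R * (3 * l ^3) +9 * l ^4) * (R * V ^2) ^2 := ⟨_, rfl⟩
  obtain ⟨E1, hE1⟩ : ∃ E, E = W * R ^2 * l * (R * V ^2) ^2 := ⟨_, rfl⟩
  rw [← hE2, ← hE1]
  have hEE : Vk k p ^2 * (Vk (6 * k) p * W) * T + (k * W * l ^2 + n * (3 * l ^3) +9 * l ^4) * (R * Vk k p ^2) ^2 ≤ E2 := by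
    rw [hE2]; gcongr
  have hEE1 : W * R ^2 * l * (R * Vk k p ^2) ^2 ≤ E1 := by rw [hE1]; gcongr
  have t2 : ∀ m : Fin k, N /10 / W.totient * (1 /2 * (a * J /2) ^2 * X) - E2 ≤
      ∑ v ∈ JJ p W N m, ArithmeticFunction.vonMangoldt v * log (N / v) * fS p (cof p g R) (XX k p W (v - m * W)) ^2 := fun m => by
    have h1 := s2 m
    have h2 : N /10 / W.totient * (1 /2 * (a * J /2) ^2 * X) ≤ MN N / W.totient * ∑ x, (∏ i, P2 m (p i) (x i)) * fS p (cof p g R) x ^2 := by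
      refine mul_le_mul (by gcongr) (le_trans (by gcongr) (l1 m)) (by positivity) (div_nonneg (le_trans (by positivity) hMN) (by positivity))
    linarith
  have t3 := sum_le_sum (s := univ) fun m _ => t2 m
  rw [sum_const, card_univ, Fintype.card_fin, nsmul_eq_mul] at t3
  have t4 : ∑ j ∈ (Icc 1 N).filter (fun j => j ≡ 1 [MOD W]), wt N j * fS p (cof p g R) (XX k p W j) ^2 ≤ N / W * (4 * a * X) + E1 := by
    have h0 : (∑ j ∈ Icc 1 N, wt N j) / W * ∑ x : Fin n → Option (Fin k), (∏ i, P1 (p i) (x i)) * fS p (cof p g R) x ^2 ≤ N / W * (4 * a * X) := by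
      have : (∑ j ∈ Icc 1 N, wt N j) / W ≤ N / W := by gcongr; exact wt_sum (by omega)
      have h1 :0 ≤ (∑ j ∈ Icc 1 N, wt N j) / W := div_nonneg (sum_nonneg fun j _ => wt_nonneg N j) hW0.le
      calc _ ≤ (∑ j ∈ Icc 1 N, wt N j) / W * (4 * a * X) := by
            refine mul_le_mul_of_nonneg_left (u1.trans ?_) h1
            rw [hGX]; gcongr
        _ ≤ _ := by gcongr
    linarith
  have t5 := mul_le_mul_of_nonneg_left t4 (by linarith :0 ≤ l)
  have key : l * (N / W * (4 * a * X)) + N / W ≤ k * (N /10 / W.totient * (1 /2 * (a * J /2) ^2 * X)) := by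
    have e1 : k * (N /10 / W.totient * (1 /2 * (a * J /2) ^2 * X)) = N / W * ((k * b * J) * J /80 * a * X) := by
      rw [had]; field_simp; ring
    rw [e1, hbL, hl]
    have :0 ≤ (N:ℝ) / W := by positivity
    have h3 :40 * L * (4 * a * X) +1 ≤ L /48 * J /80 * a * X := by
      have h4 :1 ≤ L * (a * X) := one_le_mul_of_one_le_of_one_le hL1 (one_le_mul_of_one_le_of_one_le (by linarith) hXX)
      have h5 : L * (a * X) *1228800 ≤ L * (a * X) * J := by gcongr
      rw [show 40 * L * (4 * a * X) =160 * (L * (a * X)) by ring, show L /48 * J /80 * a * X = L * (a * X) * J /3840 by ring]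
      linarith
    calc _ = N / W * (40 * L * (4 * a * X) +1) := by ring
      _ ≤ _ := by gcongr
  linarith
end

section

theorem pr_enum {D R : ℕ} (hD :1 ≤ D) (hDR : D ≤ R) : ∃ n, ∃ p : Fin n → ℕ, (∀ t, (p t).Prime ∧ D < p t ∧ p t ≤ R) ∧
    Function.Injective p ∧ n ≤ R ∧ (∀ q, q.Prime → D < q → q ≤ R → ∃ t, p t = q) ∧ ∑ t, 1 / (p t : ℝ) ^2 ≤ (1 / D : ℝ) := by
  classical
  let S := (Ioc D R).filter Nat.Prime
  have hm : ∀ q, q ∈ S ↔ (D < q ∧ q ≤ R) ∧ q.Prime := fun q => by simp [S]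
  refine ⟨S.card, fun t => (S.equivFin.symm t : ℕ), fun t => ?_, fun s t h => ?_, ?_, fun q h1 h2 h3 => ?_, ?_⟩
  · have := (hm _).1 (S.equivFin.symm t).2
    tauto
  · exact S.equivFin.symm.injective (Subtype.ext h)
  · exact (card_filter_le _ _).trans (by simp)
  · exact ⟨S.equivFin ⟨q, (hm q).2 ⟨⟨h2, h3⟩, h1⟩⟩, by simp⟩
  · change ∑ t, (fun s : S => 1 / ((s : ℕ) : ℝ) ^2) (S.equivFin.symm t) ≤ _
    rw [Equiv.sum_comp S.equivFin.symm (fun s : S => 1 / ((s : ℕ) : ℝ) ^2), sum_coe_sort S (fun s => 1 / (s : ℝ) ^2)]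
    calc _ ≤ ∑ s ∈ Ioc D R, 1 / (s : ℝ) ^2 := sum_le_sum_of_subset_of_nonneg (filter_subset _ _) fun _ _ _ => by positivity
      _ ≤ _ := by
        have := sum_Ioc_inv_sq_le_sub (α := ℝ) (k := D) (n := R) (by omega) hDR
        simp only [one_div]
        have h2 : (0:ℝ) ≤ (R:ℝ)⁻¹ := by positivity
        linarith

theorem ar_T {N l Q V T : ℝ} {a A' B : ℕ} (hA' : A' =3 * a +4) (hB : B =3 * a +4 * A' +1) (hN :0 ≤ N) (hl :1 ≤ l) (hV : V = l ^ a)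
    (hQ0 :0 ≤ Q) (hQ : Q ≤ l ^ (2 * A')) (hQ2 : (l /80) ^ A' ≤ √Q) (hT : T ≤ Q ^2 * (N / l ^ B) +8 * N * l ^3 / √Q) :
    V ^2 * V * T ≤ (1 +8 *80 ^ A') * (N / l) := by
  have hl0 :0 < l := by linarith
  calc _ ≤ V ^2 * V * ((l ^ (2 * A')) ^2 * (N / l ^ B) +8 * N * l ^3 / (l /80) ^ A') := by
        rw [hV]
        gcongr
        refine hT.trans ?_
        gcongr
    _ = _ := by
        rw [hV, hB, div_pow]
        have e1 : l ^ (3 * a +4 * A' +1) = (l ^ a) ^3 * (l ^ A') ^4 * l := by ring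
        have e2 : l ^ A' = (l ^ a) ^3 * l ^4 := by rw [hA']; ring
        rw [e1, show (l ^ (2 * A')) ^2 = (l ^ A') ^4 by ring]
        have e3 :0 < l ^ A' := by positivity
        have h1 : (l ^ a) ^2 * l ^ a * ((l ^ A') ^4 * (N / ((l ^ a) ^3 * (l ^ A') ^4 * l))) = N / l := by
          field_simp
        have h2 : (l ^ a) ^2 * l ^ a * (8 * N * l ^3 / (l ^ A' /80 ^ A')) =8 *80 ^ A' * (N / l) := by
          rw [e2]; field_simp
        rw [mul_add, h1, h2]; ring

theorem ar_fin {k W R l V T N n0 C : ℝ} {a : ℕ} (hk :1 ≤ k) (hW :1 ≤ W) (hR :1 ≤ R) (hl :1 ≤ l) (hn :0 ≤ n0) (hV : V = l ^ a) (hN : N = R ^40)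
    (hT : V ^2 * V * T ≤ C * (N / l)) (hC :4 * k * W ^2 * C ≤ l) (hlR : l ^ (4 +4 * a) ≤ R)
    (hCR :4 * W * (k * (k * W +12) + W + k * (2 + n0)) ≤ R) :
    k * (V ^2 * (V * W) * T + (k * W * l ^2 + R * (3 * l ^3) +9 * l ^4) * (R * V ^2) ^2)
      + l * (W * R ^2 * l * (R * V ^2) ^2) + k * (R * V ^2) ^2 * l ^2 * (2 * √N + n0) < N / W := by
  have hl0 :0 < l := by linarith
  have hR0 :0 < R := by linarith
  have hW0 :0 < W := by linarith
  have hV0 :0 ≤ V := by rw [hV]; positivity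
  have hNp :0 < N := by rw [hN]; positivity
  have hs : √N = R ^20 := by rw [hN, show R ^40 = (R ^20) ^2 by ring]; exact Real.sqrt_sq (by positivity)
  have hV4 : V ^4 * l ^4 ≤ R := by refine le_trans (le_of_eq ?_) hlR; rw [hV]; ring
  have p1 : k * (V ^2 * (V * W) * T) ≤ N / W /4 := by
    calc _ = k * W * (V ^2 * V * T) := by ring
      _ ≤ k * W * (C * (N / l)) := by gcongr
      _ = (4 * k * W ^2 * C) * (N / (4 * W * l)) := by field_simp
      _ ≤ l * (N / (4 * W * l)) := by gcongr
      _ = _ := by field_simp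
  have l24 : l ^2 ≤ l ^4 := pow_le_pow_right₀ hl (by norm_num)
  have l34 : l ^3 ≤ l ^4 := pow_le_pow_right₀ hl (by norm_num)
  have p2 : (k * W * l ^2 + R * (3 * l ^3) +9 * l ^4) * (R * V ^2) ^2 ≤ (k * W +12) * R ^23 := by
    calc _ ≤ (k * W * (R * l ^4) + R * (3 * l ^4) +9 * (R * l ^4)) * (R * V ^2) ^2 := by
          have h1 : l ^2 ≤ R * l ^4 := l24.trans (le_mul_of_one_le_left (by positivity) hR)
          have h2 : l ^4 ≤ R * l ^4 := le_mul_of_one_le_left (by positivity) hR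
          gcongr
      _ = (k * W +12) * R ^3 * (V ^4 * l ^4) := by ring
      _ ≤ (k * W +12) * R ^3 * R := by gcongr
      _ = (k * W +12) * R ^4 := by ring
      _ ≤ _ := by gcongr; first | exact hR | norm_num
  have p3 : l * (W * R ^2 * l * (R * V ^2) ^2) ≤ W * R ^23 := by
    calc _ = W * R ^4 * (V ^4 * l ^2) := by ring
      _ ≤ W * R ^4 * (V ^4 * l ^4) := by gcongr
      _ ≤ W * R ^4 * R := by gcongr
      _ = W * R ^5 := by ring
      _ ≤ _ := by gcongr; first | exact hR | norm_num
  have p4 : (R * V ^2) ^2 * l ^2 * (2 * √N + n0) ≤ (2 + n0) * R ^23 := by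
    rw [hs]
    have h1 : n0 ≤ n0 * R ^20 := le_mul_of_one_le_right hn (one_le_pow₀ hR)
    calc _ ≤ (R * V ^2) ^2 * l ^4 * (2 * R ^20 + n0 * R ^20) := by gcongr
      _ = (2 + n0) * R ^22 * (V ^4 * l ^4) := by ring
      _ ≤ (2 + n0) * R ^22 * R := by gcongr
      _ = _ := by ring
  have p5 : (k * (k * W +12) + W + k * (2 + n0)) * R ^23 ≤ N / W /4 := by
    rw [div_div, le_div_iff₀ (by positivity)]
    calc _ =4 * W * (k * (k * W +12) + W + k * (2 + n0)) * R ^23 := by ring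
      _ ≤ R * R ^23 := by gcongr
      _ = R ^24 := by ring
      _ ≤ N := by rw [hN]; gcongr; first | exact hR | norm_num
  have p2' := mul_le_mul_of_nonneg_left p2 (by linarith :0 ≤ k)
  have p4' := mul_le_mul_of_nonneg_left p4 (by linarith :0 ≤ k)
  have p6 :0 < N / W := by positivity
  linarith

theorem pairs {k J : ℕ} (hk : k =2 ^ J) (hJ :1228800 ≤ J) : ∃ W : ℕ, 1 ≤ W ∧ ∀ n0 : ℕ, ∃ j : ℕ, n0 < j ∧ ∃ i i' : Fin k, (j + i * W).Prime ∧ (j + i' * W).Prime ∧ i ≠ i' := by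
  have hk1 :1 ≤ k := by rw [hk]; exact Nat.one_le_two_pow
  obtain ⟨D, hD⟩ : ∃ D, D =36 * k ^2 := ⟨_, rfl⟩
  have hD1 :1 ≤ D := by rw [hD]; exact Nat.mul_pos (by norm_num) (pow_pos hk1 2)
  obtain ⟨W, hW⟩ : ∃ W, W = D.factorial := ⟨_, rfl⟩
  have hW1 :1 ≤ W := by rw [hW]; exact Nat.factorial_pos D
  refine ⟨W, hW1, fun n0 => ?_⟩
  by_contra! hno0
  have hno : ∀ j, n0 < j → ∀ i i' : Fin k, (j + i * W).Prime → (j + i' * W).Prime → i = i' := hno0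
  clear hno0
  obtain ⟨a, ha⟩ : ∃ a, a =18 * k := ⟨_, rfl⟩
  obtain ⟨A', hA'⟩ : ∃ A', A' =3 * a +4 := ⟨_, rfl⟩
  obtain ⟨B, hB⟩ : ∃ B, B =3 * a +4 * A' +1 := ⟨_, rfl⟩
  obtain ⟨L0, hL0⟩ := Sp_small (2 * A') B
  obtain ⟨C, hC⟩ : ∃ C : ℝ, C =1 +8 *80 ^ A' := ⟨_, rfl⟩
  have hlogT : Filter.Tendsto (fun R : ℕ => log R) Filter.atTop Filter.atTop := Real.tendsto_log_atTop.comp tendsto_natCast_atTop_atTop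
  have v1 := hlogT.eventually_ge_atTop 1
  have v2 := hlogT.eventually_ge_atTop L0
  have v3 := hlogT.eventually_ge_atTop (4 * k * W ^2 * C)
  have v4 := hlogT.eventually_ge_atTop (2 * (W +1) / ((W.totient / W : ℝ) / (48 * k * J)))
  have v5 := tendsto_natCast_atTop_atTop.eventually_ge_atTop (4 * W * (k * (k * W +12) + W + k * (2 + n0)) : ℝ)
  have v6 : ∀ᶠ R : ℕ in Filter.atTop, (40 * log R) ^ (4 +4 * a) ≤ (R : ℝ) := by
    have h := (Real.isLittleO_pow_log_id_atTop (n :=4 +4 * a)).bound (c :=1 /40 ^ (4 +4 * a)) (by positivity)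
    filter_upwards [tendsto_natCast_atTop_atTop.eventually h] with R hR
    simp only [id, Real.norm_eq_abs] at hR
    rw [abs_of_nonneg (by positivity : (0:ℝ) ≤ R), abs_of_nonneg (pow_nonneg (Real.log_natCast_nonneg R) _)] at hR
    rw [mul_pow]
    have h2 : (0:ℝ) <40 ^ (4 +4 * a) := by positivity
    calc _ ≤40 ^ (4 +4 * a) * (1 /40 ^ (4 +4 * a) * (R:ℝ)) := by gcongr
      _ = _ := by field_simp
  obtain ⟨R0, hR0⟩ := Filter.eventually_atTop.1 (v1.and (v2.and (v3.and (v4.and (v5.and (v6.and (Filter.eventually_ge_atTop (W ^2 + k * W + D +1000))))))))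
  obtain ⟨Q, hQ, hG⟩ := good_scale ((R0 +1) ^ (2 * A'))
  obtain ⟨x, hx⟩ : ∃ x : ℝ, x = (Q : ℝ) ^ ((1:ℝ) / (2 * A' : ℕ)) := ⟨_, rfl⟩
  have hxA : x ^ (2 * A') = Q := by
    rw [hx, one_div]; exact Real.rpow_inv_natCast_pow (by positivity) (by omega)
  have hx0 :0 ≤ x := by rw [hx]; positivity
  have hxR : (R0 +1 : ℝ) ≤ x := by
    refine le_of_pow_le_pow_left₀ (n :=2 * A') (by omega) hx0 ?_
    rw [hxA]; exact_mod_cast hQ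
  obtain ⟨R, hR⟩ : ∃ R, R = ⌈Real.exp x⌉₊ := ⟨_, rfl⟩
  have hRx : Real.exp x ≤ R := by rw [hR]; exact Nat.le_ceil _
  have hRx2 : (R:ℝ) < Real.exp x +1 := by rw [hR]; exact Nat.ceil_lt_add_one (Real.exp_pos _).le
  have hRR : R0 ≤ R := by
    have := Real.add_one_le_exp x
    have : (R0:ℝ) ≤ R := by linarith
    exact_mod_cast this
  obtain ⟨w1, w2, w3, w4, w5, w6, w7⟩ := hR0 R hRR
  obtain ⟨L, hL⟩ : ∃ L, L = log R := ⟨_, rfl⟩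
  rw [← hL] at w1 w2 w3 w4 w6
  have hR1 :1 ≤ R := by omega
  have hR1r : (1:ℝ) ≤ R := by exact_mod_cast hR1
  have hxL : x ≤ L := by rw [hL, Real.le_log_iff_exp_le (by linarith)]; exact hRx
  have hLx : L ≤2 * x := by
    rw [hL, Real.log_le_iff_le_exp (by linarith), two_mul, Real.exp_add]
    have : x +1 ≤ Real.exp x := Real.add_one_le_exp x
    have : (0:ℝ) ≤ R0 := by positivity
    have h3 := mul_le_mul_of_nonneg_right (by linarith :2 ≤ Real.exp x) (Real.exp_pos x).le
    linarith
  obtain ⟨N, hN⟩ : ∃ N, N = R ^40 := ⟨_, rfl⟩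
  obtain ⟨l, hl⟩ : ∃ l, l =40 * L := ⟨_, rfl⟩
  rw [← hl] at w6
  have hNr : (N:ℝ) = (R:ℝ) ^40 := by rw [hN]; push_cast; rfl
  have hlN : log N = l := by rw [hNr, hl, hL, Real.log_pow]; norm_num
  have hRN : R ≤ N := by rw [hN]; exact Nat.le_self_pow (by norm_num) R
  have hlL : L ≤ l := by linarith
  have hl1 :1 ≤ l := by linarith
  obtain ⟨n, p, hp1, hinj, hn, hS, hsum⟩ := pr_enum hD1 (show D ≤ R by omega)
  have hcop : ∀ q, q.Prime → (q.Coprime W ↔ D < q) := fun q hq => by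
    rw [hq.coprime_iff_not_dvd, hW, hq.dvd_factorial, not_le]
  have H : Hy k p W := ⟨fun t => (hp1 t).1, hinj, fun t => (hcop _ (hp1 t).1).2 (hp1 t).2.1, fun t => by rw [← hD]; exact (hp1 t).2.1.le, hW1⟩
  have hWR : W * R ^2 ≤ N := by
    rw [hN]
    calc W * R ^2 ≤ R * R ^2 := Nat.mul_le_mul_right _ ((Nat.le_self_pow two_ne_zero W).trans (by omega))
      _ = R ^3 := by ring
      _ ≤ _ := Nat.pow_le_pow_right hR1 (by norm_num)
  have hY : (W * R ^2) ^16 ≤ N := by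
    rw [hN]
    calc (W * R ^2) ^16 = (W ^2) ^8 * R ^32 := by ring
      _ ≤ R ^8 * R ^32 := Nat.mul_le_mul_right _ (Nat.pow_le_pow_left (by omega) 8)
      _ = R ^40 := by ring
  have hQ1 :1 ≤ Q := le_trans (Nat.one_le_pow _ _ (Nat.succ_pos R0)) hQ
  have hQl : (Q:ℝ) ≤ l ^ (2 * A') := by rw [← hxA]; gcongr; linarith
  have hT := D_sum (N := N) (Q := Q) (Y := W * R ^2) (B := B) (by omega) hQ1 (Nat.mul_pos hW1 (pow_pos hR1 2)) hY
    (hL0 N Q (by rw [hlN]; linarith) (by rw [hlN]; exact hQl) hG)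
  rw [hlN] at hT
  have hQs : (l /80) ^ A' ≤ √(Q:ℝ) := by
    rw [← hxA, show x ^ (2 * A') = (x ^ A') ^2 by ring, Real.sqrt_sq (by positivity)]
    gcongr; linarith
  obtain ⟨V, hV⟩ : ∃ V, V = l ^ a := ⟨_, rfl⟩
  have hT2 := ar_T hA' hB (by positivity) hl1 hV (by positivity) hQl hQs hT
  rw [← hC] at hT2
  have hW0 : (0:ℝ) < W := by exact_mod_cast hW1
  have hk0 : (0:ℝ) < k := by exact_mod_cast hk1
  have hJ0 : (0:ℝ) < J := by exact_mod_cast (by omega :0 < J)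
  have hφ0 : (0:ℝ) < W.totient := by exact_mod_cast Nat.totient_pos.2 hW1
  have F := ar_fin (k := k) (W := W) (R := R) (l := l) (n0 := n0) (by exact_mod_cast hk1) (by exact_mod_cast hW1) hR1r hl1 (by positivity) hV hNr hT2
    (by linarith) w6 w5
  have hDr : (D:ℝ) =36 * k ^2 := by rw [hD]; push_cast; rfl
  have S := step (V := V) H hk hJ (fun t => (hp1 t).2.2) hn (fun q h1 h2 h3 => hS q h1 ((hcop q h1).1 h3) h2) hsum
    (by rw [hDr]; apply le_of_eq; field_simp; norm_num) hN hL w1 hl (by rw [hV, ha])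
    (by rw [div_le_iff₀ (by positivity)] at w4; exact w4.trans (le_of_eq (by ring))) (by omega) hWR (by omega) hno
  linarith
end

end
theorem gaps : ∃ C : ℕ, ∀ M : ℕ, ∃ n, M ≤ n ∧ nthPrime (n +1) ≤ nthPrime n + C := by
  obtain ⟨J, hJ⟩ : ∃ J : ℕ, 1228800 ≤ J := ⟨_, le_rfl⟩
  obtain ⟨k, hk⟩ : ∃ k : ℕ, k =2 ^ J := ⟨_, rfl⟩
  obtain ⟨W, hW0, hW⟩ := pairs hk hJ
  have key : ∀ M q q' : ℕ, q.Prime → q'.Prime → Nat.nth Nat.Prime M < q → q < q' → q' ≤ q + k * W →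
      ∃ n, M ≤ n ∧ nthPrime (n +1) ≤ nthPrime n + k * W := fun M q q' h1 h2 h3 h4 h5 => by
    have e1 := Nat.nth_count h1
    have e2 := Nat.nth_count h2
    refine ⟨Nat.count Nat.Prime q +1, ?_, ?_⟩
    · have : M < Nat.count Nat.Prime q := by
        rw [← e1] at h3; exact (Nat.nth_lt_nth Nat.infinite_setOf_prime).1 h3
      omega
    · simp only [nthPrime, Nat.add_sub_cancel]
      rw [e1]
      refine le_trans ?_ h5
      conv_rhs => rw [← e2]
      exact (Nat.nth_le_nth Nat.infinite_setOf_prime).2 (Nat.count_strict_mono h1 h4)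
  refine ⟨k * W, fun M => ?_⟩
  obtain ⟨j, hj, i, i', h1, h2, hne⟩ := hW (Nat.nth Nat.Prime M)
  have b1 : i.1 * W ≤ k * W := Nat.mul_le_mul_right _ i.2.le
  have b2 : i'.1 * W ≤ k * W := Nat.mul_le_mul_right _ i'.2.le
  rcases lt_or_gt_of_ne hne with h | h
  · have : i.1 * W < i'.1 * W := Nat.mul_lt_mul_of_pos_right h (by omega)
    exact key M _ _ h1 h2 (by omega) (by omega) (by omega)
  · have : i'.1 * W < i.1 * W := Nat.mul_lt_mul_of_pos_right h (by omega)
    exact key M _ _ h2 h1 (by omega) (by omega) (by omega)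

/-- (Goldston–Pintz–Yildirim, Theorem 3.4) `Δ₁ = liminf (p_{n+1} - p_n)/log p_n = 0`. -/
theorem goldston_pintz_yildirim_liminf_eq_zero :
    Filter.liminf
      (fun n : ℕ => ((nthPrime (n + 1) : ℝ) - nthPrime n) / Real.log (nthPrime n))
      Filter.atTop = 0 := by
  obtain ⟨C, hC⟩ := gaps
  have hge : ∀ n, n ≤ nthPrime n := fun n => by
    have : n - 1 + 2 ≤ Nat.nth Nat.Prime (n - 1) := Nat.add_two_le_nth_prime (n - 1)
    unfold nthPrime; omega
  have h0 : ∀ᶠ n : ℕ in atTop, 0 ≤ ((nthPrime (n + 1) : ℝ) - nthPrime n) / Real.log (nthPrime n) := .of_forall fun n => by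
    have : nthPrime n ≤ nthPrime (n + 1) := (Nat.nth_le_nth Nat.infinite_setOf_prime).2 (by omega)
    have : (nthPrime n : ℝ) ≤ nthPrime (n + 1) := by exact_mod_cast this
    exact div_nonneg (by linarith) (Real.log_natCast_nonneg _)
  have hT : Tendsto (fun n : ℕ => Real.log (nthPrime n)) atTop atTop :=
    Real.tendsto_log_atTop.comp (tendsto_natCast_atTop_atTop.comp (tendsto_atTop_mono hge tendsto_id))
  have hf : ∀ ε : ℝ, 0 < ε → ∃ᶠ n : ℕ in atTop, ((nthPrime (n + 1) : ℝ) - nthPrime n) / Real.log (nthPrime n) ≤ ε := fun ε hε => by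
    have h1 := hT.eventually_ge_atTop (C / ε + 1)
    have h2 : ∃ᶠ n : ℕ in atTop, nthPrime (n + 1) ≤ nthPrime n + C := frequently_atTop.2 fun M => hC M
    refine (h2.and_eventually h1).mono fun n ⟨a, b⟩ => ?_
    have a' : (nthPrime (n + 1) : ℝ) ≤ nthPrime n + C := by exact_mod_cast a
    have : 0 ≤ C / ε := by positivity
    rw [div_le_iff₀ (by linarith)]
    have : C / ε ≤ Real.log (nthPrime n) := by linarith
    rw [div_le_iff₀ hε] at this
    linarith
  refine le_antisymm (le_of_forall_pos_le_add fun ε hε => ?_) ?_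
  · rw [zero_add]
    exact liminf_le_of_frequently_le (hf ε hε) ⟨0, by simpa using h0⟩
  · exact le_liminf_of_le (IsCoboundedUnder.of_frequently_le (hf 1 one_pos)) h0
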